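/- Let 0 < q, r < ∞ and 1 < p < ∞ with max{q, r} < p, let u, w be weights on (0,∞), and let v be a weight on (0,∞) such that ∫_x^∞ v(t)^{1-p'} dt < ∞ for every x ∈ (0,∞). Then there exists a constant C > 0 such that (∫₀^∞ (∫_x^∞ (∫_t^∞ h(s) ds)^r u(t) dt)^{q/r} w(x) dx)^{1/q} ≤ C (∫₀^∞ h(t)^p v(t) dt)^{1/p} for all h ∈ M⁺(0,∞) if and only if E₃ < ∞ and E₅ < ∞, where E₃ := (∫₀^∞ (∫₀^t w(s) (∫_s^t u)^{q/r} ds)^{q/(p-q)} w(t) (sup_{x∈(t,∞)} (∫_t^x u)^{q/r} (∫_x^∞ v^{1-p'})^{(p-1)q/(p-q)}) dt)^{(p-q)/(pq)} and E₅ := (∫₀^∞ (∫₀^t w)^{q/(p-q)} w(t) (∫_t^∞ (∫_t^x u)^{r/(p-r)} u(x) (∫_x^∞ v^{1-p'})^{(p-1)r/(p-r)} dx)^{q(p-r)/(r(p-q))} dt)^{(p-q)/(pq)}. -/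

import Mathlib

open MeasureTheory Set ENNReal NNReal

noncomputable section

/-- Lebesgue measure restricted to `(0, ∞)`. -/
def mu0 : Measure ℝ := volume.restrict (Ioi (0 : ℝ))

/-- A weight on `(0, ∞)`: a measurable function that is positive (and finite) a.e. on `(0, ∞)`. -/
def IsWeight (v : ℝ → ℝ≥0∞) : Prop :=
  Measurable v ∧ ∀ᵐ x ∂mu0, 0 < v x ∧ v x < ∞

/-! ### Measures of half-lines -/

theorem measure_le_of_isLowerSet (ν : Measure ℝ) {S : Set ℝ} (hS : IsLowerSet S) {l : ℝ≥0∞}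
    (h : ∀ t ∈ S, ν (Iic t) ≤ l) : ν S ≤ l := by
  by_cases hmax : ∃ a ∈ S, ∀ b ∈ S, b ≤ a
  · obtain ⟨a, ha, hb⟩ := hmax
    exact (measure_mono fun b hbS => hb b hbS).trans (h a ha)
  · push Not at hmax
    have hsub : S ⊆ ⋃ q ∈ {q : ℚ | (q : ℝ) ∈ S}, Iic (q : ℝ) := by
      intro x hx
      obtain ⟨b, hb, hxb⟩ := hmax x hx
      obtain ⟨q, hq1, hq2⟩ := exists_rat_btwn hxb
      exact mem_biUnion (x := q) (hS hq2.le hb) hq1.le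
    refine (measure_mono hsub).trans ?_
    rw [measure_biUnion_eq_iSup (to_countable _)]
    · exact iSup₂_le fun q hq => h q hq
    · intro a ha b hb
      rcases le_total a b with hab | hab
      · exact ⟨b, hb, Iic_subset_Iic.2 (by exact_mod_cast hab), subset_rfl⟩
      · exact ⟨a, ha, subset_rfl, Iic_subset_Iic.2 (by exact_mod_cast hab)⟩

theorem measure_le_of_isUpperSet (ν : Measure ℝ) {S : Set ℝ} (hS : IsUpperSet S) {l : ℝ≥0∞}
    (h : ∀ t ∈ S, ν (Ici t) ≤ l) : ν S ≤ l := by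
  by_cases hmin : ∃ a ∈ S, ∀ b ∈ S, a ≤ b
  · obtain ⟨a, ha, hb⟩ := hmin
    exact (measure_mono fun b hbS => hb b hbS).trans (h a ha)
  · push Not at hmin
    have hsub : S ⊆ ⋃ q ∈ {q : ℚ | (q : ℝ) ∈ S}, Ici (q : ℝ) := by
      intro x hx
      obtain ⟨b, hb, hxb⟩ := hmin x hx
      obtain ⟨q, hq1, hq2⟩ := exists_rat_btwn hxb
      exact mem_biUnion (x := q) (hS hq1.le hb) hq2.le
    refine (measure_mono hsub).trans ?_
    rw [measure_biUnion_eq_iSup (to_countable _)]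
    · exact iSup₂_le fun q hq => h q hq
    · intro a ha b hb
      rcases le_total a b with hab | hab
      · exact ⟨a, ha, subset_rfl, Ici_subset_Ici.2 (by exact_mod_cast hab)⟩
      · exact ⟨b, hb, Ici_subset_Ici.2 (by exact_mod_cast hab), subset_rfl⟩

theorem monotone_measure_Iic (ν : Measure ℝ) : Monotone fun t => ν (Iic t) :=
  fun _ _ h => measure_mono (Iic_subset_Iic.2 h)

theorem antitone_measure_Ioi (ν : Measure ℝ) : Antitone fun t => ν (Ioi t) :=
  fun _ _ h => measure_mono (Ioi_subset_Ioi h)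

theorem measurable_measure_Iic (ν : Measure ℝ) : Measurable fun t => ν (Iic t) :=
  (monotone_measure_Iic ν).measurable

theorem measurable_measure_Ioi (ν : Measure ℝ) : Measurable fun t => ν (Ioi t) :=
  (antitone_measure_Ioi ν).measurable

theorem measure_setOf_measure_Iic_le (ν : Measure ℝ) (l : ℝ≥0∞) : ν {t | ν (Iic t) ≤ l} ≤ l :=
  measure_le_of_isLowerSet ν (fun _ _ hab ha => (monotone_measure_Iic ν hab).trans ha)
    fun _ ht => ht

theorem measure_setOf_measure_Ioi_le (ν : Measure ℝ) [NullSingletonClass ν] (l : ℝ≥0∞) :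
    ν {t | ν (Ioi t) ≤ l} ≤ l :=
  measure_le_of_isUpperSet ν (fun _ _ hab ha => (antitone_measure_Ioi ν hab).trans ha)
    fun t ht => by rw [measure_congr (Ioi_ae_eq_Ici (a := t)).symm]; exact ht

theorem measure_setOf_lt_measure_Iic (ν : Measure ℝ) {l : ℝ≥0∞} :
    ν univ - l ≤ ν {t | l < ν (Iic t)} := by
  rw [tsub_le_iff_right]
  calc ν univ ≤ ν ({t | l < ν (Iic t)} ∪ {t | ν (Iic t) ≤ l}) :=
        measure_mono fun t _ => lt_or_ge l (ν (Iic t))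
    _ ≤ _ := (measure_union_le _ _).trans (by gcongr; exact measure_setOf_measure_Iic_le ν l)

theorem mul_measure_univ_sub_le_lintegral (ν : Measure ℝ) {g : ℝ} (hg : 0 ≤ g) (l : ℝ≥0∞) :
    l ^ g * (ν univ - l) ≤ ∫⁻ t, ν (Iic t) ^ g ∂ν := by
  calc l ^ g * (ν univ - l) ≤ l ^ g * ν {t | l < ν (Iic t)} := by
        gcongr; exact measure_setOf_lt_measure_Iic ν
    _ = ∫⁻ _ in {t | l < ν (Iic t)}, l ^ g ∂ν := by simp
    _ ≤ ∫⁻ t in {t | l < ν (Iic t)}, ν (Iic t) ^ g ∂ν :=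
        setLIntegral_mono ((measurable_measure_Iic ν).pow_const g)
          fun t ht => ENNReal.rpow_le_rpow (le_of_lt ht) hg
    _ ≤ _ := setLIntegral_le_lintegral _ _

/-- A lower bound for `∫ N ^ g dN`, where `N` is the distribution function of `ν`. -/
theorem measure_univ_rpow_le_lintegral (ν : Measure ℝ) {g : ℝ} (hg : 0 ≤ g) :
    ν univ ^ (g + 1) ≤ 2 ^ (g + 1) * ∫⁻ t, ν (Iic t) ^ g ∂ν := by
  by_cases htop : ν univ = ∞
  · have := mul_measure_univ_sub_le_lintegral ν hg 1
    rw [htop] at this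
    rw [ENNReal.one_rpow, one_mul] at this
    rw [ENNReal.top_sub (by simp), top_le_iff] at this
    rw [this, ENNReal.mul_top]
    · exact le_top
    · simp
  · have := mul_measure_univ_sub_le_lintegral ν hg (ν univ / 2)
    rw [ENNReal.sub_half htop] at this
    calc ν univ ^ (g + 1) = (2 * (ν univ / 2)) ^ (g + 1) := by
          rw [ENNReal.mul_div_cancel (by simp) (by simp)]
      _ = 2 ^ (g + 1) * ((ν univ / 2) ^ g * (ν univ / 2)) := by
          rw [ENNReal.mul_rpow_of_nonneg _ _ (by linarith),
            ENNReal.rpow_add_of_nonneg (x := ν univ / 2) _ _ hg zero_le_one, ENNReal.rpow_one]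
      _ ≤ _ := by gcongr

theorem measure_rpow_le_setLIntegral (ν : Measure ℝ) (S : Set ℝ) {g : ℝ} (hg : 0 ≤ g) :
    ν S ^ (g + 1) ≤ 2 ^ (g + 1) * ∫⁻ t in S, ν (S ∩ Iic t) ^ g ∂ν := by
  have := measure_univ_rpow_le_lintegral (ν.restrict S) hg
  simpa [Measure.restrict_apply measurableSet_Iic, inter_comm] using this

theorem ennreal_rpow_le_rpow_of_nonpos {a b : ℝ≥0∞} {z : ℝ} (hz : z ≤ 0) (h : a ≤ b) :
    b ^ z ≤ a ^ z := by
  rw [← neg_neg z, ENNReal.rpow_neg, ENNReal.rpow_neg a]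
  exact ENNReal.inv_le_inv.2 (ENNReal.rpow_le_rpow h (by linarith))

theorem rpow_le_two_rpow_abs_mul {a b : ℝ≥0∞} (d : ℝ) (h1 : a ≤ 2 * b) (h2 : b ≤ a) :
    a ^ d ≤ 2 ^ |d| * b ^ d := by
  rcases le_total 0 d with hd | hd
  · rw [abs_of_nonneg hd, ← ENNReal.mul_rpow_of_nonneg _ _ hd]
    gcongr
  · calc a ^ d ≤ b ^ d := ennreal_rpow_le_rpow_of_nonpos hd h2
      _ = 1 * b ^ d := (one_mul _).symm
      _ ≤ _ := by
        gcongr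
        simpa using ENNReal.rpow_le_rpow (z := |d|) one_le_two (abs_nonneg d)

/-- A lower bound for `∫ V ^ d d(-V)`, where `V` is the survival function of `m`. -/
theorem measure_Ioi_rpow_le_setLIntegral (m : Measure ℝ) [NullSingletonClass m] {d : ℝ}
    (hd : 0 < d + 1) {t : ℝ} (ht : m (Ioi t) ≠ ∞) :
    m (Ioi t) ^ (d + 1) ≤ 2 ^ (|d| + 1) * ∫⁻ s in Ioi t, m (Ioi s) ^ d ∂m := by
  rcases eq_or_ne (m (Ioi t)) 0 with h0 | h0
  · rw [h0, ENNReal.zero_rpow_of_pos hd]; exact zero_le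
  set A := Ioi t ∩ {s | m (Ioi t) / 2 < m (Ioi s)} with hA
  have hAm : MeasurableSet A :=
    measurableSet_Ioi.inter (measurableSet_lt measurable_const (measurable_measure_Ioi m))
  have hmA : m (Ioi t) ≤ 2 * m A := by
    have : m (Ioi t) ≤ m A + m (Ioi t) / 2 := by
      refine (measure_mono (t := A ∪ {s | m (Ioi s) ≤ m (Ioi t) / 2}) ?_).trans
        ((measure_union_le _ _).trans (by gcongr; exact measure_setOf_measure_Ioi_le m _))
      intro s hs
      rcases lt_or_ge (m (Ioi t) / 2) (m (Ioi s)) with h | h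
      · exact Or.inl ⟨hs, h⟩
      · exact Or.inr h
    have h2 : m (Ioi t) / 2 ≤ m A := by
      rw [← ENNReal.sub_half ht]
      exact tsub_le_iff_right.2 this
    calc m (Ioi t) = 2 * (m (Ioi t) / 2) := by
          rw [ENNReal.mul_div_cancel (by simp) (by simp)]
      _ ≤ _ := by gcongr
  calc m (Ioi t) ^ (d + 1) = m (Ioi t) ^ d * m (Ioi t) := by
        rw [ENNReal.rpow_add _ _ h0 ht, ENNReal.rpow_one]
    _ ≤ m (Ioi t) ^ d * (2 * m A) := by gcongr
    _ = 2 * ∫⁻ _ in A, m (Ioi t) ^ d ∂m := by rw [setLIntegral_const]; ring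
    _ ≤ 2 * ∫⁻ s in A, 2 ^ |d| * m (Ioi s) ^ d ∂m := by
        gcongr 2 * ?_
        refine setLIntegral_mono (((measurable_measure_Ioi m).pow_const d).const_mul _) ?_
        intro s hs
        refine rpow_le_two_rpow_abs_mul d ?_ (antitone_measure_Ioi m (le_of_lt hs.1))
        calc m (Ioi t) = 2 * (m (Ioi t) / 2) := by
              rw [ENNReal.mul_div_cancel (by simp) (by simp)]
          _ ≤ _ := by gcongr; exact le_of_lt hs.2
    _ = 2 ^ (|d| + 1) * ∫⁻ s in A, m (Ioi s) ^ d ∂m := by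
        rw [lintegral_const_mul _ ((measurable_measure_Ioi m).pow_const d),
          ENNReal.rpow_add _ _ (by simp) (by simp), ENNReal.rpow_one]
        ring
    _ ≤ _ := by
        gcongr
        exact inter_subset_left

theorem exists_inv_two_pow_bracket {a : ℝ≥0∞} (h0 : a ≠ 0) (h1 : a ≤ 1) :
    ∃ k : ℕ, (2⁻¹ : ℝ≥0∞) ^ (k + 1) ≤ a ∧ a ≤ 2⁻¹ ^ k := by
  classical
  have hex := ENNReal.exists_inv_two_pow_lt h0
  obtain ⟨n, hn⟩ : ∃ n, Nat.find hex = n + 1 := by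
    refine Nat.exists_eq_succ_of_ne_zero fun h => ?_
    have := Nat.find_spec hex
    rw [h, pow_zero] at this
    exact absurd h1 (not_le.2 this)
  refine ⟨n, ?_, ?_⟩
  · rw [← hn]; exact (Nat.find_spec hex).le
  · exact not_lt.1 (Nat.find_min hex (by omega))

theorem tsum_two_inv_pow_rpow_lt_top {e : ℝ} (he : 0 < e) :
    ∑' k : ℕ, ((2⁻¹ : ℝ≥0∞) ^ k) ^ e < ∞ := by
  have : ∀ k : ℕ, ((2⁻¹ : ℝ≥0∞) ^ k) ^ e = ((2⁻¹ : ℝ≥0∞) ^ e) ^ k := fun k => by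
    rw [← ENNReal.rpow_natCast, ← ENNReal.rpow_natCast, ← ENNReal.rpow_mul, ← ENNReal.rpow_mul,
      mul_comm]
  simp_rw [this]
  rw [ENNReal.tsum_geometric, ENNReal.inv_lt_top, tsub_pos_iff_lt]
  exact ENNReal.rpow_lt_one (by simp) he

/-- An upper bound for `∫ V ^ (e - 1) d(-V)`, where `V` is the survival function of `m`. -/
theorem exists_setLIntegral_measure_Ioi_rpow_le {e : ℝ} (he : 0 < e) :
    ∃ C : ℝ≥0, ∀ (m : Measure ℝ) [NullSingletonClass m] (t : ℝ), m (Ioi t) ≠ ∞ →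
      ∫⁻ s in Ioi t, m (Ioi s) ^ (e - 1) ∂m ≤ C * m (Ioi t) ^ e := by
  rcases le_total 1 e with h1 | h1
  · refine ⟨1, fun m _ t ht => ?_⟩
    calc ∫⁻ s in Ioi t, m (Ioi s) ^ (e - 1) ∂m ≤ ∫⁻ _ in Ioi t, m (Ioi t) ^ (e - 1) ∂m := by
          refine setLIntegral_mono measurable_const fun s hs => ?_
          exact ENNReal.rpow_le_rpow (antitone_measure_Ioi m (le_of_lt hs)) (by linarith)
      _ = m (Ioi t) ^ (e - 1) * m (Ioi t) ^ (1 : ℝ) := by simp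
      _ = _ := by rw [← ENNReal.rpow_add_of_nonneg _ _ (by linarith) zero_le_one]; simp
  · set K : ℝ≥0∞ := 2 ^ (1 - e) * ∑' k : ℕ, ((2⁻¹ : ℝ≥0∞) ^ k) ^ e with hK
    have hKtop : K ≠ ∞ := ENNReal.mul_ne_top (by simp) (tsum_two_inv_pow_rpow_lt_top he).ne
    refine ⟨K.toNNReal, fun m _ t ht => ?_⟩
    rw [ENNReal.coe_toNNReal hKtop]
    set a := m (Ioi t) with ha
    rcases eq_or_ne a 0 with h0 | h0
    · rw [Measure.restrict_eq_zero.2 h0]; simp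
    let f : ℕ → ℝ → ℝ≥0∞ := fun k =>
      {s | m (Ioi s) ≤ 2⁻¹ ^ k * a}.indicator fun _ => (2⁻¹ ^ (k + 1) * a) ^ (e - 1)
    have hfm : ∀ k, MeasurableSet {s | m (Ioi s) ≤ 2⁻¹ ^ k * a} := fun k =>
      measurableSet_le (measurable_measure_Ioi m) measurable_const
    have hpt : ∀ᵐ s ∂m.restrict (Ioi t), m (Ioi s) ^ (e - 1) ≤ ∑' k, f k s := by
      have hz : ∀ᵐ s ∂m.restrict (Ioi t), ¬ m (Ioi s) ≤ 0 := by
        refine ae_restrict_of_ae ?_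
        rw [ae_iff]
        simpa using measure_setOf_measure_Ioi_le m 0
      filter_upwards [hz, ae_restrict_mem measurableSet_Ioi] with s hs hst
      have hs0 : m (Ioi s) ≠ 0 := fun h => hs h.le
      have hle : m (Ioi s) ≤ a := antitone_measure_Ioi m (le_of_lt hst)
      obtain ⟨k, hk1, hk2⟩ := exists_inv_two_pow_bracket (a := m (Ioi s) / a)
        (ENNReal.div_ne_zero.2 ⟨hs0, ht⟩) (ENNReal.div_le_of_le_mul (by simpa using hle))
      have hk1' : 2⁻¹ ^ (k + 1) * a ≤ m (Ioi s) := by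
        rwa [ENNReal.le_div_iff_mul_le (Or.inl h0) (Or.inl ht)] at hk1
      have hk2' : m (Ioi s) ≤ 2⁻¹ ^ k * a := by
        rwa [ENNReal.div_le_iff_le_mul (Or.inl h0) (Or.inl ht)] at hk2
      refine le_trans ?_ (ENNReal.le_tsum k)
      have : s ∈ {s | m (Ioi s) ≤ 2⁻¹ ^ k * a} := hk2'
      simp only [f, indicator_of_mem this]
      exact ennreal_rpow_le_rpow_of_nonpos (by linarith) hk1'
    calc ∫⁻ s in Ioi t, m (Ioi s) ^ (e - 1) ∂m ≤ ∫⁻ s in Ioi t, ∑' k, f k s ∂m :=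
          lintegral_mono_ae hpt
      _ ≤ ∫⁻ s, ∑' k, f k s ∂m := setLIntegral_le_lintegral _ _
      _ = ∑' k, ∫⁻ s, f k s ∂m :=
          lintegral_tsum fun k => (measurable_const.indicator (hfm k)).aemeasurable
      _ ≤ ∑' k : ℕ, 2 ^ (1 - e) * ((2⁻¹ : ℝ≥0∞) ^ k) ^ e * a ^ e := by
          refine ENNReal.tsum_le_tsum fun k => ?_
          rw [lintegral_indicator_const (hfm k)]
          have hb0 : (2⁻¹ : ℝ≥0∞) ^ k * a ≠ 0 := mul_ne_zero (by simp) h0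
          have hbt : (2⁻¹ : ℝ≥0∞) ^ k * a ≠ ∞ := ENNReal.mul_ne_top (by simp) ht
          calc ((2⁻¹ : ℝ≥0∞) ^ (k + 1) * a) ^ (e - 1) * m {s | m (Ioi s) ≤ 2⁻¹ ^ k * a}
              ≤ ((2⁻¹ : ℝ≥0∞) ^ (k + 1) * a) ^ (e - 1) * (2⁻¹ ^ k * a) := by
                gcongr; exact measure_setOf_measure_Ioi_le m _
            _ = (2⁻¹ * (2⁻¹ ^ k * a)) ^ (e - 1) * (2⁻¹ ^ k * a) ^ (1 : ℝ) := by
                rw [ENNReal.rpow_one, pow_succ]; ring_nf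
            _ = 2⁻¹ ^ (e - 1) * ((2⁻¹ ^ k * a) ^ (e - 1) * (2⁻¹ ^ k * a) ^ (1 : ℝ)) := by
                rw [ENNReal.mul_rpow_of_ne_top (by simp) hbt, mul_assoc]
            _ = 2 ^ (1 - e) * (2⁻¹ ^ k * a) ^ e := by
                rw [← ENNReal.rpow_add _ _ hb0 hbt, ENNReal.inv_rpow, ← ENNReal.rpow_neg]
                congr 2 <;> ring
            _ = _ := by rw [ENNReal.mul_rpow_of_nonneg _ _ he.le, mul_assoc]
      _ = K * a ^ e := by rw [ENNReal.tsum_mul_right, ENNReal.tsum_mul_left]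

/-! ### Hardy's inequality with general measures -/

theorem tsum_rpow_mul_rpow_le {ι : Type*} (a b : ι → ℝ≥0∞) {s t : ℝ} (hs : 0 ≤ s) (ht : 0 ≤ t)
    (hst : s + t = 1) :
    ∑' i, a i ^ s * b i ^ t ≤ (∑' i, a i) ^ s * (∑' i, b i) ^ t := by
  let _ : MeasurableSpace ι := ⊤
  have := ENNReal.lintegral_mul_norm_pow_le (μ := Measure.count) (f := a) (g := b)
    measurable_from_top.aemeasurable measurable_from_top.aemeasurable hs ht hst
  simpa only [lintegral_count] using this

theorem setLIntegral_le_rpow_mul_measure_rpow {p : ℝ} (hp : 1 < p) (m : Measure ℝ) {f : ℝ → ℝ≥0∞}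
    (hf : Measurable f) (P : Set ℝ) :
    ∫⁻ t in P, f t ∂m ≤ (∫⁻ t in P, f t ^ p ∂m) ^ (1 / p) * m P ^ ((p - 1) / p) := by
  have h := ENNReal.lintegral_mul_norm_pow_le (μ := m.restrict P) (f := fun t => f t ^ p)
    (g := fun _ => 1) (hf.pow_const p).aemeasurable aemeasurable_const
    (p := 1 / p) (q := (p - 1) / p) (by positivity) (div_nonneg (by linarith) (by linarith))
    (by field_simp; ring)
  have hp0 : p ≠ 0 := by positivity
  simpa [← ENNReal.rpow_mul, hp0] using h

theorem pairwise_disjoint_dyadic (H : ℝ → ℝ≥0∞) :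
    Pairwise (Function.onFun Disjoint
      fun k : ℤ => {t | (2 : ℝ≥0∞) ^ k ≤ H t ∧ H t < 2 ^ (k + 1)}) := by
  have key : ∀ i j : ℤ, i < j → Disjoint {t | (2 : ℝ≥0∞) ^ i ≤ H t ∧ H t < 2 ^ (i + 1)}
      {t | (2 : ℝ≥0∞) ^ j ≤ H t ∧ H t < 2 ^ (j + 1)} := by
    intro i j hij
    refine Set.disjoint_left.2 fun t hi hj => ?_
    have := ENNReal.zpow_le_of_le one_le_two (show i + 1 ≤ j by omega)
    exact absurd (hi.2.trans_le (this.trans hj.1)) (lt_irrefl _)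
  intro i j hij
  rcases lt_or_gt_of_ne hij with h | h
  · exact key i j h
  · exact (key j i h).symm

theorem half_two_zpow_le_of_dyadic {p : ℝ} (hp : 1 < p) (m : Measure ℝ) [NullSingletonClass m]
    {f : ℝ → ℝ≥0∞} (hf : Measurable f) {t : ℝ} {c : ℝ≥0∞} (hc : c ≠ ∞)
    (ht : c ≤ ∫⁻ s in Ioi t, f s ∂m) (ht' : ∫⁻ s in Ioi t, f s ∂m < 2 * c) :
    c / 2 ≤ (∫⁻ s in {s | c ≤ 2 * ∫⁻ x in Ioi s, f x ∂m ∧ ∫⁻ x in Ioi s, f x ∂m < 2 * c},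
      f s ^ p ∂m) ^ (1 / p) * m (Ioi t) ^ ((p - 1) / p) := by
  set P := {s | c ≤ 2 * ∫⁻ x in Ioi s, f x ∂m ∧ ∫⁻ x in Ioi s, f x ∂m < 2 * c} with hP
  set η := m.withDensity f with hη
  have hηI : ∀ s, η (Ioi s) = ∫⁻ x in Ioi s, f x ∂m := fun s =>
    withDensity_apply f measurableSet_Ioi
  have h1 : c ≤ η (Ioi t ∩ P) + c / 2 := by
    calc c ≤ η (Ioi t) := by rwa [hηI]
      _ ≤ η (Ioi t ∩ P ∪ {s | η (Ioi s) ≤ c / 2}) := by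
          refine measure_mono fun s hs => ?_
          have hle : η (Ioi s) ≤ η (Ioi t) := antitone_measure_Ioi η (le_of_lt hs)
          rcases le_total (η (Ioi s)) (c / 2) with h | h
          · exact Or.inr h
          · refine Or.inl ⟨hs, ?_, ?_⟩
            · rw [← hηI]
              rwa [ENNReal.div_le_iff_le_mul (by simp) (by simp), mul_comm] at h
            · rw [← hηI]; rw [hηI t] at hle; exact hle.trans_lt ht'
      _ ≤ _ := (measure_union_le _ _).trans (by gcongr; exact measure_setOf_measure_Ioi_le η _)
  have h2 : c / 2 ≤ η (Ioi t ∩ P) := by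
    rw [← ENNReal.sub_half hc]
    exact tsub_le_iff_right.2 h1
  have hHm : Measurable fun s => ∫⁻ x in Ioi s, f x ∂m := by
    simp_rw [← hηI]; exact measurable_measure_Ioi η
  have hPm : MeasurableSet P :=
    (measurableSet_le measurable_const (hHm.const_mul 2)).inter
      (measurableSet_lt hHm measurable_const)
  calc c / 2 ≤ ∫⁻ s in Ioi t ∩ P, f s ∂m := by
        rwa [← withDensity_apply f (measurableSet_Ioi.inter hPm)]
    _ ≤ _ := setLIntegral_le_rpow_mul_measure_rpow hp m hf _
    _ ≤ _ := by
        have hp' : 0 ≤ (p - 1) / p := div_nonneg (by linarith) (by linarith)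
        gcongr
        · exact inter_subset_right
        · exact inter_subset_left

theorem setLIntegral_dyadic_le {p r : ℝ} (hp : 1 < p) (hr : 0 < r) (hrp : r < p)
    (m ν : Measure ℝ) {H : ℝ → ℝ≥0∞} (hH : Measurable H) {c A : ℝ≥0∞} (hc0 : c ≠ 0)
    (hA : A ≠ ∞)
    (hcA : ∀ t ∈ {t | c ≤ H t ∧ H t < 2 * c}, c / 2 ≤ A ^ (1 / p) * m (Ioi t) ^ ((p - 1) / p)) :
    ∫⁻ t in {t | c ≤ H t ∧ H t < 2 * c}, H t ^ r ∂ν ≤ (4 ^ r * 2) * (A ^ (r / p) *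
      (∫⁻ t in {t | c ≤ H t ∧ H t < 2 * c},
        ν (Iic t) ^ (r / (p - r)) * m (Ioi t) ^ ((p - 1) * r / (p - r)) ∂ν) ^ ((p - r) / p)) := by
  set L := {t | c ≤ H t ∧ H t < 2 * c} with hL
  have hLm : MeasurableSet L :=
    (measurableSet_le measurable_const hH).inter (measurableSet_lt hH measurable_const)
  rcases L.eq_empty_or_nonempty with hE | ⟨t₀, ht₀⟩
  · simp [hE]
  have hp0 : 0 < p := by linarith
  have hpr : 0 < p - r := by linarith
  have hA0 : A ≠ 0 := by
    rintro rfl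
    have := hcA t₀ ht₀
    rw [ENNReal.zero_rpow_of_pos (by positivity), zero_mul, nonpos_iff_eq_zero,
      ENNReal.div_eq_zero_iff] at this
    simp [hc0] at this
  set B := A ^ (1 / p) with hB
  have hB0 : B ≠ 0 := (ENNReal.rpow_pos (pos_iff_ne_zero.2 hA0) hA).ne'
  have hBt : B ≠ ∞ := ENNReal.rpow_ne_top_of_nonneg (by positivity) hA
  set κ := c / 2 / B with hκ
  have hBκ : 4 * (B * κ) = 2 * c := by
    rw [hκ, ENNReal.mul_div_cancel hB0 hBt]
    calc 4 * (c / 2) = 2 * (2 * (c / 2)) := by ring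
      _ = 2 * c := by rw [ENNReal.mul_div_cancel (by simp) (by simp)]
  have hκV : ∀ t ∈ L, κ ^ (p * r / (p - r)) ≤ m (Ioi t) ^ ((p - 1) * r / (p - r)) := by
    intro t ht
    have h1 : κ ≤ m (Ioi t) ^ ((p - 1) / p) := by
      refine ENNReal.div_le_of_le_mul ?_
      rw [mul_comm]; exact hcA t ht
    have h2 := ENNReal.rpow_le_rpow h1 (show 0 ≤ p * r / (p - r) by positivity)
    rw [← ENNReal.rpow_mul] at h2
    convert h2 using 2
    field_simp
  have hγ : 0 ≤ r / (p - r) := by positivity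
  set J := ∫⁻ t in L, ν (Iic t) ^ (r / (p - r)) * m (Ioi t) ^ ((p - 1) * r / (p - r)) ∂ν with hJ
  have h1 : κ ^ (p * r / (p - r)) * ν L ^ (r / (p - r) + 1) ≤ 2 ^ (r / (p - r) + 1) * J := by
    calc κ ^ (p * r / (p - r)) * ν L ^ (r / (p - r) + 1)
        ≤ κ ^ (p * r / (p - r)) *
          (2 ^ (r / (p - r) + 1) * ∫⁻ t in L, ν (L ∩ Iic t) ^ (r / (p - r)) ∂ν) := by
          gcongr; exact measure_rpow_le_setLIntegral ν L hγ
      _ ≤ κ ^ (p * r / (p - r)) *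
          (2 ^ (r / (p - r) + 1) * ∫⁻ t in L, ν (Iic t) ^ (r / (p - r)) ∂ν) := by
          gcongr; exact inter_subset_right
      _ = 2 ^ (r / (p - r) + 1) *
          ∫⁻ t in L, ν (Iic t) ^ (r / (p - r)) * κ ^ (p * r / (p - r)) ∂ν := by
          rw [lintegral_mul_const _ ((measurable_measure_Iic ν).pow_const _)]; ring
      _ ≤ _ := by
          gcongr 2 ^ (r / (p - r) + 1) * ?_
          refine setLIntegral_mono' hLm fun t ht => ?_
          gcongr; exact hκV t ht
  have h2 : κ ^ r * ν L ≤ 2 * J ^ ((p - r) / p) := by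
    have h := ENNReal.rpow_le_rpow h1 (show 0 ≤ (p - r) / p by positivity)
    rw [ENNReal.mul_rpow_of_nonneg _ _ (by positivity),
      ENNReal.mul_rpow_of_nonneg _ _ (by positivity), ← ENNReal.rpow_mul, ← ENNReal.rpow_mul,
      ← ENNReal.rpow_mul] at h
    have e1 : p * r / (p - r) * ((p - r) / p) = r := by field_simp
    have e2 : (r / (p - r) + 1) * ((p - r) / p) = 1 := by field_simp; ring
    rwa [e1, e2, ENNReal.rpow_one, ENNReal.rpow_one] at h
  calc ∫⁻ t in L, H t ^ r ∂ν ≤ ∫⁻ _ in L, (4 * (B * κ)) ^ r ∂ν := by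
        refine setLIntegral_mono' hLm fun t ht => ?_
        rw [hBκ]
        exact ENNReal.rpow_le_rpow ht.2.le hr.le
    _ = 4 ^ r * (B ^ r * (κ ^ r * ν L)) := by
        rw [setLIntegral_const, ENNReal.mul_rpow_of_nonneg _ _ hr.le,
          ENNReal.mul_rpow_of_nonneg _ _ hr.le]
        ring
    _ ≤ 4 ^ r * (B ^ r * (2 * J ^ ((p - r) / p))) := by gcongr
    _ = _ := by
        rw [hB, ← ENNReal.rpow_mul, show 1 / p * r = r / p by ring]; ring

/-- Hardy's inequality for `0 < r < p`, `1 < p`, with general measures: sufficiency of the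
Maz'ya–Sinnamon condition. -/
theorem exists_hardy_le {p r : ℝ} (hp : 1 < p) (hr : 0 < r) (hrp : r < p) :
    ∃ C : ℝ≥0, ∀ (m ν : Measure ℝ) [NullSingletonClass m], (∀ᵐ t ∂ν, m (Ioi t) ≠ ∞) →
      ∀ f : ℝ → ℝ≥0∞, Measurable f → ∫⁻ t, f t ^ p ∂m ≠ ∞ →
      ∫⁻ t, (∫⁻ s in Ioi t, f s ∂m) ^ r ∂ν ≤
        C * (∫⁻ t, ν (Iic t) ^ (r / (p - r)) * m (Ioi t) ^ ((p - 1) * r / (p - r)) ∂ν) ^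
          ((p - r) / p) * (∫⁻ t, f t ^ p ∂m) ^ (r / p) := by
  have hp0 : 0 < p := by linarith
  have hpr : 0 < p - r := by linarith
  have hK : (4 ^ r * 2 * 2 ^ (r / p) : ℝ≥0∞) ≠ ∞ := by
    refine ENNReal.mul_ne_top (ENNReal.mul_ne_top ?_ (by simp)) ?_ <;>
    exact ENNReal.rpow_ne_top_of_nonneg (by positivity) (by simp)
  refine ⟨(4 ^ r * 2 * 2 ^ (r / p) : ℝ≥0∞).toNNReal, fun m ν _ hν f hf hF => ?_⟩
  rw [ENNReal.coe_toNNReal hK]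
  set H : ℝ → ℝ≥0∞ := fun t => ∫⁻ s in Ioi t, f s ∂m with hHdef
  have hHm : Measurable H := by
    have : H = fun t => m.withDensity f (Ioi t) := by
      ext t; rw [withDensity_apply f measurableSet_Ioi]
    rw [this]; exact measurable_measure_Ioi _
  have hHtop : ∀ᵐ t ∂ν, H t ≠ ∞ := by
    filter_upwards [hν] with t ht
    refine ne_top_of_le_ne_top ?_ (setLIntegral_le_rpow_mul_measure_rpow hp m hf (Ioi t))
    refine ENNReal.mul_ne_top (ENNReal.rpow_ne_top_of_nonneg (by positivity) ?_)
      (ENNReal.rpow_ne_top_of_nonneg (div_nonneg (by linarith) hp0.le) ht)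
    exact ne_top_of_le_ne_top hF (setLIntegral_le_lintegral _ _)
  let L : ℤ → Set ℝ := fun k => {t | (2 : ℝ≥0∞) ^ k ≤ H t ∧ H t < 2 ^ (k + 1)}
  have hLm : ∀ k, MeasurableSet (L k) := fun k =>
    (measurableSet_le measurable_const hHm).inter (measurableSet_lt hHm measurable_const)
  have hLd : Pairwise (Function.onFun Disjoint L) := pairwise_disjoint_dyadic H
  have hz : ∀ k : ℤ, (2 : ℝ≥0∞) ^ (k + 1) = 2 * 2 ^ k := fun k => by
    rw [ENNReal.zpow_add (by simp) (by simp), zpow_one, mul_comm]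
  let P : ℤ → Set ℝ := fun k => {t | (2 : ℝ≥0∞) ^ k ≤ 2 * H t ∧ H t < 2 * 2 ^ k}
  let a : ℤ → ℝ≥0∞ := fun k => ∫⁻ t in P k, f t ^ p ∂m
  let φ : ℝ → ℝ≥0∞ := fun t => ν (Iic t) ^ (r / (p - r)) * m (Ioi t) ^ ((p - 1) * r / (p - r))
  have hlevel : ∀ k, ∫⁻ t in L k, H t ^ r ∂ν ≤
      (4 ^ r * 2) * (a k ^ (r / p) * (∫⁻ t in L k, φ t ∂ν) ^ ((p - r) / p)) := by
    intro k
    have hLk : L k = {t | (2 : ℝ≥0∞) ^ k ≤ H t ∧ H t < 2 * 2 ^ k} := by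
      simp only [L, hz]
    have hc : (2 : ℝ≥0∞) ^ k ≠ ∞ := (ENNReal.zpow_lt_top (by simp) (by simp) k).ne
    rw [hLk]
    refine setLIntegral_dyadic_le hp hr hrp m ν hHm (ENNReal.zpow_pos (by simp) (by simp) k).ne'
      (ne_top_of_le_ne_top hF (setLIntegral_le_lintegral _ _)) fun t ht => ?_
    exact half_two_zpow_le_of_dyadic hp m hf hc ht.1 ht.2
  have hsplit : ∫⁻ t, H t ^ r ∂ν ≤ ∑' k, ∫⁻ t in L k, H t ^ r ∂ν := by
    rw [← lintegral_iUnion hLm hLd, ← lintegral_indicator (MeasurableSet.iUnion hLm)]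
    refine lintegral_mono_ae ?_
    filter_upwards [hHtop] with t ht
    rcases eq_or_ne (H t) 0 with h0 | h0
    · rw [h0, ENNReal.zero_rpow_of_pos hr]; exact zero_le
    · obtain ⟨k, hk⟩ := ENNReal.exists_mem_Ico_zpow h0 ht one_lt_two (by simp)
      have hkL : t ∈ L k := ⟨hk.1, hk.2⟩
      rw [indicator_of_mem (mem_iUnion_of_mem k hkL)]
  have hφ : ∑' k, ∫⁻ t in L k, φ t ∂ν ≤ ∫⁻ t, φ t ∂ν := by
    rw [← lintegral_iUnion hLm hLd]; exact setLIntegral_le_lintegral _ _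
  have ha : ∑' k, a k ≤ 2 * ∫⁻ t, f t ^ p ∂m := by
    have hsum : ∑' k, ∫⁻ t in L k, f t ^ p ∂m ≤ ∫⁻ t, f t ^ p ∂m := by
      rw [← lintegral_iUnion hLm hLd]; exact setLIntegral_le_lintegral _ _
    have hak : ∀ k, a k ≤ (∫⁻ t in L (k - 1), f t ^ p ∂m) + ∫⁻ t in L k, f t ^ p ∂m := by
      intro k
      refine (lintegral_mono_set ?_).trans (lintegral_union_le _ _ _)
      intro t ht
      rcases lt_or_ge (H t) (2 ^ k) with h | h
      · refine Or.inl ⟨?_, by simpa using h⟩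
        have h1 := ht.1
        have h2 := hz (k - 1)
        rw [sub_add_cancel] at h2
        rw [h2] at h1
        exact (ENNReal.mul_le_mul_iff_right (by simp) (by simp)).1 h1
      · exact Or.inr ⟨h, by rw [hz]; exact ht.2⟩
    calc ∑' k, a k ≤ ∑' k, ((∫⁻ t in L (k - 1), f t ^ p ∂m) + ∫⁻ t in L k, f t ^ p ∂m) :=
          ENNReal.tsum_le_tsum hak
      _ = (∑' k, ∫⁻ t in L (k - 1), f t ^ p ∂m) + ∑' k, ∫⁻ t in L k, f t ^ p ∂m :=
          ENNReal.tsum_add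
      _ = 2 * ∑' k, ∫⁻ t in L k, f t ^ p ∂m := by
          rw [two_mul]
          congr 1
          exact (Equiv.subRight (1 : ℤ)).tsum_eq fun k => ∫⁻ t in L k, f t ^ p ∂m
      _ ≤ _ := by gcongr
  calc ∫⁻ t, H t ^ r ∂ν ≤ ∑' k, ∫⁻ t in L k, H t ^ r ∂ν := hsplit
    _ ≤ ∑' k, (4 ^ r * 2) * (a k ^ (r / p) * (∫⁻ t in L k, φ t ∂ν) ^ ((p - r) / p)) :=
        ENNReal.tsum_le_tsum hlevel
    _ = (4 ^ r * 2) * ∑' k, a k ^ (r / p) * (∫⁻ t in L k, φ t ∂ν) ^ ((p - r) / p) :=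
        ENNReal.tsum_mul_left
    _ ≤ (4 ^ r * 2) * ((∑' k, a k) ^ (r / p) * (∑' k, ∫⁻ t in L k, φ t ∂ν) ^ ((p - r) / p)) := by
        gcongr
        exact tsum_rpow_mul_rpow_le _ _ (by positivity) (by positivity) (by field_simp; ring)
    _ ≤ (4 ^ r * 2) * ((2 * ∫⁻ t, f t ^ p ∂m) ^ (r / p) * (∫⁻ t, φ t ∂ν) ^ ((p - r) / p)) := by
        gcongr
    _ = _ := by
        rw [ENNReal.mul_rpow_of_nonneg _ _ (by positivity)]; ring

theorem le_rpow_of_le_mul_rpow {X D : ℝ≥0∞} {s : ℝ} (hs1 : s < 1) (hX : X ≠ ∞)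
    (h : X ≤ D * X ^ s) : X ≤ D ^ (1 / (1 - s)) := by
  rcases eq_or_ne X 0 with h0 | h0
  · rw [h0]; exact zero_le
  have hXs0 : X ^ s ≠ 0 := (ENNReal.rpow_pos (pos_iff_ne_zero.2 h0) hX).ne'
  have hXst : X ^ s ≠ ∞ := by
    rw [ne_eq, ENNReal.rpow_eq_top_iff]; tauto
  have h1 : X ^ (1 - s) * X ^ s ≤ D * X ^ s := by
    rwa [← ENNReal.rpow_add _ _ h0 hX, sub_add_cancel, ENNReal.rpow_one]
  have h2 : X ^ (1 - s) ≤ D := (ENNReal.mul_le_mul_iff_left hXs0 hXst).1 h1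
  have hs : 0 < 1 - s := by linarith
  have h3 := ENNReal.rpow_le_rpow h2 (show 0 ≤ 1 / (1 - s) by positivity)
  rwa [← ENNReal.rpow_mul, mul_one_div_cancel hs.ne', ENNReal.rpow_one] at h3

theorem lintegral_hardy_test_le {g e : ℝ} (hg : 0 ≤ g) (he : 0 < e) :
    ∃ C : ℝ≥0, ∀ (m ν : Measure ℝ) [NullSingletonClass m] [SFinite m] [SFinite ν],
      (∀ᵐ t ∂ν, m (Ioi t) ≠ ∞) →
      ∫⁻ s, ν (Iic s) ^ (g + 1) * m (Ioi s) ^ (e - 1) ∂m ≤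
        C * ∫⁻ t, ν (Iic t) ^ g * m (Ioi t) ^ e ∂ν := by
  obtain ⟨C, hC⟩ := exists_setLIntegral_measure_Ioi_rpow_le he
  have h2 : (2 ^ (g + 1) : ℝ≥0∞) ≠ ∞ := ENNReal.rpow_ne_top_of_nonneg (by linarith) (by simp)
  refine ⟨(2 ^ (g + 1) : ℝ≥0∞).toNNReal * C, fun m ν _ _ _ hν => ?_⟩
  rw [ENNReal.coe_mul, ENNReal.coe_toNNReal h2]
  have hVm := measurable_measure_Ioi m
  have hNm := measurable_measure_Iic ν
  have hmeas : Measurable (Function.uncurry fun s t : ℝ =>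
      m (Ioi s) ^ (e - 1) * (Iic s).indicator (fun t => ν (Iic t) ^ g) t) := by
    refine ((hVm.comp measurable_fst).pow_const _).mul ?_
    exact ((hNm.comp measurable_snd).pow_const g).indicator
      (measurableSet_le measurable_snd measurable_fst)
  calc ∫⁻ s, ν (Iic s) ^ (g + 1) * m (Ioi s) ^ (e - 1) ∂m
      ≤ ∫⁻ s, 2 ^ (g + 1) *
          ∫⁻ t, m (Ioi s) ^ (e - 1) * (Iic s).indicator (fun t => ν (Iic t) ^ g) t ∂ν ∂m := by
        refine lintegral_mono fun s => ?_
        have h := measure_rpow_le_setLIntegral ν (Iic s) hg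
        have h' : ∫⁻ t in Iic s, ν (Iic s ∩ Iic t) ^ g ∂ν ≤
            ∫⁻ t, (Iic s).indicator (fun t => ν (Iic t) ^ g) t ∂ν := by
          rw [lintegral_indicator measurableSet_Iic]
          refine lintegral_mono fun t => ?_
          gcongr; exact inter_subset_right
        simp only
        rw [lintegral_const_mul _ ((hNm.pow_const g).indicator measurableSet_Iic)]
        calc ν (Iic s) ^ (g + 1) * m (Ioi s) ^ (e - 1)
            ≤ 2 ^ (g + 1) * (∫⁻ t, (Iic s).indicator (fun t => ν (Iic t) ^ g) t ∂ν) *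
              m (Ioi s) ^ (e - 1) := by gcongr; exact h.trans (by gcongr)
          _ = _ := by ring
    _ = 2 ^ (g + 1) *
          ∫⁻ t, ∫⁻ s, m (Ioi s) ^ (e - 1) * (Iic s).indicator (fun t => ν (Iic t) ^ g) t ∂m ∂ν := by
        rw [lintegral_const_mul' _ _ h2, lintegral_lintegral_swap hmeas.aemeasurable]
    _ ≤ 2 ^ (g + 1) * ∫⁻ t, C * (ν (Iic t) ^ g * m (Ioi t) ^ e) ∂ν := by
        gcongr 2 ^ (g + 1) * ?_
        refine lintegral_mono_ae ?_
        filter_upwards [hν] with t ht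
        have : ∀ s, m (Ioi s) ^ (e - 1) * (Iic s).indicator (fun t => ν (Iic t) ^ g) t =
            ν (Iic t) ^ g * (Ici t).indicator (fun s => m (Ioi s) ^ (e - 1)) s := by
          intro s
          by_cases hts : t ≤ s
          · rw [indicator_of_mem (mem_Iic.2 hts), indicator_of_mem (mem_Ici.2 hts), mul_comm]
          · rw [indicator_of_notMem (by simpa using hts), indicator_of_notMem (by simpa using hts),
              mul_zero, mul_zero]
        simp_rw [this]
        rw [lintegral_const_mul _ ((hVm.pow_const _).indicator measurableSet_Ici),
          lintegral_indicator measurableSet_Ici, setLIntegral_congr (Ioi_ae_eq_Ici (a := t)).symm]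
        calc ν (Iic t) ^ g * ∫⁻ s in Ioi t, m (Ioi s) ^ (e - 1) ∂m
            ≤ ν (Iic t) ^ g * (C * m (Ioi t) ^ e) := by gcongr; exact hC m t ht
          _ = _ := by ring
    _ = _ := by
        rw [lintegral_const_mul' _ _ ENNReal.coe_ne_top, mul_assoc]

theorem exists_le_of_hardy_le_aux {p r : ℝ} (hp : 1 < p) (hr : 0 < r) (hrp : r < p) :
    ∃ C : ℝ≥0, ∀ (m ν : Measure ℝ) [NullSingletonClass m] [SFinite m] [SFinite ν],
      (∀ᵐ t ∂ν, m (Ioi t) ≠ ∞) → ∀ B : ℝ≥0∞,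
      (∀ f : ℝ → ℝ≥0∞, Measurable f →
        ∫⁻ t, (∫⁻ s in Ioi t, f s ∂m) ^ r ∂ν ≤ B * (∫⁻ t, f t ^ p ∂m) ^ (r / p)) →
      ∫⁻ t, ν (Iic t) ^ (r / (p - r)) * m (Ioi t) ^ ((p - 1) * r / (p - r)) ∂ν ≠ ∞ →
      ∫⁻ t, ν (Iic t) ^ (r / (p - r)) * m (Ioi t) ^ ((p - 1) * r / (p - r)) ∂ν ≤
        C * B ^ (p / (p - r)) := by
  have hp0 : 0 < p := by linarith
  have hp1 : 0 < p - 1 := by linarith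
  have hpr : 0 < p - r := by linarith
  obtain ⟨C, hC⟩ := lintegral_hardy_test_le (g := r / (p - r)) (e := (p - 1) * r / (p - r))
    (by positivity) (by positivity)
  set d := (r - 1) / (p - r) with hd
  have hd1 : d + 1 = (p - 1) / (p - r) := by rw [hd]; field_simp; ring
  set K : ℝ≥0∞ := (2 ^ (|d| + 1)) ^ r * (C : ℝ≥0∞) ^ (r / p) with hK
  have hKt : K ^ (p / (p - r)) ≠ ∞ := by
    refine ENNReal.rpow_ne_top_of_nonneg (by positivity) (ENNReal.mul_ne_top ?_ ?_)
    · exact ENNReal.rpow_ne_top_of_nonneg hr.le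
        (ENNReal.rpow_ne_top_of_nonneg (by positivity) (by simp))
    · exact ENNReal.rpow_ne_top_of_nonneg (by positivity) (by simp)
  refine ⟨(K ^ (p / (p - r))).toNNReal, fun m ν _ _ _ hν B hB hX => ?_⟩
  rw [ENNReal.coe_toNNReal hKt]
  set X := ∫⁻ t, ν (Iic t) ^ (r / (p - r)) * m (Ioi t) ^ ((p - 1) * r / (p - r)) ∂ν with hXdef
  have hVm := measurable_measure_Ioi m
  have hNm := measurable_measure_Iic ν
  let f : ℝ → ℝ≥0∞ := fun s => ν (Iic s) ^ (1 / (p - r)) * m (Ioi s) ^ d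
  have hfm : Measurable f := (hNm.pow_const _).mul (hVm.pow_const _)
  have hfp : ∫⁻ t, f t ^ p ∂m ≤ C * X := by
    refine le_trans (lintegral_mono fun s => ?_) (hC m ν hν)
    simp only [f]
    rw [ENNReal.mul_rpow_of_nonneg _ _ hp0.le, ← ENNReal.rpow_mul, ← ENNReal.rpow_mul]
    refine le_of_eq ?_
    congr 2
    · field_simp; ring
    · rw [hd]; field_simp; ring
  have hlow : X ≤ (2 ^ (|d| + 1)) ^ r * ∫⁻ t, (∫⁻ s in Ioi t, f s ∂m) ^ r ∂ν := by
    rw [← lintegral_const_mul' _ _ (ENNReal.rpow_ne_top_of_nonneg hr.le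
      (ENNReal.rpow_ne_top_of_nonneg (by positivity) (by simp)))]
    refine lintegral_mono_ae ?_
    filter_upwards [hν] with t ht
    have h1 : ν (Iic t) ^ (1 / (p - r)) * m (Ioi t) ^ (d + 1) ≤
        2 ^ (|d| + 1) * ∫⁻ s in Ioi t, f s ∂m := by
      calc ν (Iic t) ^ (1 / (p - r)) * m (Ioi t) ^ (d + 1)
          ≤ ν (Iic t) ^ (1 / (p - r)) *
            (2 ^ (|d| + 1) * ∫⁻ s in Ioi t, m (Ioi s) ^ d ∂m) := by
            gcongr
            exact measure_Ioi_rpow_le_setLIntegral m (by rw [hd1]; positivity) ht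
        _ = 2 ^ (|d| + 1) * ∫⁻ s in Ioi t, ν (Iic t) ^ (1 / (p - r)) * m (Ioi s) ^ d ∂m := by
            rw [lintegral_const_mul _ (hVm.pow_const d)]; ring
        _ ≤ _ := by
            gcongr 2 ^ (|d| + 1) * ?_
            refine setLIntegral_mono hfm fun s hs => ?_
            simp only [f]
            gcongr
            exact le_of_lt hs
    have h2 := ENNReal.rpow_le_rpow h1 hr.le
    rw [ENNReal.mul_rpow_of_nonneg _ _ hr.le, ENNReal.mul_rpow_of_nonneg _ _ hr.le,
      ← ENNReal.rpow_mul, ← ENNReal.rpow_mul, hd1] at h2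
    convert h2 using 3 <;> ring
  have hmain : X ≤ (K * B) * X ^ (r / p) := by
    calc X ≤ (2 ^ (|d| + 1)) ^ r * (B * (C * X) ^ (r / p)) := by
          refine hlow.trans ?_
          gcongr
          exact (hB f hfm).trans (by gcongr)
      _ = _ := by rw [ENNReal.mul_rpow_of_nonneg _ _ (by positivity), hK]; ring
  have := le_rpow_of_le_mul_rpow ((div_lt_one hp0).2 hrp) hX hmain
  rwa [show 1 / (1 - r / p) = p / (p - r) by field_simp,
    ENNReal.mul_rpow_of_nonneg _ _ (by positivity)] at this

/-- Hardy's inequality for `0 < r < p`, `1 < p`, with general measures: necessity of the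
Maz'ya–Sinnamon condition. -/
theorem exists_le_of_hardy_le {p r : ℝ} (hp : 1 < p) (hr : 0 < r) (hrp : r < p) :
    ∃ C : ℝ≥0, ∀ (m ν : Measure ℝ) [NullSingletonClass m] [SFinite m],
      (∀ t, 0 < t → m (Ioi t) ≠ ∞) → (∀ t, m (Ioi t) ≠ 0) → ν (Iic 0) = 0 →
      ∀ B : ℝ≥0∞, B ≠ ∞ →
      (∀ f : ℝ → ℝ≥0∞, Measurable f →
        ∫⁻ t, (∫⁻ s in Ioi t, f s ∂m) ^ r ∂ν ≤ B * (∫⁻ t, f t ^ p ∂m) ^ (r / p)) →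
      ∫⁻ t, ν (Iic t) ^ (r / (p - r)) * m (Ioi t) ^ ((p - 1) * r / (p - r)) ∂ν ≤
        C * B ^ (p / (p - r)) := by
  have hp0 : 0 < p := by linarith
  have hp1 : 0 < p - 1 := by linarith
  have hpr : 0 < p - r := by linarith
  have hγ : 0 ≤ r / (p - r) := by positivity
  have he : 0 ≤ (p - 1) * r / (p - r) := by positivity
  obtain ⟨C, hC⟩ := exists_le_of_hardy_le_aux hp hr hrp
  refine ⟨C, fun m ν _ _ hV hV0 hν B hBt hB => ?_⟩
  have hfin : ∀ b, 0 < b → ν (Iic b) ≠ ∞ := by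
    intro b hb htop
    have h := hB ((Ioi b).indicator 1) (measurable_one.indicator measurableSet_Ioi)
    have hR : ∫⁻ t, (Ioi b).indicator (1 : ℝ → ℝ≥0∞) t ^ p ∂m = m (Ioi b) := by
      have : ∀ t, (Ioi b).indicator (1 : ℝ → ℝ≥0∞) t ^ p = (Ioi b).indicator 1 t := by
        intro t
        by_cases ht : t ∈ Ioi b
        · simp [indicator_of_mem ht]
        · simp [indicator_of_notMem ht, hp0]
      simp_rw [this]
      rw [lintegral_indicator_one measurableSet_Ioi]
    rw [hR] at h
    have hL : ∞ ≤ ∫⁻ t, (∫⁻ s in Ioi t, (Ioi b).indicator (1 : ℝ → ℝ≥0∞) s ∂m) ^ r ∂ν := by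
      calc ∞ = ∫⁻ _ in Iic b, m (Ioi b) ^ r ∂ν := by
            rw [setLIntegral_const, htop, ENNReal.mul_top]
            exact (ENNReal.rpow_pos (pos_iff_ne_zero.2 (hV0 b)) (hV b hb)).ne'
        _ ≤ ∫⁻ t in Iic b, (∫⁻ s in Ioi t, (Ioi b).indicator (1 : ℝ → ℝ≥0∞) s ∂m) ^ r ∂ν := by
            refine setLIntegral_mono' measurableSet_Iic fun t ht => ?_
            rw [lintegral_indicator_one measurableSet_Ioi, Measure.restrict_apply measurableSet_Ioi,
              inter_eq_left.2 (Ioi_subset_Ioi ht)]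
        _ ≤ _ := setLIntegral_le_lintegral _ _
    refine absurd (hL.trans h) (not_le.2 (ENNReal.mul_lt_top hBt.lt_top ?_))
    exact (ENNReal.rpow_ne_top_of_nonneg (by positivity) (hV b hb)).lt_top
  let S : ℕ → Set ℝ := fun n => Ioc (1 / ((n : ℝ) + 1)) (n + 1)
  have hSm : ∀ n, MeasurableSet (S n) := fun n => measurableSet_Ioc
  have hSpos : ∀ n, ∀ t ∈ S n, 0 < t := fun n t ht => lt_trans (by positivity) ht.1
  let φ : ℕ → ℝ → ℝ≥0∞ := fun n => (S n).indicator fun t =>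
    ν (S n ∩ Iic t) ^ (r / (p - r)) * m (Ioi t) ^ ((p - 1) * r / (p - r))
  have hφm : ∀ n, Measurable (φ n) := fun n => by
    refine Measurable.indicator (.mul ?_ ((measurable_measure_Ioi m).pow_const _)) (hSm n)
    refine Measurable.pow_const (Monotone.measurable fun a b hab => ?_) _
    exact measure_mono (inter_subset_inter_right _ (Iic_subset_Iic.2 hab))
  have hφle : ∀ n, ∫⁻ t, φ n t ∂ν ≤ C * B ^ (p / (p - r)) := by
    intro n
    have hSfin : ν (S n) ≠ ∞ :=
      ne_top_of_le_ne_top (hfin (n + 1) (by positivity)) (measure_mono fun t ht => ht.2)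
    have : IsFiniteMeasure (ν.restrict (S n)) := isFiniteMeasure_restrict.2 hSfin
    have hX : ∫⁻ t, φ n t ∂ν = ∫⁻ t, (ν.restrict (S n)) (Iic t) ^ (r / (p - r)) *
        m (Ioi t) ^ ((p - 1) * r / (p - r)) ∂(ν.restrict (S n)) := by
      simp only [φ]
      rw [lintegral_indicator (hSm n)]
      refine lintegral_congr fun t => ?_
      rw [Measure.restrict_apply measurableSet_Iic, inter_comm]
    rw [hX]
    refine hC m (ν.restrict (S n)) ?_ B ?_ ?_
    · filter_upwards [ae_restrict_mem (hSm n)] with t ht using hV t (hSpos n t ht)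
    · exact fun f hf => (setLIntegral_le_lintegral _ _).trans (hB f hf)
    · have hc : ν (S n) ^ (r / (p - r)) * m (Ioi (1 / ((n : ℝ) + 1))) ^ ((p - 1) * r / (p - r)) *
          ν (S n) ≠ ∞ :=
        ENNReal.mul_ne_top (ENNReal.mul_ne_top (ENNReal.rpow_ne_top_of_nonneg hγ hSfin)
          (ENNReal.rpow_ne_top_of_nonneg he (hV _ (by positivity)))) hSfin
      refine ne_top_of_le_ne_top hc ?_
      rw [← setLIntegral_const]
      refine setLIntegral_mono' (hSm n) fun t ht => ?_
      refine mul_le_mul' (ENNReal.rpow_le_rpow ?_ hγ)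
        (ENNReal.rpow_le_rpow (measure_mono (Ioi_subset_Ioi ht.1.le)) he)
      rw [Measure.restrict_apply measurableSet_Iic]
      exact measure_mono inter_subset_right
  have hlim : ∀ᵐ t ∂ν, ν (Iic t) ^ (r / (p - r)) * m (Ioi t) ^ ((p - 1) * r / (p - r)) ≤
      Filter.liminf (fun n => φ n t) Filter.atTop := by
    have hpos : ∀ᵐ t ∂ν, 0 < t := by
      rw [ae_iff]
      simp only [not_lt]
      exact hν
    filter_upwards [hpos] with t ht
    have hSmono : Monotone S := by
      intro a b hab
      have : (a : ℝ) ≤ b := by exact_mod_cast hab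
      exact Ioc_subset_Ioc (one_div_le_one_div_of_le (by positivity) (by linarith)) (by linarith)
    have hSun : ⋃ n, S n = Ioi 0 := by
      ext x
      simp only [mem_iUnion, mem_Ioi]
      refine ⟨fun ⟨n, hn⟩ => hSpos n x hn, fun hx => ?_⟩
      obtain ⟨n, hn⟩ := exists_nat_one_div_lt hx
      obtain ⟨k, hk⟩ := exists_nat_gt x
      refine ⟨max n k, ?_, ?_⟩
      · refine lt_of_le_of_lt (one_div_le_one_div_of_le (by positivity) ?_) hn
        gcongr; exact le_max_left _ _
      · have : (k : ℝ) ≤ (max n k : ℕ) := by exact_mod_cast le_max_right _ _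
        linarith
    have h1 : Filter.Tendsto (fun n => ν (S n ∩ Iic t)) Filter.atTop (nhds (ν (Iic t))) := by
      have := tendsto_measure_iUnion_atTop (μ := ν) (s := fun n => S n ∩ Iic t)
        fun a b hab => inter_subset_inter_left _ (hSmono hab)
      rw [← iUnion_inter, hSun] at this
      have heq : ν (Ioi 0 ∩ Iic t) = ν (Iic t) := by
        refine le_antisymm (measure_mono inter_subset_right) ?_
        calc ν (Iic t) ≤ ν (Ioi 0 ∩ Iic t ∪ Iic 0) := by
              refine measure_mono fun x hx => ?_
              rcases lt_or_ge 0 x with h | h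
              · exact Or.inl ⟨h, hx⟩
              · exact Or.inr h
          _ ≤ ν (Ioi 0 ∩ Iic t) + ν (Iic 0) := measure_union_le _ _
          _ = _ := by rw [hν, add_zero]
      rwa [heq] at this
    have h2 : Filter.Tendsto (fun n => φ n t) Filter.atTop
        (nhds (ν (Iic t) ^ (r / (p - r)) * m (Ioi t) ^ ((p - 1) * r / (p - r)))) := by
      have h3 := ENNReal.Tendsto.mul_const
        (b := m (Ioi t) ^ ((p - 1) * r / (p - r)))
        ((ENNReal.continuous_rpow_const (y := r / (p - r))).continuousAt.tendsto.comp h1)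
        (Or.inr (ENNReal.rpow_ne_top_of_nonneg he (hV t ht)))
      refine h3.congr' ?_
      obtain ⟨N, hN⟩ : ∃ N, t ∈ S N := by
        rw [← mem_iUnion, hSun]; exact ht
      filter_upwards [Filter.eventually_ge_atTop N] with n hn
      simp only [φ, Function.comp]
      rw [indicator_of_mem (hSmono hn hN)]
    exact h2.liminf_eq.ge
  calc ∫⁻ t, ν (Iic t) ^ (r / (p - r)) * m (Ioi t) ^ ((p - 1) * r / (p - r)) ∂ν
      ≤ ∫⁻ t, Filter.liminf (fun n => φ n t) Filter.atTop ∂ν := lintegral_mono_ae hlim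
    _ ≤ Filter.liminf (fun n => ∫⁻ t, φ n t ∂ν) Filter.atTop := lintegral_liminf_le hφm
    _ ≤ Filter.liminf (fun _ : ℕ => C * B ^ (p / (p - r))) Filter.atTop :=
        Filter.liminf_le_liminf (Filter.Eventually.of_forall hφle)
    _ = _ := Filter.liminf_const _

theorem exists_add_rpow_le {θ : ℝ} (hθ : 0 < θ) :
    ∃ K : ℝ≥0, 1 ≤ K ∧ ∀ a b : ℝ≥0∞, (a + b) ^ θ ≤ K * a ^ θ + (3 / 2 : ℝ≥0) * b ^ θ := by
  set ρ : ℝ≥0 := (3 / 2) ^ (1 / θ) with hρ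
  have hρ1 : 1 < ρ := NNReal.one_lt_rpow (by norm_num [← NNReal.coe_lt_coe]) (by positivity)
  obtain ⟨δ, hδ⟩ : ∃ δ, ρ = 1 + δ := ⟨ρ - 1, (add_tsub_cancel_of_le hρ1.le).symm⟩
  have hδ0 : δ ≠ 0 := by rintro rfl; simp [hδ] at hρ1
  have hρθ : (ρ : ℝ≥0∞) ^ θ = (3 / 2 : ℝ≥0) := by
    rw [← ENNReal.coe_rpow_of_nonneg _ hθ.le, hρ, ← NNReal.rpow_mul, one_div_mul_cancel hθ.ne',
      NNReal.rpow_one]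
  refine ⟨(1 + δ⁻¹) ^ θ, NNReal.one_le_rpow (by simp) hθ.le, fun a b => ?_⟩
  rcases le_total a (δ * b) with h | h
  · calc (a + b) ^ θ ≤ (ρ * b) ^ θ := by
          refine ENNReal.rpow_le_rpow ?_ hθ.le
          rw [hδ, ENNReal.coe_add, ENNReal.coe_one, add_mul, one_mul, add_comm]
          gcongr
      _ = (3 / 2 : ℝ≥0) * b ^ θ := by rw [ENNReal.mul_rpow_of_nonneg _ _ hθ.le, hρθ]
      _ ≤ _ := le_add_self
  · calc (a + b) ^ θ ≤ ((1 + δ⁻¹ : ℝ≥0) * a) ^ θ := by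
          refine ENNReal.rpow_le_rpow ?_ hθ.le
          rw [ENNReal.coe_add, ENNReal.coe_one, add_mul, one_mul]
          gcongr
          rw [ENNReal.coe_inv hδ0]
          rwa [← ENNReal.div_eq_inv_mul, ENNReal.le_div_iff_mul_le (by simp [hδ0]) (by simp),
            mul_comm]
      _ = ((1 + δ⁻¹) ^ θ : ℝ≥0) * a ^ θ := by
          rw [ENNReal.mul_rpow_of_nonneg _ _ hθ.le, ENNReal.coe_rpow_of_nonneg _ hθ.le]
      _ ≤ _ := le_self_add

/-- A discrete Hardy inequality with geometrically decreasing weights. -/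
theorem exists_tsum_mul_sum_rpow_le {θ : ℝ} (hθ : 0 < θ) :
    ∃ K : ℝ≥0, ∀ c a : ℕ → ℝ≥0∞, (∀ k, c (k + 1) ≤ 2⁻¹ * c k) →
      ∑' k, c k * (∑ j ∈ Finset.range (k + 1), a j) ^ θ ≤ K * ∑' k, c k * a k ^ θ := by
  obtain ⟨K, hK1, hK⟩ := exists_add_rpow_le hθ
  refine ⟨4 * K, fun c a hc => ENNReal.tsum_le_of_sum_range_le fun N => ?_⟩
  set A := ∑' k, c k * a k ^ θ with hA
  induction N with
  | zero => simp
  | succ N ih =>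
    rw [Finset.sum_range_succ']
    have h34 : (2⁻¹ : ℝ≥0∞) * (3 / 2 : ℝ≥0) * (4 * K : ℝ≥0) = (3 * K : ℝ≥0) := by
      rw [show (2⁻¹ : ℝ≥0∞) = ((2⁻¹ : ℝ≥0) : ℝ≥0∞) by simp, ← ENNReal.coe_mul, ← ENNReal.coe_mul]
      congr 1
      rw [← mul_assoc]
      congr 1
      norm_num [← NNReal.coe_inj]
    calc (∑ k ∈ Finset.range N, c (k + 1) * (∑ j ∈ Finset.range (k + 1 + 1), a j) ^ θ) +
          c 0 * (∑ j ∈ Finset.range (0 + 1), a j) ^ θ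
        ≤ (∑ k ∈ Finset.range N, (K * (c (k + 1) * a (k + 1) ^ θ) + 2⁻¹ * (3 / 2 : ℝ≥0) *
            (c k * (∑ j ∈ Finset.range (k + 1), a j) ^ θ))) + K * (c 0 * a 0 ^ θ) := by
          refine add_le_add (Finset.sum_le_sum fun k _ => ?_) ?_
          · rw [Finset.sum_range_succ _ (k + 1), add_comm (∑ j ∈ Finset.range (k + 1), a j)]
            calc c (k + 1) * (a (k + 1) + ∑ j ∈ Finset.range (k + 1), a j) ^ θ
                ≤ c (k + 1) * (K * a (k + 1) ^ θ +
                  (3 / 2 : ℝ≥0) * (∑ j ∈ Finset.range (k + 1), a j) ^ θ) := by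
                  gcongr; exact hK _ _
              _ = K * (c (k + 1) * a (k + 1) ^ θ) +
                  c (k + 1) * ((3 / 2 : ℝ≥0) * (∑ j ∈ Finset.range (k + 1), a j) ^ θ) := by ring
              _ ≤ K * (c (k + 1) * a (k + 1) ^ θ) +
                  2⁻¹ * c k * ((3 / 2 : ℝ≥0) * (∑ j ∈ Finset.range (k + 1), a j) ^ θ) := by
                  gcongr; exact hc k
              _ = _ := by ring
          · rw [zero_add, Finset.sum_range_one]
            exact le_mul_of_one_le_left' (by exact_mod_cast hK1)
      _ = K * ((∑ k ∈ Finset.range N, c (k + 1) * a (k + 1) ^ θ) + c 0 * a 0 ^ θ) +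
          2⁻¹ * (3 / 2 : ℝ≥0) *
            ∑ k ∈ Finset.range N, c k * (∑ j ∈ Finset.range (k + 1), a j) ^ θ := by
          rw [Finset.sum_add_distrib, ← Finset.mul_sum, ← Finset.mul_sum]; ring
      _ ≤ K * A + 2⁻¹ * (3 / 2 : ℝ≥0) * ((4 * K : ℝ≥0) * A) := by
          gcongr
          rw [← Finset.sum_range_succ' (fun k => c k * a k ^ θ)]
          exact ENNReal.sum_le_tsum _
      _ = K * A + (3 * K : ℝ≥0) * A := by rw [← mul_assoc, h34]
      _ = (4 * K : ℝ≥0) * A := by push_cast; ring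

theorem exists_measure_Iic_eq (ω : Measure ℝ) [NullSingletonClass ω] {T : ℝ} {l : ℝ≥0∞}
    (hT : ω (Iic T) ≠ ∞) (hl : ω (Iic 0) < l) (hlT : l ≤ ω (Iic T)) :
    ∃ s, ω (Iic s) = l := by
  rcases hlT.eq_or_lt with h | hlT'
  · exact ⟨T, h.symm⟩
  set S := {t | ω (Iic t) ≤ l} with hS
  have h0S : (0 : ℝ) ∈ S := hl.le
  have hTS : ∀ t ∈ S, t ≤ T := fun t ht => not_lt.1 fun h =>
    absurd (hlT'.trans_le ((monotone_measure_Iic ω h.le).trans ht)) (lt_irrefl _)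
  have hbdd : BddAbove S := ⟨T, hTS⟩
  set s := sSup S with hs
  have hsT : s ≤ T := csSup_le ⟨0, h0S⟩ hTS
  refine ⟨s, le_antisymm ?_ ?_⟩
  · rw [← Iio_union_right]
    refine (measure_union_le _ _).trans ?_
    rw [measure_singleton, add_zero]
    refine measure_le_of_isLowerSet ω (isLowerSet_Iio s) fun t ht => ?_
    obtain ⟨b, hb, htb⟩ := exists_lt_of_lt_csSup ⟨0, h0S⟩ ht
    exact (monotone_measure_Iic ω htb.le).trans hb
  · have hu : (ω.restrict (Iic T)) (Ioi s) ≤ ω (Iic T) - l := by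
      refine measure_le_of_isUpperSet _ (isUpperSet_Ioi s) fun t ht => ?_
      obtain ⟨b, hb1, hb2⟩ := exists_between (mem_Ioi.1 ht)
      rw [Measure.restrict_apply measurableSet_Ici]
      have hbS : l < ω (Iic b) := not_le.1 fun h => absurd (le_csSup hbdd h) (not_le.2 hb1)
      refine ENNReal.le_sub_of_add_le_right (ne_top_of_lt (hlT'.trans_le le_top)) ?_
      rcases le_total b T with hbT | hbT
      · calc ω (Ici t ∩ Iic T) + l ≤ ω (Ici t ∩ Iic T) + ω (Iic b) := by gcongr
          _ = ω (Ici t ∩ Iic T ∪ Iic b) := by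
              rw [measure_union _ measurableSet_Iic]
              exact Set.disjoint_left.2 fun x hx hx' => absurd (hb2.trans_le hx.1) (not_lt.2 hx')
          _ ≤ _ := measure_mono (union_subset inter_subset_right (Iic_subset_Iic.2 hbT))
      · have : Ici t ∩ Iic T = ∅ := by
          ext x; simp only [mem_inter_iff, mem_Ici, mem_Iic, mem_empty_iff_false, iff_false]
          intro h; linarith [h.1, h.2]
        rw [this]; simpa using hlT
    rw [Measure.restrict_apply measurableSet_Ioi] at hu
    have h1 : ω (Iic T) ≤ ω (Iic s) + (ω (Iic T) - l) :=
      calc ω (Iic T) ≤ ω (Iic s ∪ Ioi s ∩ Iic T) := by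
            refine measure_mono fun x hx => ?_
            rcases le_or_gt x s with h | h
            · exact Or.inl h
            · exact Or.inr ⟨h, hx⟩
        _ ≤ ω (Iic s) + ω (Ioi s ∩ Iic T) := measure_union_le _ _
        _ ≤ _ := by gcongr
    by_contra! hlt
    have : ω (Iic s) + (ω (Iic T) - l) < l + (ω (Iic T) - l) :=
      ENNReal.add_lt_add_right (ne_top_of_le_ne_top hT tsub_le_self) hlt
    rw [add_tsub_cancel_of_le hlT] at this
    exact absurd (h1.trans_lt this) (lt_irrefl _)

/-- The points `x k` split `(0, T]` into intervals whose `ω`-measures decrease geometrically. -/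
structure IsGeometricPartition (ω : Measure ℝ) (T : ℝ) (x : ℕ → ℝ) : Prop where
  strictAnti : StrictAnti x
  zero_eq : x 0 = T
  pos : ∀ k, 0 < x k
  measure_Iic_succ : ∀ k, ω (Iic (x (k + 1))) = 2⁻¹ * ω (Iic (x k))
  measure_Ioc : ∀ k, ω (Ioc (x (k + 1)) (x k)) = ω (Iic (x (k + 1)))
  iUnion_Ioc : ⋃ k, Ioc (x (k + 1)) (x k) = Ioc 0 T

theorem exists_geometric_partition (ω : Measure ℝ) [NullSingletonClass ω] (h0 : ω (Iic 0) = 0)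
    (hpos : ∀ t, 0 < t → ω (Iic t) ≠ 0) {T : ℝ} (hT0 : 0 < T) (hT : ω (Iic T) ≠ ∞) :
    ∃ x : ℕ → ℝ, IsGeometricPartition ω T x := by
  set Ω := ω (Iic T) with hΩ
  have hΩ0 : Ω ≠ 0 := hpos T hT0
  have h2 : ∀ k : ℕ, (2⁻¹ : ℝ≥0∞) ^ k ≠ 0 := fun k => pow_ne_zero k (by simp)
  have hex : ∀ k : ℕ, ∃ s, ω (Iic s) = 2⁻¹ ^ k * Ω ∧ (k = 0 → s = T) := by
    intro k
    rcases k.eq_zero_or_pos with rfl | hk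
    · exact ⟨T, by simp [hΩ], fun _ => rfl⟩
    · obtain ⟨s, hs⟩ := exists_measure_Iic_eq ω (l := 2⁻¹ ^ k * Ω) hT
        (by rw [h0]; exact ENNReal.mul_pos (h2 k) hΩ0)
        (mul_le_of_le_one_left' (pow_le_one' (by simp) k))
      exact ⟨s, hs, fun h => by omega⟩
  choose x hx hx0 using hex
  have hlt : ∀ k, 2⁻¹ ^ (k + 1) * Ω < 2⁻¹ ^ k * Ω := by
    intro k
    refine ENNReal.mul_lt_mul_left hΩ0 hT ?_
    rw [pow_succ]
    calc (2⁻¹ : ℝ≥0∞) ^ k * 2⁻¹ < 2⁻¹ ^ k * 1 :=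
          ENNReal.mul_lt_mul_right (h2 k) (ENNReal.pow_ne_top (by simp)) (by simp)
      _ = _ := mul_one _
  have hanti : StrictAnti x := strictAnti_nat_of_succ_lt fun k => by
    by_contra! h
    have := monotone_measure_Iic ω h
    simp only [hx] at this
    exact absurd (hlt k) (not_lt.2 this)
  have hxpos : ∀ k, 0 < x k := fun k => by
    by_contra! h
    have := monotone_measure_Iic ω h
    simp only [hx, h0] at this
    exact mul_ne_zero (h2 k) hΩ0 (le_antisymm this zero_le)
  refine ⟨x, hanti, hx0 0 rfl, hxpos, fun k => ?_, fun k => ?_, ?_⟩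
  · rw [hx, hx, pow_succ, mul_comm (2⁻¹ ^ k), mul_assoc]
  · have h1 : ω (Iic (x (k + 1))) + ω (Ioc (x (k + 1)) (x k)) = ω (Iic (x k)) := by
      rw [← measure_union _ measurableSet_Ioc, Iic_union_Ioc_eq_Iic (hanti (Nat.lt_succ_self k)).le]
      exact Set.disjoint_left.2 fun y hy hy' => absurd hy'.1 (not_lt.2 hy)
    have h3 : 2⁻¹ ^ (k + 1) * Ω + 2⁻¹ ^ (k + 1) * Ω = 2⁻¹ ^ k * Ω := by
      rw [← two_mul, ← mul_assoc, pow_succ, mul_comm (2⁻¹ ^ k), ← mul_assoc,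
        ENNReal.mul_inv_cancel (by simp) (by simp), one_mul]
    rw [hx, hx, ← h3] at h1
    rw [hx]
    exact (ENNReal.add_right_inj
      (ENNReal.mul_ne_top (ENNReal.pow_ne_top (by simp)) hT)).1 h1
  · ext t
    simp only [mem_iUnion]
    constructor
    · rintro ⟨k, hk⟩
      exact ⟨(hxpos _).trans hk.1, hk.2.trans ((hanti.antitone k.zero_le).trans (hx0 0 rfl).le)⟩
    · intro ht
      have hex : ∃ n, x n < t := by
        have htl : Filter.Tendsto (fun n : ℕ => (2⁻¹ : ℝ≥0∞) ^ n * Ω) Filter.atTop (nhds 0) := by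
          have := ENNReal.Tendsto.mul_const (b := Ω)
            (ENNReal.tendsto_pow_atTop_nhds_zero_of_lt_one (r := 2⁻¹) (by simp)) (Or.inr hT)
          simpa using this
        obtain ⟨n, hn⟩ := (htl.eventually_lt_const (pos_iff_ne_zero.2 (hpos t ht.1))).exists
        refine ⟨n, not_le.1 fun h => ?_⟩
        have := monotone_measure_Iic ω h
        simp only [hx] at this
        exact absurd hn (not_lt.2 this)
      classical
      have hne : Nat.find hex ≠ 0 := fun h => by
        have := Nat.find_spec hex
        rw [h, hx0 0 rfl] at this
        exact absurd ht.2 (not_le.2 this)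
      obtain ⟨n, hn⟩ := Nat.exists_eq_succ_of_ne_zero hne
      refine ⟨n, ?_, ?_⟩
      · have := Nat.find_spec hex
        rwa [hn] at this
      · exact not_lt.1 (Nat.find_min hex (by omega))

namespace IsGeometricPartition

variable {ω : Measure ℝ} {T : ℝ} {x : ℕ → ℝ}

theorem disjoint_Ioc (hx : IsGeometricPartition ω T x) :
    Pairwise (Function.onFun Disjoint fun k => Ioc (x (k + 1)) (x k)) :=
  hx.strictAnti.antitone.pairwise_disjoint_on_Ioc_succ

theorem shift (hx : IsGeometricPartition ω T x) (k : ℕ) :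
    IsGeometricPartition ω (x k) fun j => x (k + j) where
  strictAnti := fun _ _ h => hx.strictAnti (Nat.add_lt_add_left h k)
  zero_eq := rfl
  pos _ := hx.pos _
  measure_Iic_succ _ := hx.measure_Iic_succ _
  measure_Ioc _ := hx.measure_Ioc _
  iUnion_Ioc := by
    ext t
    simp only [mem_iUnion]
    refine ⟨fun ⟨j, hj⟩ => ⟨(hx.pos _).trans hj.1,
      hj.2.trans (hx.strictAnti.antitone (Nat.le_add_right k j))⟩, fun ht => ?_⟩
    have h1 : t ∈ Ioc 0 T :=
      ⟨ht.1, ht.2.trans ((hx.strictAnti.antitone k.zero_le).trans hx.zero_eq.le)⟩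
    rw [← hx.iUnion_Ioc, mem_iUnion] at h1
    obtain ⟨n, hn⟩ := h1
    have hkn : k ≤ n := by
      by_contra! h
      exact absurd (hn.1.trans_le ht.2) (not_lt.2 (hx.strictAnti.antitone (Nat.succ_le_of_lt h)))
    obtain ⟨j, rfl⟩ := Nat.exists_eq_add_of_le hkn
    exact ⟨j, hn⟩

theorem setLIntegral_eq_tsum (hx : IsGeometricPartition ω T x) (ρ : Measure ℝ) (g : ℝ → ℝ≥0∞) :
    ∫⁻ t in Ioc 0 T, g t ∂ρ = ∑' k, ∫⁻ t in Ioc (x (k + 1)) (x k), g t ∂ρ := by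
  rw [← hx.iUnion_Ioc, lintegral_iUnion (fun _ => measurableSet_Ioc) hx.disjoint_Ioc]

theorem two_mul_measure_Iic_succ (hx : IsGeometricPartition ω T x) (k : ℕ) :
    2 * ω (Iic (x (k + 1))) = ω (Iic (x k)) := by
  rw [hx.measure_Iic_succ, ← mul_assoc, ENNReal.mul_inv_cancel (by simp) (by simp), one_mul]

theorem setLIntegral_Ioi_eq_sum (hx : IsGeometricPartition ω T x) (ρ : Measure ℝ) (g : ℝ → ℝ≥0∞)
    (k : ℕ) :
    ∫⁻ t in Ioi (x k), g t ∂ρ =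
      ∑ j ∈ Finset.range (k + 1), ∫⁻ t in disjointed (fun k => Ioi (x k)) j, g t ∂ρ := by
  have hm : Monotone fun k => Ioi (x k) := fun _ _ h => Ioi_subset_Ioi (hx.strictAnti.antitone h)
  induction k with
  | zero => simp [disjointed_zero]
  | succ k ih =>
    rw [Finset.sum_range_succ, ← ih, hm.disjointed_add_one, Ioi_sdiff_Ioi,
      ← lintegral_union measurableSet_Ioc, union_comm,
      Ioc_union_Ioi_eq_Ioi (hx.strictAnti k.lt_add_one).le]
    exact Set.disjoint_left.2 fun y hy hy' => absurd hy'.2 (not_le.2 hy)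

theorem le_setLIntegral_Ioc (hx : IsGeometricPartition ω T x) {k : ℕ} {g : ℝ → ℝ≥0∞} {b : ℝ≥0∞}
    (h : ∀ t ∈ Ioc (x (k + 1)) (x k), b ≤ g t) :
    b * ω (Iic (x (k + 1))) ≤ ∫⁻ t in Ioc (x (k + 1)) (x k), g t ∂ω := by
  rw [← hx.measure_Ioc, ← setLIntegral_const]
  exact setLIntegral_mono' measurableSet_Ioc h

theorem setLIntegral_Ioc_le (hx : IsGeometricPartition ω T x) {k : ℕ} {g : ℝ → ℝ≥0∞} {b : ℝ≥0∞}
    (h : ∀ t ∈ Ioc (x (k + 1)) (x k), g t ≤ b) :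
    ∫⁻ t in Ioc (x (k + 1)) (x k), g t ∂ω ≤ b * ω (Iic (x (k + 1))) := by
  rw [← hx.measure_Ioc, ← setLIntegral_const]
  exact setLIntegral_mono' measurableSet_Ioc h

end IsGeometricPartition

theorem exists_setLIntegral_tail_rpow_le {θ : ℝ} (hθ : 0 < θ) :
    ∃ K : ℝ≥0, ∀ (ω μ : Measure ℝ) (T : ℝ) (x : ℕ → ℝ), IsGeometricPartition ω T x →
      ∀ g : ℝ → ℝ≥0∞, ∫⁻ t in Ioc 0 T, (∫⁻ s in Ioi t, g s ∂μ) ^ θ ∂ω ≤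
        K * ∑' k, ω (Iic (x k)) * (∫⁻ s in disjointed (fun k => Ioi (x k)) k, g s ∂μ) ^ θ := by
  obtain ⟨K, hK⟩ := exists_tsum_mul_sum_rpow_le hθ
  refine ⟨K, fun ω μ T x hx g => ?_⟩
  refine le_trans ?_ (hK (fun k => ω (Iic (x k))) _ fun k => (hx.measure_Iic_succ k).le)
  rw [hx.setLIntegral_eq_tsum]
  simp_rw [← hx.setLIntegral_Ioi_eq_sum]
  calc ∑' k, ∫⁻ t in Ioc (x (k + 1)) (x k), (∫⁻ s in Ioi t, g s ∂μ) ^ θ ∂ω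
      ≤ ∑' k, ω (Iic (x (k + 1))) * (∫⁻ s in Ioi (x (k + 1)), g s ∂μ) ^ θ := by
        refine ENNReal.tsum_le_tsum fun k => ?_
        rw [mul_comm]
        exact hx.setLIntegral_Ioc_le fun t ht => ENNReal.rpow_le_rpow
          (lintegral_mono_set (Ioi_subset_Ioi ht.1.le)) hθ.le
    _ ≤ _ := ENNReal.tsum_comp_le_tsum_of_injective (add_left_injective 1)
        fun k => ω (Iic (x k)) * (∫⁻ s in Ioi (x k), g s ∂μ) ^ θ

/-- The inner integral of the second condition. -/
def tailKernel (m μ : Measure ℝ) (γ e t : ℝ) : ℝ≥0∞ :=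
  ∫⁻ x in Ioi t, μ (Ioc t x) ^ γ * m (Ioi x) ^ e ∂μ

/-- The inner integral of the first condition. -/
def headKernel (μ ω : Measure ℝ) (θ t : ℝ) : ℝ≥0∞ :=
  ∫⁻ s in Iic t, μ (Ioc s t) ^ θ ∂ω

/-- The inner supremum of the first condition. -/
def supKernel (m μ : Measure ℝ) (θ ε t : ℝ) : ℝ≥0∞ :=
  ⨆ x ∈ Ioi t, μ (Ioc t x) ^ θ * m (Ioi x) ^ ε

theorem antitone_tailKernel (m μ : Measure ℝ) {γ e : ℝ} (hγ : 0 ≤ γ) :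
    Antitone (tailKernel m μ γ e) := by
  intro s t hst
  refine (lintegral_mono_set (Ioi_subset_Ioi hst)).trans' ?_
  refine setLIntegral_mono' measurableSet_Ioi fun x _ => ?_
  exact mul_le_mul_left (ENNReal.rpow_le_rpow (measure_mono (Ioc_subset_Ioc_left hst)) hγ) _

theorem IsGeometricPartition.tsum_tailKernel_le {ω : Measure ℝ} {T : ℝ} {x : ℕ → ℝ}
    (hx : IsGeometricPartition ω T x) (m μ : Measure ℝ) {γ e a β : ℝ} (hγ : 0 ≤ γ) (ha : 0 ≤ a)
    (hβ : 0 ≤ β) :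
    ∑' k, ω (Iic (x k)) ^ (a + 1) * tailKernel m μ γ e (x k) ^ β ≤
      2 ^ (a + 1) * ∫⁻ t, ω (Iic t) ^ a * tailKernel m μ γ e t ^ β ∂ω := by
  calc ∑' k, ω (Iic (x k)) ^ (a + 1) * tailKernel m μ γ e (x k) ^ β
      = ∑' k, 2 ^ (a + 1) * (ω (Iic (x (k + 1))) ^ a * tailKernel m μ γ e (x k) ^ β *
          ω (Iic (x (k + 1)))) := by
        refine tsum_congr fun k => ?_
        rw [← hx.two_mul_measure_Iic_succ, ENNReal.mul_rpow_of_nonneg _ _ (by linarith),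
          ENNReal.rpow_add_of_nonneg (x := ω _) _ _ ha zero_le_one, ENNReal.rpow_one]
        ring
    _ = 2 ^ (a + 1) * ∑' k, ω (Iic (x (k + 1))) ^ a * tailKernel m μ γ e (x k) ^ β *
          ω (Iic (x (k + 1))) := ENNReal.tsum_mul_left
    _ ≤ 2 ^ (a + 1) * ∑' k, ∫⁻ t in Ioc (x (k + 1)) (x k),
          ω (Iic t) ^ a * tailKernel m μ γ e t ^ β ∂ω := by
        gcongr with k
        refine hx.le_setLIntegral_Ioc fun t ht => mul_le_mul' ?_ ?_
        · exact ENNReal.rpow_le_rpow (monotone_measure_Iic ω ht.1.le) ha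
        · exact ENNReal.rpow_le_rpow (antitone_tailKernel m μ hγ ht.2) hβ
    _ ≤ _ := by
        rw [← hx.setLIntegral_eq_tsum]
        exact mul_le_mul' le_rfl (setLIntegral_le_lintegral _ _)

theorem exists_tsum_local_le {p q r : ℝ} (hp : 1 < p) (hq : 0 < q) (hr : 0 < r) (hqp : q < p)
    (hrp : r < p) :
    ∃ C : ℝ≥0, ∀ (m μ ω : Measure ℝ) [NullSingletonClass m] (T : ℝ) (x : ℕ → ℝ),
      (∀ t, 0 < t → m (Ioi t) ≠ ∞) → IsGeometricPartition ω T x →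
      ∀ f : ℝ → ℝ≥0∞, Measurable f → ∫⁻ t, f t ^ p ∂m ≠ ∞ →
      ∑' k, ω (Iic (x k)) * (∫⁻ t in disjointed (fun k => Ioi (x k)) k,
          (∫⁻ s in Ioi t, (disjointed (fun k => Ioi (x k)) k).indicator f s ∂m) ^ r ∂μ) ^ (q / r) ≤
        C * (∫⁻ t, ω (Iic t) ^ (q / (p - q)) *
          tailKernel m μ (r / (p - r)) ((p - 1) * r / (p - r)) t ^
            (q * (p - r) / (r * (p - q))) ∂ω) ^ ((p - q) / p) *
        (∫⁻ t, f t ^ p ∂m) ^ (q / p) := by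
  have hp0 : 0 < p := by linarith
  have hp1 : 0 < p - 1 := by linarith
  have hpr : 0 < p - r := by linarith
  have hpq : 0 < p - q := by linarith
  have hγ : 0 ≤ r / (p - r) := by positivity
  have he : 0 ≤ (p - 1) * r / (p - r) := by positivity
  have hβ : 0 ≤ q * (p - r) / (r * (p - q)) := by positivity
  have ha : 0 ≤ q / (p - q) := by positivity
  have hs : 0 ≤ (p - q) / p := by positivity
  have hθ : 0 ≤ q / r := by positivity
  obtain ⟨C, hC⟩ := exists_hardy_le hp hr hrp
  set a := q / (p - q) with ha_def
  set β := q * (p - r) / (r * (p - q)) with hβ_def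
  set D : ℝ≥0∞ := C ^ (q / r) * (2 ^ (a + 1)) ^ ((p - q) / p) with hD
  have hDt : D ≠ ∞ := by
    refine ENNReal.mul_ne_top (ENNReal.rpow_ne_top_of_nonneg hθ (by simp))
      (ENNReal.rpow_ne_top_of_nonneg hs (ENNReal.rpow_ne_top_of_nonneg (by linarith) (by simp)))
  refine ⟨D.toNNReal, fun m μ ω _ T x hm hx f hf hfp => ?_⟩
  rw [ENNReal.coe_toNNReal hDt]
  set J := disjointed fun k => Ioi (x k) with hJ
  have hJm : ∀ k, MeasurableSet (J k) := fun k => MeasurableSet.disjointed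
    (fun k => measurableSet_Ioi) k
  have hJsub : ∀ k, J k ⊆ Ioi (x k) := fun k => disjointed_le _ k
  set G := tailKernel m μ (r / (p - r)) ((p - 1) * r / (p - r)) with hG
  have hterm : ∀ k, (∫⁻ t in J k, (∫⁻ s in Ioi t, (J k).indicator f s ∂m) ^ r ∂μ) ≤
      C * G (x k) ^ ((p - r) / p) * (∫⁻ t in J k, f t ^ p ∂m) ^ (r / p) := by
    intro k
    have hind : ∫⁻ t, (J k).indicator f t ^ p ∂m = ∫⁻ t in J k, f t ^ p ∂m := by
      rw [← lintegral_indicator (hJm k)]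
      refine lintegral_congr fun t => ?_
      by_cases ht : t ∈ J k
      · simp [ht]
      · simp [ht, hp0]
    have h := hC m (μ.restrict (J k)) ?_ ((J k).indicator f) (hf.indicator (hJm k)) ?_
    · rw [hind] at h
      refine h.trans ?_
      gcongr
      rw [hG, tailKernel]
      refine (lintegral_mono' (Measure.restrict_mono (hJsub k) le_rfl) le_rfl).trans ?_
      refine setLIntegral_mono' measurableSet_Ioi fun t _ => ?_
      refine mul_le_mul_left (ENNReal.rpow_le_rpow ?_ hγ) _
      rw [Measure.restrict_apply measurableSet_Iic]
      exact measure_mono fun y hy => ⟨hJsub k hy.2, hy.1⟩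
    · filter_upwards [ae_restrict_mem (hJm k)] with t ht
      exact hm t ((hx.pos k).trans (hJsub k ht))
    · rw [hind]
      exact ne_top_of_le_ne_top hfp (setLIntegral_le_lintegral _ _)
  have hb : ∑' k, ∫⁻ t in J k, f t ^ p ∂m ≤ ∫⁻ t, f t ^ p ∂m := by
    rw [← lintegral_iUnion hJm (disjoint_disjointed _)]
    exact setLIntegral_le_lintegral _ _
  calc ∑' k, ω (Iic (x k)) * (∫⁻ t in J k,
          (∫⁻ s in Ioi t, (J k).indicator f s ∂m) ^ r ∂μ) ^ (q / r)
      ≤ ∑' k, C ^ (q / r) * ((ω (Iic (x k)) ^ (a + 1) * G (x k) ^ β) ^ ((p - q) / p) *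
          (∫⁻ t in J k, f t ^ p ∂m) ^ (q / p)) := by
        refine ENNReal.tsum_le_tsum fun k => ?_
        have e1 : (a + 1) * ((p - q) / p) = 1 := by rw [ha_def]; field_simp; ring
        have e2 : (p - r) / p * (q / r) = β * ((p - q) / p) := by rw [hβ_def]; field_simp
        have e3 : r / p * (q / r) = q / p := by field_simp
        calc ω (Iic (x k)) * (∫⁻ t in J k,
              (∫⁻ s in Ioi t, (J k).indicator f s ∂m) ^ r ∂μ) ^ (q / r)
            ≤ ω (Iic (x k)) * (C * G (x k) ^ ((p - r) / p) *
                (∫⁻ t in J k, f t ^ p ∂m) ^ (r / p)) ^ (q / r) := by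
              gcongr; exact hterm k
          _ = _ := by
              rw [ENNReal.mul_rpow_of_nonneg _ _ hθ, ENNReal.mul_rpow_of_nonneg _ _ hθ,
                ENNReal.mul_rpow_of_nonneg _ _ hs, ← ENNReal.rpow_mul, ← ENNReal.rpow_mul,
                ← ENNReal.rpow_mul, ← ENNReal.rpow_mul, e1, e2, e3, ENNReal.rpow_one]
              ring
    _ = C ^ (q / r) * ∑' k, (ω (Iic (x k)) ^ (a + 1) * G (x k) ^ β) ^ ((p - q) / p) *
          (∫⁻ t in J k, f t ^ p ∂m) ^ (q / p) := ENNReal.tsum_mul_left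
    _ ≤ C ^ (q / r) * ((∑' k, ω (Iic (x k)) ^ (a + 1) * G (x k) ^ β) ^ ((p - q) / p) *
          (∑' k, ∫⁻ t in J k, f t ^ p ∂m) ^ (q / p)) := by
        gcongr
        exact tsum_rpow_mul_rpow_le _ _ hs (by positivity) (by field_simp; ring)
    _ ≤ C ^ (q / r) * ((2 ^ (a + 1) * ∫⁻ t, ω (Iic t) ^ a * G t ^ β ∂ω) ^ ((p - q) / p) *
          (∫⁻ t, f t ^ p ∂m) ^ (q / p)) := by
        gcongr
        exact hx.tsum_tailKernel_le m μ hγ ha hβ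
    _ = _ := by
        rw [ENNReal.mul_rpow_of_nonneg _ _ hs, hD]; ring

theorem lintegral_sum_smul_dirac {ι : Type*} [Countable ι] (d : ι → ℝ≥0∞) (x : ι → ℝ)
    (g : ℝ → ℝ≥0∞) :
    ∫⁻ t, g t ∂(Measure.sum fun k => d k • Measure.dirac (x k)) = ∑' k, d k * g (x k) := by
  simp [lintegral_sum_measure, lintegral_smul_measure]

theorem sum_smul_dirac_Iic_le {d : ℕ → ℝ≥0∞} {x : ℕ → ℝ} (hx : StrictAnti x) (k : ℕ) :
    (Measure.sum fun k => d k • Measure.dirac (x k)) (Iic (x k)) ≤ ∑' j, d (k + j) := by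
  rw [Measure.sum_apply _ measurableSet_Iic,
    ← Summable.sum_add_tsum_nat_add' (k := k)
    (f := fun j => (d j • Measure.dirac (x j)) (Iic (x k))) ENNReal.summable,
    Finset.sum_eq_zero, zero_add]
  · refine ENNReal.tsum_le_tsum fun j => ?_
    rw [add_comm j k, Measure.smul_apply, smul_eq_mul]
    exact mul_le_of_le_one_right' prob_le_one
  · intro j hj
    have : x j ∉ Iic (x k) := not_le.2 (hx (Finset.mem_range.1 hj))
    simp [this]

namespace IsGeometricPartition

variable {ω : Measure ℝ} {T : ℝ} {x : ℕ → ℝ}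

theorem tsum_le_headKernel (hx : IsGeometricPartition ω T x) (μ : Measure ℝ) {θ : ℝ} (hθ : 0 ≤ θ)
    {k : ℕ} {t : ℝ} (ht : x (k + 2) ≤ t) :
    ∑' j, ω (Iic (x (k + 2 + j + 1))) * μ (Ioc (x (k + 2 + j + 1)) (x (k + 2 + j))) ^ θ ≤
      2 * headKernel μ ω θ t := by
  have hsub : Ioc 0 (x (k + 3)) ⊆ Iic t := fun s hs =>
    hs.2.trans ((hx.strictAnti.antitone (Nat.le_succ _)).trans ht)
  have hle : headKernel μ ω θ t ≥ ∫⁻ s in Ioc 0 (x (k + 3)), μ (Ioc s t) ^ θ ∂ω :=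
    lintegral_mono_set hsub
  rw [(hx.shift (k + 3)).setLIntegral_eq_tsum] at hle
  refine le_trans ?_ (mul_le_mul_right hle 2)
  rw [← ENNReal.tsum_mul_left]
  refine ENNReal.tsum_le_tsum fun j => ?_
  have h1 := (hx.shift (k + 3)).le_setLIntegral_Ioc (k := j) (g := fun s => μ (Ioc s t) ^ θ)
    (b := μ (Ioc (x (k + 3 + j)) (x (k + 2 + j))) ^ θ) fun s hs =>
      ENNReal.rpow_le_rpow (measure_mono (Ioc_subset_Ioc hs.2
        ((hx.strictAnti.antitone (Nat.le_add_right _ _)).trans ht))) hθ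
  refine le_trans (le_of_eq ?_) (mul_le_mul_right h1 2)
  rw [show k + 2 + j + 1 = k + 3 + j by ring, ← hx.two_mul_measure_Iic_succ (k + 3 + j)]
  rw [show k + 3 + (j + 1) = k + 3 + j + 1 by ring]
  ring

theorem tsum_mul_tail_rpow_le (hx : IsGeometricPartition ω T x) (m μ : Measure ℝ) {θ ε a : ℝ}
    (hθ : 0 ≤ θ) (ha : 0 ≤ a) :
    ∑' k, ω (Iic (x (k + 1))) * μ (Ioc (x (k + 1)) (x k)) ^ θ *
        (∑' j, ω (Iic (x (k + 2 + j + 1))) * μ (Ioc (x (k + 2 + j + 1)) (x (k + 2 + j))) ^ θ) ^ a *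
        m (Ioi (x k)) ^ ε ≤
      2 ^ (a + 1) * ∫⁻ t, headKernel μ ω θ t ^ a * supKernel m μ θ ε t ∂ω := by
  calc _ ≤ ∑' k, 2 ^ (a + 1) * ∫⁻ t in Ioc (x (k + 1 + 1)) (x (k + 1)),
          headKernel μ ω θ t ^ a * supKernel m μ θ ε t ∂ω := by
        refine ENNReal.tsum_le_tsum fun k => ?_
        set S := ∑' j, ω (Iic (x (k + 2 + j + 1))) *
          μ (Ioc (x (k + 2 + j + 1)) (x (k + 2 + j))) ^ θ with hS
        have h1 := hx.le_setLIntegral_Ioc (k := k + 1)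
          (g := fun t => headKernel μ ω θ t ^ a * supKernel m μ θ ε t)
          (b := (S / 2) ^ a * (μ (Ioc (x (k + 1)) (x k)) ^ θ * m (Ioi (x k)) ^ ε)) fun t ht => by
            refine mul_le_mul' (ENNReal.rpow_le_rpow ?_ ha) ?_
            · exact ENNReal.div_le_of_le_mul' (hx.tsum_le_headKernel μ hθ ht.1.le)
            · have htx : x k ∈ Ioi t := ht.2.trans_lt (hx.strictAnti (Nat.lt_add_one k))
              refine le_trans ?_ (le_iSup₂_of_le (x k) htx le_rfl)
              exact mul_le_mul_left (ENNReal.rpow_le_rpow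
                (measure_mono (Ioc_subset_Ioc_left ht.2)) hθ) _
        refine le_trans (le_of_eq ?_) (mul_le_mul_right h1 _)
        have h2 : S ^ a = 2 ^ a * (S / 2) ^ a := by
          rw [← ENNReal.mul_rpow_of_nonneg _ _ ha, ENNReal.mul_div_cancel (by simp) (by simp)]
        rw [h2, ← hx.two_mul_measure_Iic_succ (k + 1),
          ENNReal.rpow_add_of_nonneg _ _ ha zero_le_one, ENNReal.rpow_one]
        ring
    _ = 2 ^ (a + 1) * ∑' k, ∫⁻ t in Ioc (x (k + 1 + 1)) (x (k + 1)),
          headKernel μ ω θ t ^ a * supKernel m μ θ ε t ∂ω := ENNReal.tsum_mul_left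
    _ ≤ 2 ^ (a + 1) * ∑' k, ∫⁻ t in Ioc (x (k + 1)) (x k),
          headKernel μ ω θ t ^ a * supKernel m μ θ ε t ∂ω :=
        mul_le_mul_right (ENNReal.tsum_comp_le_tsum_of_injective (add_left_injective 1)
          fun k => ∫⁻ t in Ioc (x (k + 1)) (x k),
            headKernel μ ω θ t ^ a * supKernel m μ θ ε t ∂ω) _
    _ ≤ _ := by
        rw [← hx.setLIntegral_eq_tsum]
        exact mul_le_mul_right (setLIntegral_le_lintegral _ _) _

theorem tsum_rpow_add_one_le (hx : IsGeometricPartition ω T x) (m μ : Measure ℝ)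
    {γ e a β θ ε : ℝ} (hγ : 0 ≤ γ) (he : 0 ≤ e) (ha : 0 ≤ a) (hβ : 0 ≤ β)
    (hγβ : (γ + 1) * β = θ * (a + 1)) (heβ : e * β = ε) :
    ∑' k, (ω (Iic (x (k + 1))) * μ (Ioc (x (k + 1)) (x k)) ^ θ) ^ (a + 1) * m (Ioi (x k)) ^ ε ≤
      (2 ^ (γ + 1)) ^ β * 2 ^ (a + 1) *
        ∫⁻ t, ω (Iic t) ^ a * tailKernel m μ γ e t ^ β ∂ω := by
  calc _ ≤ ∑' k, (2 ^ (γ + 1)) ^ β *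
          (ω (Iic (x (k + 1))) ^ (a + 1) * tailKernel m μ γ e (x (k + 1)) ^ β) := by
        refine ENNReal.tsum_le_tsum fun k => ?_
        have h1 : μ (Ioc (x (k + 1)) (x k)) ^ (γ + 1) * m (Ioi (x k)) ^ e ≤
            2 ^ (γ + 1) * tailKernel m μ γ e (x (k + 1)) := by
          refine (mul_le_mul_left (measure_rpow_le_setLIntegral μ _ hγ) _).trans ?_
          rw [mul_assoc]
          refine mul_le_mul_right ?_ _
          rw [mul_comm, tailKernel]
          refine (mul_comm _ _).trans_le ?_
          refine (lintegral_mul_const_le _ _).trans ?_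
          refine (setLIntegral_mono' measurableSet_Ioc fun t ht => ?_).trans
            (lintegral_mono_set fun t ht => ht.1)
          refine mul_le_mul' (ENNReal.rpow_le_rpow (measure_mono fun y hy => ⟨hy.1.1, hy.2⟩) hγ)
            (ENNReal.rpow_le_rpow (measure_mono (Ioi_subset_Ioi ht.2)) he)
        have h2 := ENNReal.rpow_le_rpow h1 hβ
        rw [ENNReal.mul_rpow_of_nonneg _ _ hβ, ENNReal.mul_rpow_of_nonneg _ _ hβ,
          ← ENNReal.rpow_mul, ← ENNReal.rpow_mul, hγβ, heβ] at h2
        rw [ENNReal.mul_rpow_of_nonneg _ _ (by linarith), ← ENNReal.rpow_mul]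
        calc _ = ω (Iic (x (k + 1))) ^ (a + 1) *
              (μ (Ioc (x (k + 1)) (x k)) ^ (θ * (a + 1)) * m (Ioi (x k)) ^ ε) := by ring
          _ ≤ _ := mul_le_mul_right h2 _
          _ = _ := by ring
    _ = (2 ^ (γ + 1)) ^ β * ∑' k,
          ω (Iic (x (k + 1))) ^ (a + 1) * tailKernel m μ γ e (x (k + 1)) ^ β :=
        ENNReal.tsum_mul_left
    _ ≤ (2 ^ (γ + 1)) ^ β * ∑' k, ω (Iic (x k)) ^ (a + 1) * tailKernel m μ γ e (x k) ^ β :=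
        mul_le_mul_right (ENNReal.tsum_comp_le_tsum_of_injective (add_left_injective 1)
          fun k => ω (Iic (x k)) ^ (a + 1) * tailKernel m μ γ e (x k) ^ β) _
    _ ≤ _ := by
        rw [mul_assoc]
        exact mul_le_mul_right (hx.tsum_tailKernel_le m μ hγ ha hβ) _

end IsGeometricPartition

theorem mul_add_rpow_mul_le {a : ℝ} (ha : 0 ≤ a) {d d' S V V' : ℝ≥0∞} (hV : V ≤ V') :
    d * (d + (d' + S)) ^ a * V ≤
      3 ^ a * (2 * (d ^ (a + 1) * V) + d' ^ (a + 1) * V' + d * S ^ a * V) := by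
  have hpow : ∀ y : ℝ≥0∞, y * y ^ a = y ^ (a + 1) := fun y => by
    rw [ENNReal.rpow_add_of_nonneg _ _ ha zero_le_one, ENNReal.rpow_one, mul_comm]
  have h1 : (d + (d' + S)) ^ a ≤ 3 ^ a * (d ^ a + d' ^ a + S ^ a) := by
    have key : ∀ y : ℝ≥0∞, d ≤ y → d' ≤ y → S ≤ y → (d + (d' + S)) ^ a ≤ 3 ^ a * y ^ a := by
      intro y h1 h2 h3
      rw [← ENNReal.mul_rpow_of_nonneg _ _ ha]
      refine ENNReal.rpow_le_rpow ?_ ha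
      calc d + (d' + S) ≤ y + (y + y) := by gcongr
        _ = 3 * y := by ring
    rcases le_total d d' with h | h
    · rcases le_total d' S with h' | h'
      · exact (key S (h.trans h') h' le_rfl).trans (mul_le_mul_right le_add_self _)
      · exact (key d' h le_rfl h').trans (mul_le_mul_right (le_add_self.trans le_self_add) _)
    · rcases le_total d S with h' | h'
      · exact (key S h' (h.trans h') le_rfl).trans (mul_le_mul_right le_add_self _)
      · exact (key d le_rfl h h').trans (mul_le_mul_right (le_self_add.trans le_self_add) _)
  have h2 : d * d' ^ a * V ≤ d ^ (a + 1) * V + d' ^ (a + 1) * V' := by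
    rcases le_total d' d with h | h
    · refine le_add_right (mul_le_mul_left ?_ _)
      rw [← hpow]
      exact mul_le_mul_right (ENNReal.rpow_le_rpow h ha) _
    · refine le_add_left (mul_le_mul' ?_ hV)
      rw [← hpow]
      exact mul_le_mul_left h _
  calc d * (d + (d' + S)) ^ a * V ≤ d * (3 ^ a * (d ^ a + d' ^ a + S ^ a)) * V := by gcongr
    _ = 3 ^ a * (d * d ^ a * V + d * d' ^ a * V + d * S ^ a * V) := by ring
    _ ≤ 3 ^ a * (d * d ^ a * V + (d ^ (a + 1) * V + d' ^ (a + 1) * V') + d * S ^ a * V) := by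
        gcongr
    _ = _ := by rw [hpow]; ring

theorem exists_tsum_discrete_le {p q r : ℝ} (hp : 1 < p) (hq : 0 < q) (hr : 0 < r) (hqp : q < p)
    (hrp : r < p) :
    ∃ C : ℝ≥0, ∀ (m μ ω : Measure ℝ) [NullSingletonClass m] (T : ℝ) (x : ℕ → ℝ),
      (∀ t, 0 < t → m (Ioi t) ≠ ∞) → IsGeometricPartition ω T x →
      ∀ f : ℝ → ℝ≥0∞, Measurable f → ∫⁻ t, f t ^ p ∂m ≠ ∞ →
      ∑' k, ω (Iic (x (k + 1))) * μ (Ioc (x (k + 1)) (x k)) ^ (q / r) *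
          (∫⁻ s in Ioi (x k), f s ∂m) ^ q ≤
        C * ((∫⁻ t, headKernel μ ω (q / r) t ^ (q / (p - q)) *
            supKernel m μ (q / r) ((p - 1) * q / (p - q)) t ∂ω) +
          ∫⁻ t, ω (Iic t) ^ (q / (p - q)) *
            tailKernel m μ (r / (p - r)) ((p - 1) * r / (p - r)) t ^
              (q * (p - r) / (r * (p - q))) ∂ω) ^ ((p - q) / p) *
        (∫⁻ t, f t ^ p ∂m) ^ (q / p) := by
  have hp0 : 0 < p := by linarith
  have hp1 : 0 < p - 1 := by linarith
  have hpr : 0 < p - r := by linarith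
  have hpq : 0 < p - q := by linarith
  have hγ : 0 ≤ r / (p - r) := by positivity
  have he : 0 ≤ (p - 1) * r / (p - r) := by positivity
  have hε : 0 ≤ (p - 1) * q / (p - q) := by positivity
  have hβ : 0 ≤ q * (p - r) / (r * (p - q)) := by positivity
  have ha : 0 ≤ q / (p - q) := by positivity
  have hs : 0 ≤ (p - q) / p := by positivity
  have hθ : 0 ≤ q / r := by positivity
  have hγβ : (r / (p - r) + 1) * (q * (p - r) / (r * (p - q))) = q / r * (q / (p - q) + 1) := by
    field_simp; ring
  have heβ : (p - 1) * r / (p - r) * (q * (p - r) / (r * (p - q))) = (p - 1) * q / (p - q) := by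
    field_simp
  obtain ⟨C, hC⟩ := exists_hardy_le hp hq hqp
  set a := q / (p - q) with ha_def
  set β := q * (p - r) / (r * (p - q)) with hβ_def
  set γ := r / (p - r) with hγ_def
  set e := (p - 1) * r / (p - r) with he_def
  set ε := (p - 1) * q / (p - q) with hε_def
  set θ := q / r with hθ_def
  set L : ℝ≥0∞ := 3 ^ a * (3 * ((2 ^ (γ + 1)) ^ β * 2 ^ (a + 1)) + 2 ^ (a + 1)) with hL
  have hLt : L ≠ ∞ := by
    have h3 : (3 : ℝ≥0∞) ^ a ≠ ∞ := ENNReal.rpow_ne_top_of_nonneg ha (by simp)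
    have h2 : (2 : ℝ≥0∞) ^ (a + 1) ≠ ∞ := ENNReal.rpow_ne_top_of_nonneg (by linarith) (by simp)
    have h4 : ((2 : ℝ≥0∞) ^ (γ + 1)) ^ β ≠ ∞ := ENNReal.rpow_ne_top_of_nonneg hβ
      (ENNReal.rpow_ne_top_of_nonneg (by linarith) (by simp))
    exact ENNReal.mul_ne_top h3 (ENNReal.add_ne_top.2
      ⟨ENNReal.mul_ne_top (by simp) (ENNReal.mul_ne_top h4 h2), h2⟩)
  set D : ℝ≥0∞ := C * L ^ ((p - q) / p) with hD
  have hDt : D ≠ ∞ := ENNReal.mul_ne_top (by simp) (ENNReal.rpow_ne_top_of_nonneg hs hLt)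
  refine ⟨D.toNNReal, fun m μ ω _ T x hm hx f hf hfp => ?_⟩
  rw [ENNReal.coe_toNNReal hDt]
  set E3 := ∫⁻ t, headKernel μ ω θ t ^ a * supKernel m μ θ ε t ∂ω with hE3
  set E5 := ∫⁻ t, ω (Iic t) ^ a * tailKernel m μ γ e t ^ β ∂ω with hE5
  set d : ℕ → ℝ≥0∞ := fun k => ω (Iic (x (k + 1))) * μ (Ioc (x (k + 1)) (x k)) ^ θ with hd
  set ν := Measure.sum fun k => d k • Measure.dirac (x k) with hν
  have hT : ∀ k, ∑' j, d (k + j) = d k + (d (k + 1) + ∑' j, d (k + 2 + j)) := by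
    intro k
    rw [tsum_eq_zero_add' ENNReal.summable, tsum_eq_zero_add' ENNReal.summable]
    simp only [add_zero, zero_add]
    congr 3
    ext j
    congr 1
    ring
  have hdiag := hx.tsum_rpow_add_one_le m μ hγ he ha hβ hγβ heβ
  have htail := hx.tsum_mul_tail_rpow_le m μ (ε := ε) hθ ha
  have hdiag' : ∑' k, d (k + 1) ^ (a + 1) * m (Ioi (x (k + 1))) ^ ε ≤
      (2 ^ (γ + 1)) ^ β * 2 ^ (a + 1) * E5 :=
    (ENNReal.tsum_comp_le_tsum_of_injective (add_left_injective 1)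
      fun k => d k ^ (a + 1) * m (Ioi (x k)) ^ ε).trans hdiag
  have hcond : ∫⁻ t, ν (Iic t) ^ a * m (Ioi t) ^ ε ∂ν ≤ L * (E3 + E5) := by
    rw [hν, lintegral_sum_smul_dirac]
    calc _ ≤ ∑' k, 3 ^ a * (2 * (d k ^ (a + 1) * m (Ioi (x k)) ^ ε) +
            d (k + 1) ^ (a + 1) * m (Ioi (x (k + 1))) ^ ε +
            d k * (∑' j, d (k + 2 + j)) ^ a * m (Ioi (x k)) ^ ε) := by
          refine ENNReal.tsum_le_tsum fun k => ?_
          refine le_trans ?_ (mul_add_rpow_mul_le ha (ENNReal.rpow_le_rpow (measure_mono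
            (Ioi_subset_Ioi (hx.strictAnti (Nat.lt_add_one k)).le)) hε))
          rw [← hT, mul_assoc (d k)]
          exact mul_le_mul_right (mul_le_mul_left (ENNReal.rpow_le_rpow
            (sum_smul_dirac_Iic_le hx.strictAnti k) ha) _) _
      _ = 3 ^ a * (2 * (∑' k, d k ^ (a + 1) * m (Ioi (x k)) ^ ε) +
            (∑' k, d (k + 1) ^ (a + 1) * m (Ioi (x (k + 1))) ^ ε) +
            ∑' k, d k * (∑' j, d (k + 2 + j)) ^ a * m (Ioi (x k)) ^ ε) := by
          rw [ENNReal.tsum_mul_left, ENNReal.tsum_add, ENNReal.tsum_add, ENNReal.tsum_mul_left]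
      _ ≤ 3 ^ a * (2 * ((2 ^ (γ + 1)) ^ β * 2 ^ (a + 1) * E5) +
            (2 ^ (γ + 1)) ^ β * 2 ^ (a + 1) * E5 + 2 ^ (a + 1) * E3) := by
          gcongr
      _ = 3 ^ a * (3 * ((2 ^ (γ + 1)) ^ β * 2 ^ (a + 1)) * E5 + 2 ^ (a + 1) * E3) := by ring
      _ ≤ 3 ^ a * (3 * ((2 ^ (γ + 1)) ^ β * 2 ^ (a + 1)) * (E3 + E5) +
            2 ^ (a + 1) * (E3 + E5)) := by
          gcongr
          · exact le_add_self
          · exact le_self_add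
      _ = _ := by rw [hL]; ring
  have hae : ∀ᵐ t ∂ν, m (Ioi t) ≠ ∞ := by
    rw [hν, Measure.ae_sum_iff]
    exact fun k => Measure.ae_smul_measure (by simpa using hm _ (hx.pos k)) _
  have h := hC m ν hae f hf hfp
  rw [hν, lintegral_sum_smul_dirac, ← hν] at h
  refine h.trans ?_
  rw [hD, mul_assoc (C : ℝ≥0∞) (L ^ _), ← ENNReal.mul_rpow_of_nonneg _ _ hs]
  gcongr

theorem add_rpow_le_two_rpow_mul (a b : ℝ≥0∞) {r : ℝ} (hr : 0 ≤ r) :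
    (a + b) ^ r ≤ 2 ^ r * (a ^ r + b ^ r) := by
  have key : ∀ y : ℝ≥0∞, a ≤ y → b ≤ y → (a + b) ^ r ≤ 2 ^ r * y ^ r := by
    intro y h1 h2
    rw [← ENNReal.mul_rpow_of_nonneg _ _ hr, two_mul]
    exact ENNReal.rpow_le_rpow (add_le_add h1 h2) hr
  rcases le_total a b with h | h
  · exact (key b h le_rfl).trans (mul_le_mul_right le_add_self _)
  · exact (key a le_rfl h).trans (mul_le_mul_right le_self_add _)

theorem lintegral_eq_iSup_setLIntegral_Ioc (ω : Measure ℝ) (h0 : ω (Iic 0) = 0) (g : ℝ → ℝ≥0∞) :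
    ∫⁻ t, g t ∂ω = ⨆ n : ℕ, ∫⁻ t in Ioc 0 ((n : ℝ) + 1), g t ∂ω := by
  have hU : ⋃ n : ℕ, Ioc 0 ((n : ℝ) + 1) = Ioi 0 := by
    ext t
    simp only [mem_iUnion]
    refine ⟨fun ⟨n, hn⟩ => hn.1, fun ht => ?_⟩
    obtain ⟨n, hn⟩ := exists_nat_gt t
    exact ⟨n, ht, by linarith⟩
  have hmono : Monotone fun n : ℕ => Ioc 0 ((n : ℝ) + 1) := fun a b hab =>
    Ioc_subset_Ioc_right (by simpa using hab)
  rw [← setLIntegral_iUnion_of_directed _ hmono.directed_le, hU]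
  have : Ioi (0 : ℝ) =ᵐ[ω] univ := by
    rw [ae_eq_univ, compl_Ioi]; exact h0
  rw [setLIntegral_congr this, setLIntegral_univ]

theorem setLIntegral_tail_rpow_le (m μ : Measure ℝ) [NullSingletonClass m] {r θ : ℝ} (hr : 0 < r)
    (hθ : 0 ≤ θ) {S : Set ℝ} {a b : ℝ} (hS : S = Ioc a b) (f : ℝ → ℝ≥0∞) :
    (∫⁻ t in S, (∫⁻ s in Ioi t, f s ∂m) ^ r ∂μ) ^ θ ≤ (2 ^ r) ^ θ * 2 ^ θ *
      ((∫⁻ t in S, (∫⁻ s in Ioi t, S.indicator f s ∂m) ^ r ∂μ) ^ θ +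
        μ S ^ θ * (∫⁻ s in Ioi b, f s ∂m) ^ (r * θ)) := by
  have hSm : MeasurableSet S := hS ▸ measurableSet_Ioc
  have h1 : ∀ t ∈ S, ∫⁻ s in Ioi t, f s ∂m ≤
      (∫⁻ s in Ioi t, S.indicator f s ∂m) + ∫⁻ s in Ioi b, f s ∂m := by
    intro t ht
    rw [hS] at ht
    rw [setLIntegral_indicator hSm, hS]
    calc ∫⁻ s in Ioi t, f s ∂m ≤ ∫⁻ s in (Ioc a b ∩ Ioi t) ∪ Ioi b, f s ∂m := by
          refine lintegral_mono_set fun s hs => ?_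
          rcases le_or_gt s b with h | h
          · exact Or.inl ⟨⟨ht.1.trans hs, h⟩, hs⟩
          · exact Or.inr h
      _ ≤ _ := lintegral_union_le _ _ _
  have h2 : ∫⁻ t in S, (∫⁻ s in Ioi t, f s ∂m) ^ r ∂μ ≤
      2 ^ r * ((∫⁻ t in S, (∫⁻ s in Ioi t, S.indicator f s ∂m) ^ r ∂μ) +
        μ S * (∫⁻ s in Ioi b, f s ∂m) ^ r) := by
    calc ∫⁻ t in S, (∫⁻ s in Ioi t, f s ∂m) ^ r ∂μ
        ≤ ∫⁻ t in S, 2 ^ r * ((∫⁻ s in Ioi t, S.indicator f s ∂m) ^ r +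
            (∫⁻ s in Ioi b, f s ∂m) ^ r) ∂μ := by
          refine setLIntegral_mono' hSm fun t ht => ?_
          exact (ENNReal.rpow_le_rpow (h1 t ht) hr.le).trans (add_rpow_le_two_rpow_mul _ _ hr.le)
      _ = _ := by
          rw [lintegral_const_mul' _ _ (ENNReal.rpow_ne_top_of_nonneg hr.le (by simp)),
            lintegral_add_right _ measurable_const, setLIntegral_const, mul_comm (μ S)]
  refine (ENNReal.rpow_le_rpow h2 hθ).trans ?_
  rw [ENNReal.mul_rpow_of_nonneg _ _ hθ, mul_assoc]
  refine mul_le_mul_right ((add_rpow_le_two_rpow_mul _ _ hθ).trans_eq ?_) _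
  rw [ENNReal.mul_rpow_of_nonneg _ _ hθ, ← ENNReal.rpow_mul]

theorem exists_iterated_hardy_le {p q r : ℝ} (hp : 1 < p) (hq : 0 < q) (hr : 0 < r) (hqp : q < p)
    (hrp : r < p) :
    ∃ C : ℝ≥0, ∀ (m μ ω : Measure ℝ) [NullSingletonClass m] [NullSingletonClass ω],
      (∀ t, 0 < t → m (Ioi t) ≠ ∞) → ω (Iic 0) = 0 → (∀ t, 0 < t → ω (Iic t) ≠ 0) →
      (∀ t, ω (Iic t) ≠ ∞) →
      ∀ f : ℝ → ℝ≥0∞, Measurable f → ∫⁻ t, f t ^ p ∂m ≠ ∞ →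
      ∫⁻ x, (∫⁻ t in Ioi x, (∫⁻ s in Ioi t, f s ∂m) ^ r ∂μ) ^ (q / r) ∂ω ≤
        C * ((∫⁻ t, headKernel μ ω (q / r) t ^ (q / (p - q)) *
            supKernel m μ (q / r) ((p - 1) * q / (p - q)) t ∂ω) +
          ∫⁻ t, ω (Iic t) ^ (q / (p - q)) *
            tailKernel m μ (r / (p - r)) ((p - 1) * r / (p - r)) t ^
              (q * (p - r) / (r * (p - q))) ∂ω) ^ ((p - q) / p) *
        (∫⁻ t, f t ^ p ∂m) ^ (q / p) := by
  have hθ : 0 < q / r := by positivity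
  have hs : 0 ≤ (p - q) / p := div_nonneg (by linarith) (by linarith)
  obtain ⟨C₁, hC₁⟩ := exists_tsum_local_le hp hq hr hqp hrp
  obtain ⟨C₂, hC₂⟩ := exists_tsum_discrete_le hp hq hr hqp hrp
  obtain ⟨K, hK⟩ := exists_setLIntegral_tail_rpow_le hθ
  set P : ℝ≥0∞ := (2 ^ r) ^ (q / r) * 2 ^ (q / r) with hP
  have hPt : P ≠ ∞ := ENNReal.mul_ne_top
    (ENNReal.rpow_ne_top_of_nonneg hθ.le (ENNReal.rpow_ne_top_of_nonneg hr.le (by simp)))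
    (ENNReal.rpow_ne_top_of_nonneg hθ.le (by simp))
  have hP1 : 1 ≤ P := by
    have h2 : (1 : ℝ≥0∞) ≤ 2 ^ (q / r) := by
      simpa using ENNReal.rpow_le_rpow one_le_two hθ.le
    have h3 : (1 : ℝ≥0∞) ≤ (2 ^ r) ^ (q / r) := by
      rw [← ENNReal.rpow_mul]
      simpa using ENNReal.rpow_le_rpow (z := r * (q / r)) one_le_two (by positivity)
    exact one_le_mul h3 h2
  refine ⟨K * (P.toNNReal * (C₁ + C₂)), fun m μ ω _ _ hm h0 hpos hfin f hf hfp => ?_⟩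
  rw [ENNReal.coe_mul, ENNReal.coe_mul, ENNReal.coe_toNNReal hPt, ENNReal.coe_add]
  set E3 := ∫⁻ t, headKernel μ ω (q / r) t ^ (q / (p - q)) *
    supKernel m μ (q / r) ((p - 1) * q / (p - q)) t ∂ω
  set E5 := ∫⁻ t, ω (Iic t) ^ (q / (p - q)) *
    tailKernel m μ (r / (p - r)) ((p - 1) * r / (p - r)) t ^ (q * (p - r) / (r * (p - q))) ∂ω
  set F := ∫⁻ t, f t ^ p ∂m
  rw [lintegral_eq_iSup_setLIntegral_Ioc ω h0]
  refine iSup_le fun n => ?_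
  obtain ⟨x, hx⟩ := exists_geometric_partition ω h0 hpos (T := (n : ℝ) + 1) (by positivity)
    (hfin _)
  refine (hK ω μ _ x hx _).trans ?_
  rw [mul_assoc, mul_assoc]
  refine mul_le_mul_right ?_ _
  have h1 := hC₁ m μ ω _ x hm hx f hf hfp
  have h2 := hC₂ m μ ω _ x hm hx f hf hfp
  have hJ0 : disjointed (fun k => Ioi (x k)) 0 = Ioi (x 0) := disjointed_zero _
  have hJ : ∀ k, disjointed (fun k => Ioi (x k)) (k + 1) = Ioc (x (k + 1)) (x k) := fun k => by
    have hm : Monotone fun k => Ioi (x k) := fun _ _ h => Ioi_subset_Ioi (hx.strictAnti.antitone h)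
    rw [hm.disjointed_add_one, Ioi_sdiff_Ioi]
  set J := disjointed fun k => Ioi (x k)
  calc ∑' k, ω (Iic (x k)) * (∫⁻ t in J k, (∫⁻ s in Ioi t, f s ∂m) ^ r ∂μ) ^ (q / r)
      = ω (Iic (x 0)) * (∫⁻ t in J 0, (∫⁻ s in Ioi t, f s ∂m) ^ r ∂μ) ^ (q / r) +
        ∑' k, ω (Iic (x (k + 1))) *
          (∫⁻ t in J (k + 1), (∫⁻ s in Ioi t, f s ∂m) ^ r ∂μ) ^ (q / r) :=
        tsum_eq_zero_add' ENNReal.summable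
    _ ≤ P * (ω (Iic (x 0)) *
          (∫⁻ t in J 0, (∫⁻ s in Ioi t, (J 0).indicator f s ∂m) ^ r ∂μ) ^ (q / r)) +
        ∑' k, P * (ω (Iic (x (k + 1))) *
          (∫⁻ t in J (k + 1), (∫⁻ s in Ioi t, (J (k + 1)).indicator f s ∂m) ^ r ∂μ) ^ (q / r) +
          ω (Iic (x (k + 1))) * μ (Ioc (x (k + 1)) (x k)) ^ (q / r) *
            (∫⁻ s in Ioi (x k), f s ∂m) ^ q) := by
        refine add_le_add ?_ (ENNReal.tsum_le_tsum fun k => ?_)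
        · refine le_trans (le_of_eq ?_) (le_mul_of_one_le_left' hP1)
          congr 2
          rw [hJ0]
          refine setLIntegral_congr_fun measurableSet_Ioi fun t ht => ?_
          have : Ioi (x 0) ∩ Ioi t = Ioi t := inter_eq_right.2 (Ioi_subset_Ioi (le_of_lt ht))
          simp only [setLIntegral_indicator measurableSet_Ioi, this]
        · have h := setLIntegral_tail_rpow_le m μ hr hθ.le (hJ k) f
          refine (mul_le_mul_right h _).trans_eq ?_
          rw [mul_div_cancel₀ q hr.ne', hJ k, hP]
          ring
    _ = P * ((∑' k, ω (Iic (x k)) *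
          (∫⁻ t in J k, (∫⁻ s in Ioi t, (J k).indicator f s ∂m) ^ r ∂μ) ^ (q / r)) +
        ∑' k, ω (Iic (x (k + 1))) * μ (Ioc (x (k + 1)) (x k)) ^ (q / r) *
            (∫⁻ s in Ioi (x k), f s ∂m) ^ q) := by
        rw [ENNReal.tsum_mul_left, ENNReal.tsum_add, tsum_eq_zero_add' (f := fun k =>
          ω (Iic (x k)) * (∫⁻ t in J k, (∫⁻ s in Ioi t, (J k).indicator f s ∂m) ^ r ∂μ) ^ (q / r))
          ENNReal.summable]
        ring
    _ ≤ P * (C₁ * (E3 + E5) ^ ((p - q) / p) * F ^ (q / p) +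
        C₂ * (E3 + E5) ^ ((p - q) / p) * F ^ (q / p)) := by
        refine mul_le_mul_right (add_le_add (h1.trans ?_) h2) _
        gcongr
        exact le_add_self
    _ = _ := by ring

theorem exists_le_of_hardy_le_of_le_one {p r : ℝ} (hp : 1 < p) (hr : 0 < r) (hrp : r < p) :
    ∃ C : ℝ≥0, ∀ (m ν : Measure ℝ) [NullSingletonClass m] [SFinite m],
      (∀ t, 0 < t → m (Ioi t) ≠ ∞) → (∀ t, m (Ioi t) ≠ 0) → ν (Iic 0) = 0 →
      ∀ B : ℝ≥0∞, B ≠ ∞ →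
      (∀ f : ℝ → ℝ≥0∞, Measurable f → ∫⁻ t, f t ^ p ∂m ≤ 1 →
        ∫⁻ t, (∫⁻ s in Ioi t, f s ∂m) ^ r ∂ν ≤ B) →
      ∫⁻ t, ν (Iic t) ^ (r / (p - r)) * m (Ioi t) ^ ((p - 1) * r / (p - r)) ∂ν ≤
        C * B ^ (p / (p - r)) := by
  have hp0 : 0 < p := by linarith
  have hpr : 0 < p - r := by linarith
  obtain ⟨C, hC⟩ := exists_le_of_hardy_le hp hr hrp
  refine ⟨C, fun m ν _ _ hV hV0 hν B hBt hB => ?_⟩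
  have hscale : ∀ (c : ℝ≥0∞) (f : ℝ → ℝ≥0∞), Measurable f →
      c ^ r * ∫⁻ t, (∫⁻ s in Ioi t, f s ∂m) ^ r ∂ν ≤
        ∫⁻ t, (∫⁻ s in Ioi t, c * f s ∂m) ^ r ∂ν := by
    intro c f hf
    refine (lintegral_const_mul_le _ _).trans (lintegral_mono fun t => ?_)
    simp only
    rw [lintegral_const_mul _ hf, ENNReal.mul_rpow_of_nonneg _ _ hr.le]
  have hpow : ∀ (c : ℝ≥0∞) (f : ℝ → ℝ≥0∞), Measurable f →
      ∫⁻ t, (c * f t) ^ p ∂m = c ^ p * ∫⁻ t, f t ^ p ∂m := by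
    intro c f hf
    simp_rw [ENNReal.mul_rpow_of_nonneg _ _ hp0.le]
    rw [lintegral_const_mul _ (hf.pow_const p)]
  have key : ∀ B' : ℝ≥0∞, B ≤ B' → B' ≠ 0 → B' ≠ ∞ →
      ∫⁻ t, ν (Iic t) ^ (r / (p - r)) * m (Ioi t) ^ ((p - 1) * r / (p - r)) ∂ν ≤
        C * B' ^ (p / (p - r)) := by
    intro B' hBB' h0 ht
    refine hC m ν hV hV0 hν B' ht fun f hf => ?_
    set F := ∫⁻ t, f t ^ p ∂m with hF
    rcases eq_or_ne F ∞ with hFt | hFt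
    · rw [hFt, ENNReal.top_rpow_of_pos (by positivity), ENNReal.mul_top h0]
      exact le_top
    rcases eq_or_ne F 0 with hF0 | hF0
    · have h1 : ∞ * ∫⁻ t, (∫⁻ s in Ioi t, f s ∂m) ^ r ∂ν ≤ B := by
        have h2 := hB (fun s => ∞ * f s) (hf.const_mul _) (by rw [hpow _ _ hf, ← hF, hF0]; simp)
        have h3 := (hscale ∞ f hf).trans h2
        rwa [ENNReal.top_rpow_of_pos hr] at h3
      have h4 : ∫⁻ t, (∫⁻ s in Ioi t, f s ∂m) ^ r ∂ν = 0 := by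
        by_contra hne
        rw [ENNReal.top_mul hne] at h1
        exact hBt (top_le_iff.1 h1)
      rw [h4]; exact zero_le
    · have h2 := hB (fun s => F ^ (-(1 / p)) * f s) (hf.const_mul _) (by
        rw [hpow _ _ hf, ← hF, ← ENNReal.rpow_mul, show -(1 / p) * p = -1 by field_simp,
          ENNReal.rpow_neg_one, ENNReal.inv_mul_cancel hF0 hFt])
      have h3 := (hscale _ f hf).trans (h2.trans hBB')
      rw [← ENNReal.rpow_mul, show -(1 / p) * r = -(r / p) by ring, ENNReal.rpow_neg,
        ← ENNReal.div_eq_inv_mul] at h3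
      exact (ENNReal.div_le_iff_le_mul
        (Or.inl (ENNReal.rpow_pos (pos_iff_ne_zero.2 hF0) hFt).ne')
        (Or.inl (ENNReal.rpow_ne_top_of_nonneg (by positivity) hFt))).1 h3
  have hs : 0 < p / (p - r) := by positivity
  have hlim : Filter.Tendsto (fun n : ℕ => C * (B + ((n : ℝ≥0∞) + 1)⁻¹) ^ (p / (p - r)))
      Filter.atTop (nhds (C * B ^ (p / (p - r)))) := by
    refine ENNReal.Tendsto.const_mul ?_ (Or.inr (by simp))
    refine (ENNReal.continuous_rpow_const.tendsto B).comp ?_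
    have h1 : Filter.Tendsto (fun n : ℕ => ((n : ℝ≥0∞) + 1)⁻¹) Filter.atTop (nhds 0) := by
      have := (Filter.tendsto_add_atTop_iff_nat 1).2 ENNReal.tendsto_inv_nat_nhds_zero
      simpa using this
    simpa using tendsto_const_nhds.add h1
  refine ge_of_tendsto' hlim fun n => key _ le_self_add ?_ ?_
  · exact (lt_of_lt_of_le (by simp : (0 : ℝ≥0∞) < ((n : ℝ≥0∞) + 1)⁻¹) le_add_self).ne'
  · exact ENNReal.add_ne_top.2 ⟨hBt, by simp⟩

theorem tsum_rpow_le_of_forall {p q : ℝ} (hq : 0 < q) (hqp : q < p) {d : ℕ → ℝ≥0∞} {K : ℝ≥0∞}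
    (hK : K ≠ ∞) (h : ∀ α : ℕ → ℝ≥0∞, ∑' k, d k * α k ^ q ≤ K * (∑' k, α k ^ p) ^ (q / p)) :
    ∑' k, d k ^ (p / (p - q)) ≤ K ^ (p / (p - q)) := by
  have hp : 0 < p := hq.trans hqp
  have hpq : 0 < p - q := by linarith
  have hd : ∀ k, d k ≠ ∞ := by
    intro k
    refine ne_top_of_le_ne_top hK ?_
    have h1 := h (Pi.single k 1)
    have h2 : ∑' j, (Pi.single k 1 : ℕ → ℝ≥0∞) j ^ p = 1 := by
      rw [tsum_eq_single k fun j hj => by simp [hj, hp]]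
      simp
    rw [h2, ENNReal.one_rpow, mul_one] at h1
    refine le_trans ?_ h1
    simpa using ENNReal.le_tsum (f := fun j => d j * (Pi.single k 1 : ℕ → ℝ≥0∞) j ^ q) k
  refine ENNReal.tsum_le_of_sum_range_le fun N => ?_
  set S := ∑ k ∈ Finset.range N, d k ^ (p / (p - q)) with hS
  have hSt : S ≠ ∞ := (ENNReal.sum_ne_top).2 fun k _ =>
    ENNReal.rpow_ne_top_of_nonneg (by positivity) (hd k)
  have h1 := h fun k => if k ∈ Finset.range N then d k ^ (1 / (p - q)) else 0
  have h2 : ∑' k, d k * (if k ∈ Finset.range N then d k ^ (1 / (p - q)) else 0) ^ q = S := by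
    rw [tsum_eq_sum (s := Finset.range N) fun k hk => by simp only [hk]; simp [hq]]
    refine Finset.sum_congr rfl fun k hk => ?_
    rw [if_pos hk, ← ENNReal.rpow_mul]
    nth_rw 1 [← ENNReal.rpow_one (d k)]
    rw [← ENNReal.rpow_add_of_nonneg _ _ zero_le_one (by positivity)]
    congr 1
    field_simp; ring
  have h3 : ∑' k, (if k ∈ Finset.range N then d k ^ (1 / (p - q)) else 0 : ℝ≥0∞) ^ p = S := by
    rw [tsum_eq_sum (s := Finset.range N) fun k hk => by simp only [hk]; simp [hp]]
    refine Finset.sum_congr rfl fun k hk => ?_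
    rw [if_pos hk, ← ENNReal.rpow_mul]
    congr 1
    field_simp
  rw [h2, h3] at h1
  have h4 := le_rpow_of_le_mul_rpow ((div_lt_one hp).2 hqp) hSt h1
  rwa [show 1 / (1 - q / p) = p / (p - q) by field_simp] at h4

theorem IsGeometricPartition.tsum_tail_le {ω : Measure ℝ} {T : ℝ} {x : ℕ → ℝ}
    (hx : IsGeometricPartition ω T x) (μ : Measure ℝ) (g : ℝ → ℝ≥0∞) {θ : ℝ} (hθ : 0 ≤ θ) :
    ∑' k, ω (Iic (x (k + 1))) * (∫⁻ s in Ioi (x k), g s ∂μ) ^ θ ≤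
      ∫⁻ t, (∫⁻ s in Ioi t, g s ∂μ) ^ θ ∂ω := by
  refine le_trans ?_ (setLIntegral_le_lintegral (Ioc 0 T) _)
  rw [hx.setLIntegral_eq_tsum]
  refine ENNReal.tsum_le_tsum fun k => ?_
  rw [mul_comm]
  exact hx.le_setLIntegral_Ioc fun t ht =>
    ENNReal.rpow_le_rpow (lintegral_mono_set (Ioi_subset_Ioi ht.2)) hθ

theorem iSup_rpow_le_tsum {ι : Type*} (y : ι → ℝ≥0∞) {p : ℝ} (hp : 0 < p) :
    (⨆ k, y k) ^ p ≤ ∑' k, y k ^ p := by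
  rw [← ENNReal.le_rpow_inv_iff hp]
  refine iSup_le fun k => ?_
  rw [ENNReal.le_rpow_inv_iff hp]
  exact ENNReal.le_tsum k

theorem IsGeometricPartition.tsum_rpow_le_of_iterated {p q r : ℝ} (hq : 0 < q) (hr : 0 < r)
    (hqp : q < p) {m μ ω : Measure ℝ} {T : ℝ} {x : ℕ → ℝ} (hx : IsGeometricPartition ω T x)
    {K : ℝ≥0∞} (hK : K ≠ ∞)
    (hineq : ∀ f : ℝ → ℝ≥0∞, Measurable f →
      ∫⁻ x, (∫⁻ t in Ioi x, (∫⁻ s in Ioi t, f s ∂m) ^ r ∂μ) ^ (q / r) ∂ω ≤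
        K * (∫⁻ t, f t ^ p ∂m) ^ (q / p))
    {f : ℕ → ℝ → ℝ≥0∞} (hf : ∀ k, Measurable (f k)) (hf1 : ∀ k, ∫⁻ t, f k t ^ p ∂m ≤ 1) :
    ∑' k, (ω (Iic (x (k + 1))) *
      (∫⁻ t in Ioi (x k), (∫⁻ s in Ioi t, f k s ∂m) ^ r ∂μ) ^ (q / r)) ^ (p / (p - q)) ≤
        K ^ (p / (p - q)) := by
  have hp : 0 < p := hq.trans hqp
  have hθ : 0 ≤ q / r := by positivity
  refine tsum_rpow_le_of_forall hq hqp hK fun α => ?_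
  set g : ℝ → ℝ≥0∞ := fun s => ⨆ k, α k * f k s with hg
  have hgm : Measurable g := .iSup fun k => (hf k).const_mul _
  have h1 : ∫⁻ t, g t ^ p ∂m ≤ ∑' k, α k ^ p := by
    calc ∫⁻ t, g t ^ p ∂m ≤ ∫⁻ t, ∑' k, (α k * f k t) ^ p ∂m :=
          lintegral_mono fun t => iSup_rpow_le_tsum _ hp
      _ = ∑' k, ∫⁻ t, (α k * f k t) ^ p ∂m :=
          lintegral_tsum fun k => (((hf k).const_mul _).pow_const p).aemeasurable
      _ ≤ ∑' k, α k ^ p := by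
          refine ENNReal.tsum_le_tsum fun k => ?_
          simp_rw [ENNReal.mul_rpow_of_nonneg _ _ hp.le]
          rw [lintegral_const_mul _ ((hf k).pow_const p)]
          exact mul_le_of_le_one_right' (hf1 k)
  refine le_trans ?_ ((hx.tsum_tail_le μ (fun t => (∫⁻ s in Ioi t, g s ∂m) ^ r) hθ).trans
    ((hineq g hgm).trans ?_))
  · refine ENNReal.tsum_le_tsum fun k => ?_
    rw [mul_assoc]
    refine mul_le_mul_right ?_ _
    have h2 : α k ^ r * ∫⁻ t in Ioi (x k), (∫⁻ s in Ioi t, f k s ∂m) ^ r ∂μ ≤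
        ∫⁻ t in Ioi (x k), (∫⁻ s in Ioi t, g s ∂m) ^ r ∂μ := by
      refine (lintegral_const_mul_le _ _).trans (lintegral_mono fun t => ?_)
      simp only
      rw [← ENNReal.mul_rpow_of_nonneg _ _ hr.le, ← lintegral_const_mul _ (hf k)]
      refine ENNReal.rpow_le_rpow (lintegral_mono fun s => ?_) hr.le
      exact le_iSup (fun k => α k * f k s) k
    have h3 := ENNReal.rpow_le_rpow h2 hθ
    rwa [ENNReal.mul_rpow_of_nonneg _ _ hθ, ← ENNReal.rpow_mul, mul_div_cancel₀ q hr.ne',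
      mul_comm] at h3
  · gcongr

theorem exists_lintegral_tailKernel_le {p q r : ℝ} (hp : 1 < p) (hq : 0 < q) (hr : 0 < r)
    (hqp : q < p) (hrp : r < p) :
    ∃ C : ℝ≥0, ∀ (m μ ω : Measure ℝ) [NullSingletonClass m] [SFinite m] [NullSingletonClass ω],
      (∀ t, 0 < t → m (Ioi t) ≠ ∞) → (∀ t, m (Ioi t) ≠ 0) → ω (Iic 0) = 0 →
      (∀ t, 0 < t → ω (Iic t) ≠ 0) → (∀ t, ω (Iic t) ≠ ∞) → ∀ K : ℝ≥0∞, K ≠ ∞ →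
      (∀ f : ℝ → ℝ≥0∞, Measurable f →
        ∫⁻ x, (∫⁻ t in Ioi x, (∫⁻ s in Ioi t, f s ∂m) ^ r ∂μ) ^ (q / r) ∂ω ≤
          K * (∫⁻ t, f t ^ p ∂m) ^ (q / p)) →
      ∫⁻ t, ω (Iic t) ^ (q / (p - q)) *
        tailKernel m μ (r / (p - r)) ((p - 1) * r / (p - r)) t ^
          (q * (p - r) / (r * (p - q))) ∂ω ≤ C * K ^ (p / (p - q)) := by
  have hp0 : 0 < p := by linarith
  have hpr : 0 < p - r := by linarith
  have hpq : 0 < p - q := by linarith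
  have hγ : 0 ≤ r / (p - r) := by positivity
  have hβ : 0 ≤ q * (p - r) / (r * (p - q)) := by positivity
  have ha : 0 ≤ q / (p - q) := by positivity
  have hθ : 0 < q / r := by positivity
  obtain ⟨C, hC⟩ := exists_le_of_hardy_le_of_le_one hp hr hrp
  set a := q / (p - q) with ha_def
  set β := q * (p - r) / (r * (p - q)) with hβ_def
  set γ := r / (p - r) with hγ_def
  set e := (p - 1) * r / (p - r) with he_def
  have ha1 : p / (p - q) = a + 1 := by rw [ha_def]; field_simp; ring
  have hpβ : p / (p - r) * β = q / r * (a + 1) := by rw [ha_def, hβ_def]; field_simp; ring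
  set D : ℝ≥0∞ := 2 ^ a * 2 ^ (a + 1) * (C ^ β * 2 ^ (q / r * (a + 1))) with hD
  have hDt : D ≠ ∞ := by
    have h2 : ∀ y : ℝ, 0 ≤ y → (2 : ℝ≥0∞) ^ y ≠ ∞ := fun y hy =>
      ENNReal.rpow_ne_top_of_nonneg hy (by simp)
    exact ENNReal.mul_ne_top (ENNReal.mul_ne_top (h2 _ ha) (h2 _ (by positivity)))
      (ENNReal.mul_ne_top (ENNReal.rpow_ne_top_of_nonneg hβ (by simp)) (h2 _ (by positivity)))
  refine ⟨D.toNNReal, fun m μ ω _ _ _ hm hm0 h0 hpos hfin K hK hineq => ?_⟩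
  rw [ENNReal.coe_toNNReal hDt, lintegral_eq_iSup_setLIntegral_Ioc ω h0]
  refine iSup_le fun n => ?_
  obtain ⟨x, hx⟩ := exists_geometric_partition ω h0 hpos (T := (n : ℝ) + 1) (by positivity)
    (hfin _)
  set val : ℕ → (ℝ → ℝ≥0∞) → ℝ≥0∞ :=
    fun k f => ∫⁻ t in Ioi (x k), (∫⁻ s in Ioi t, f s ∂m) ^ r ∂μ with hval
  have hbound : ∀ k, ∃ b : ℝ≥0∞, b ≠ ∞ ∧
      ∀ f : ℝ → ℝ≥0∞, Measurable f → ∫⁻ t, f t ^ p ∂m ≤ 1 → val k f ≤ b := by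
    intro k
    have hc0 := hpos _ (hx.pos (k + 1))
    refine ⟨(K / ω (Iic (x (k + 1)))) ^ (q / r)⁻¹, ENNReal.rpow_ne_top_of_nonneg
      (by positivity) (ENNReal.div_ne_top hK hc0), fun f hf hf1 => ?_⟩
    rw [ENNReal.le_rpow_inv_iff hθ, ENNReal.le_div_iff_mul_le (Or.inl hc0) (Or.inl (hfin _)),
      mul_comm]
    refine (ENNReal.le_tsum k).trans ((hx.tsum_tail_le μ
      (fun t => (∫⁻ s in Ioi t, f s ∂m) ^ r) hθ.le).trans ((hineq f hf).trans ?_))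
    exact mul_le_of_le_one_right' (ENNReal.rpow_le_one hf1 (by positivity))
  have hnear : ∀ k, ∃ f : ℝ → ℝ≥0∞, Measurable f ∧ ∫⁻ t, f t ^ p ∂m ≤ 1 ∧ val k f ≠ ∞ ∧
      ∀ g : ℝ → ℝ≥0∞, Measurable g → ∫⁻ t, g t ^ p ∂m ≤ 1 → val k g ≤ 2 * val k f := by
    intro k
    obtain ⟨b, hbt, hb⟩ := hbound k
    set B := ⨆ (f : ℝ → ℝ≥0∞) (_ : Measurable f) (_ : ∫⁻ t, f t ^ p ∂m ≤ 1), val k f with hB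
    have hBle : B ≤ b := iSup_le fun f => iSup_le fun hf => iSup_le fun hf1 => hb f hf hf1
    have hleB : ∀ g : ℝ → ℝ≥0∞, Measurable g → ∫⁻ t, g t ^ p ∂m ≤ 1 → val k g ≤ B :=
      fun g hg hg1 => le_iSup_of_le g (le_iSup₂_of_le hg hg1 le_rfl)
    rcases eq_or_ne B 0 with hB0 | hB0
    · refine ⟨0, measurable_zero, by simp [hp0], ne_top_of_le_ne_top hbt
        (hb 0 measurable_zero (by simp [hp0])), fun g hg hg1 => (hleB g hg hg1).trans ?_⟩
      rw [hB0]; exact zero_le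
    · have hlt := ENNReal.half_lt_self hB0 (ne_top_of_le_ne_top hbt hBle)
      rw [hB] at hlt
      simp only [lt_iSup_iff] at hlt
      obtain ⟨f, hf, hf1, hlt⟩ := hlt
      refine ⟨f, hf, hf1, ne_top_of_le_ne_top hbt (hb f hf hf1),
        fun g hg hg1 => (hleB g hg hg1).trans ?_⟩
      exact (ENNReal.mul_div_cancel (by simp) (by simp)).symm.trans_le (mul_le_mul_right hlt.le 2)
  choose f hf hf1 hft hfB using hnear
  have hG : ∀ k, tailKernel m μ γ e (x k) ^ β ≤
      C ^ β * 2 ^ (q / r * (a + 1)) * val k (f k) ^ (q / r * (a + 1)) := by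
    intro k
    have hν : (μ.restrict (Ioi (x k))) (Iic 0) = 0 := by
      rw [Measure.restrict_apply measurableSet_Iic, Iic_inter_Ioi, Ioc_eq_empty, measure_empty]
      exact not_lt.2 (hx.pos k).le
    have h := hC m (μ.restrict (Ioi (x k))) hm hm0 hν (2 * val k (f k))
      (ENNReal.mul_ne_top (by simp) (hft k)) fun g hg hg1 => hfB k g hg hg1
    have h2 : tailKernel m μ γ e (x k) ≤ C * (2 * val k (f k)) ^ (p / (p - r)) := by
      refine le_trans (le_of_eq ?_) h
      rw [tailKernel]
      refine lintegral_congr fun t => ?_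
      rw [Measure.restrict_apply measurableSet_Iic, Iic_inter_Ioi]
    refine (ENNReal.rpow_le_rpow h2 hβ).trans_eq ?_
    rw [ENNReal.mul_rpow_of_nonneg _ _ hβ, ← ENNReal.rpow_mul, hpβ,
      ENNReal.mul_rpow_of_nonneg _ _ (by positivity), mul_assoc]
  have hsum := hx.tsum_rpow_le_of_iterated hq hr hqp hK hineq hf hf1
  rw [hx.setLIntegral_eq_tsum]
  calc ∑' k, ∫⁻ t in Ioc (x (k + 1)) (x k), ω (Iic t) ^ a * tailKernel m μ γ e t ^ β ∂ω
      ≤ ∑' k, ω (Iic (x k)) ^ a * tailKernel m μ γ e (x (k + 1)) ^ β * ω (Iic (x (k + 1))) := by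
        refine ENNReal.tsum_le_tsum fun k => hx.setLIntegral_Ioc_le fun t ht => ?_
        exact mul_le_mul' (ENNReal.rpow_le_rpow (monotone_measure_Iic ω ht.2) ha)
          (ENNReal.rpow_le_rpow (antitone_tailKernel m μ hγ ht.1.le) hβ)
    _ = ∑' k, 2 ^ a * 2 ^ (a + 1) * (ω (Iic (x (k + 1 + 1))) ^ (a + 1) *
          tailKernel m μ γ e (x (k + 1)) ^ β) := by
        refine tsum_congr fun k => ?_
        have h1 : ω (Iic (x (k + 1))) ^ (a + 1) =
            2 ^ (a + 1) * ω (Iic (x (k + 1 + 1))) ^ (a + 1) := by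
          rw [← hx.two_mul_measure_Iic_succ (k + 1), ENNReal.mul_rpow_of_nonneg _ _ (by linarith)]
        rw [← hx.two_mul_measure_Iic_succ k, ENNReal.mul_rpow_of_nonneg _ _ ha]
        calc _ = 2 ^ a * (ω (Iic (x (k + 1))) ^ a * ω (Iic (x (k + 1))) ^ (1 : ℝ)) *
              tailKernel m μ γ e (x (k + 1)) ^ β := by rw [ENNReal.rpow_one]; ring
          _ = _ := by
            rw [← ENNReal.rpow_add_of_nonneg _ _ ha zero_le_one, h1]; ring
    _ = 2 ^ a * 2 ^ (a + 1) * ∑' k, ω (Iic (x (k + 1 + 1))) ^ (a + 1) *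
          tailKernel m μ γ e (x (k + 1)) ^ β := ENNReal.tsum_mul_left
    _ ≤ 2 ^ a * 2 ^ (a + 1) * ∑' k, ω (Iic (x (k + 1))) ^ (a + 1) *
          tailKernel m μ γ e (x k) ^ β :=
        mul_le_mul_right (ENNReal.tsum_comp_le_tsum_of_injective (add_left_injective 1)
          fun k => ω (Iic (x (k + 1))) ^ (a + 1) * tailKernel m μ γ e (x k) ^ β) _
    _ ≤ 2 ^ a * 2 ^ (a + 1) * ∑' k, C ^ β * 2 ^ (q / r * (a + 1)) *
          (ω (Iic (x (k + 1))) * val k (f k) ^ (q / r)) ^ (p / (p - q)) := by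
        refine mul_le_mul_right (ENNReal.tsum_le_tsum fun k => ?_) _
        refine (mul_le_mul_right (hG k) _).trans_eq ?_
        rw [ha1, ENNReal.mul_rpow_of_nonneg _ _ (by linarith), ← ENNReal.rpow_mul]
        ring
    _ ≤ D * K ^ (p / (p - q)) := by
        rw [ENNReal.tsum_mul_left, hD, mul_assoc (2 ^ a * 2 ^ (a + 1))]
        exact mul_le_mul_right (mul_le_mul_right hsum _) _

theorem tsum_iSup_le {ι : Type*} [Nonempty ι] {F : ℕ → ι → ℝ≥0∞} {B : ℝ≥0∞}
    (h : ∀ y : ℕ → ι, ∑' k, F k (y k) ≤ B) : ∑' k, ⨆ i, F k i ≤ B := by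
  refine ENNReal.tsum_le_of_sum_range_le fun N => ?_
  calc ∑ k ∈ Finset.range N, ⨆ i, F k i ≤ ∑ k ∈ Finset.range N, ⨆ y : ℕ → ι, F k (y k) :=
        Finset.sum_le_sum fun k _ => iSup_le fun i =>
          le_iSup (fun y : ℕ → ι => F k (y k)) fun _ => i
    _ = ⨆ y : ℕ → ι, ∑ k ∈ Finset.range N, F k (y k) := by
        refine ENNReal.finsetSum_iSup fun y z =>
          ⟨fun k => if F k (y k) ≤ F k (z k) then z k else y k, fun k => ?_⟩
        dsimp only
        split_ifs with hk
        · exact ⟨hk, le_rfl⟩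
        · exact ⟨le_rfl, (not_le.1 hk).le⟩
    _ ≤ B := iSup_le fun y => (ENNReal.sum_le_tsum _).trans (h y)

theorem headKernel_le_add (μ ω : Measure ℝ) {θ : ℝ} (hθ : 0 < θ) {s t : ℝ} (hst : s ≤ t) :
    headKernel μ ω θ t ≤ 2 ^ θ * (headKernel μ ω θ s + μ (Ioc s t) ^ θ * ω (Iic t)) := by
  calc headKernel μ ω θ t
      ≤ ∫⁻ z in Iic t, 2 ^ θ * (μ (Ioc z s) ^ θ + μ (Ioc s t) ^ θ) ∂ω := by
        refine lintegral_mono fun z => (ENNReal.rpow_le_rpow ?_ hθ.le).trans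
          (add_rpow_le_two_rpow_mul _ _ hθ.le)
        exact (measure_mono Ioc_subset_Ioc_union_Ioc).trans (measure_union_le _ _)
    _ = 2 ^ θ * ((∫⁻ z in Iic t, μ (Ioc z s) ^ θ ∂ω) + μ (Ioc s t) ^ θ * ω (Iic t)) := by
        rw [lintegral_const_mul' _ _ (ENNReal.rpow_ne_top_of_nonneg hθ.le (by simp)),
          lintegral_add_right _ measurable_const, setLIntegral_const]
    _ = _ := by
        congr 2
        rw [headKernel, ← Iic_union_Ioc_eq_Iic hst,
          lintegral_union measurableSet_Ioc (Iic_disjoint_Ioc le_rfl),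
          setLIntegral_congr_fun (g := fun _ => 0) measurableSet_Ioc fun z hz => ?_]
        · simp
        · simp [Ioc_eq_empty (not_lt.2 hz.1.le), hθ]

namespace IsGeometricPartition

theorem measure_Ioc_eq_sum {ω : Measure ℝ} {T : ℝ} {x : ℕ → ℝ} (hx : IsGeometricPartition ω T x)
    (μ : Measure ℝ) (k : ℕ) :
    μ (Ioc (x k) (x 0)) = ∑ j ∈ Finset.range k, μ (Ioc (x (j + 1)) (x j)) := by
  induction k with
  | zero => simp
  | succ k ih =>
    have h1 := hx.strictAnti.antitone (Nat.zero_le k)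
    have h2 := (hx.strictAnti k.lt_add_one).le
    rw [Finset.sum_range_succ, ← ih, ← Ioc_union_Ioc_eq_Ioc h2 h1,
      measure_union _ measurableSet_Ioc, add_comm]
    exact Ioc_disjoint_Ioc_of_le le_rfl

end IsGeometricPartition

theorem exists_headKernel_le {θ : ℝ} (hθ : 0 < θ) :
    ∃ K : ℝ≥0, ∀ (ω μ : Measure ℝ) (T : ℝ) (x : ℕ → ℝ), ω (Iic 0) = 0 →
      IsGeometricPartition ω T x →
      headKernel μ ω θ T ≤ K * ∑' k, ω (Iic (x k)) * μ (Ioc (x (k + 1)) (x k)) ^ θ := by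
  obtain ⟨K, hK⟩ := exists_tsum_mul_sum_rpow_le hθ
  refine ⟨K, fun ω μ T x h0 hx => ?_⟩
  refine le_trans ?_ (hK (fun k => ω (Iic (x k))) (fun k => μ (Ioc (x (k + 1)) (x k)))
    fun k => (hx.measure_Iic_succ k).le)
  have hT : 0 ≤ T := hx.zero_eq ▸ (hx.pos 0).le
  rw [headKernel, ← Iic_union_Ioc_eq_Iic hT,
    lintegral_union measurableSet_Ioc (Iic_disjoint_Ioc le_rfl),
    setLIntegral_measure_zero _ _ h0, zero_add, hx.setLIntegral_eq_tsum]
  refine ENNReal.tsum_le_tsum fun k => ?_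
  rw [← hx.measure_Ioc_eq_sum, mul_comm]
  refine (hx.setLIntegral_Ioc_le fun s hs => ENNReal.rpow_le_rpow (measure_mono
    (Ioc_subset_Ioc hs.1.le hx.zero_eq.ge)) hθ.le).trans (mul_le_mul_right ?_ _)
  exact monotone_measure_Iic ω (hx.strictAnti k.lt_add_one).le

theorem IsGeometricPartition.tsum_mul_tail_le {q r : ℝ} (hq : 0 < q) (hr : 0 < r)
    {m μ ω : Measure ℝ} {T : ℝ} {x : ℕ → ℝ} (hx : IsGeometricPartition ω T x) (y : ℕ → ℝ)
    (f : ℝ → ℝ≥0∞) :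
    ∑' k, ω (Iic (x (k + 2))) * μ (Ioc (x (k + 1)) (y k)) ^ (q / r) *
        (∫⁻ s in Ioi (y k), f s ∂m) ^ q ≤
      ∫⁻ x, (∫⁻ t in Ioi x, (∫⁻ s in Ioi t, f s ∂m) ^ r ∂μ) ^ (q / r) ∂ω := by
  have hθ : 0 ≤ q / r := by positivity
  refine le_trans ?_ ((ENNReal.tsum_comp_le_tsum_of_injective (add_left_injective 1) _).trans
    (hx.tsum_tail_le μ (fun t => (∫⁻ s in Ioi t, f s ∂m) ^ r) hθ))
  refine ENNReal.tsum_le_tsum fun k => ?_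
  rw [mul_assoc]
  refine mul_le_mul_right ?_ _
  calc _ = ((∫⁻ s in Ioi (y k), f s ∂m) ^ r * μ (Ioc (x (k + 1)) (y k))) ^ (q / r) := by
        rw [ENNReal.mul_rpow_of_nonneg _ _ hθ, ← ENNReal.rpow_mul, mul_div_cancel₀ q hr.ne',
          mul_comm]
    _ ≤ _ := by
        rw [← setLIntegral_const]
        refine ENNReal.rpow_le_rpow ((setLIntegral_mono' measurableSet_Ioc fun t ht => ?_).trans
          (lintegral_mono_set Ioc_subset_Ioi_self)) hθ
        exact ENNReal.rpow_le_rpow (lintegral_mono_set (Ioi_subset_Ioi ht.2)) hr.le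

theorem exists_tsum_mul_measure_Ioi_le {p q r : ℝ} (hp : 1 < p) (hq : 0 < q) (hr : 0 < r)
    (hqp : q < p) :
    ∃ C : ℝ≥0, ∀ (m μ ω : Measure ℝ) [NullSingletonClass m] [SFinite m],
      (∀ t, 0 < t → m (Ioi t) ≠ ∞) → (∀ t, m (Ioi t) ≠ 0) → ∀ K : ℝ≥0∞, K ≠ ∞ →
      (∀ f : ℝ → ℝ≥0∞, Measurable f →
        ∫⁻ x, (∫⁻ t in Ioi x, (∫⁻ s in Ioi t, f s ∂m) ^ r ∂μ) ^ (q / r) ∂ω ≤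
          K * (∫⁻ t, f t ^ p ∂m) ^ (q / p)) →
      ∀ (T : ℝ) (x : ℕ → ℝ), IsGeometricPartition ω T x → ∀ y : ℕ → ℝ,
      (∀ k, x (k + 1) < y k) →
      ∑' k, ω (Iic (x (k + 2))) * μ (Ioc (x (k + 1)) (y k)) ^ (q / r) *
        (ω (Iic (x (k + 2))) * μ (Ioc (x (k + 1)) (y k)) ^ (q / r) +
          ∑' j, ω (Iic (x (k + 1 + j + 2))) *
            μ (Ioc (x (k + 1 + j + 1)) (x (k + 1 + j))) ^ (q / r)) ^ (q / (p - q)) *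
        m (Ioi (y k)) ^ ((p - 1) * q / (p - q)) ≤ C * K ^ (p / (p - q)) := by
  have hpq : 0 < p - q := by linarith
  obtain ⟨C, hC⟩ := exists_le_of_hardy_le hp hq hqp
  have h2 : (2 : ℝ≥0∞) ^ (p / (p - q)) ≠ ∞ :=
    ENNReal.rpow_ne_top_of_nonneg (by positivity) (by simp)
  refine ⟨C * ((2 : ℝ≥0∞) ^ (p / (p - q))).toNNReal, fun m μ ω _ _ hm hm0 K hK hineq T x hx y hy =>
    ?_⟩
  set d : ℕ → ℝ≥0∞ := fun j => ω (Iic (x (j + 2))) * μ (Ioc (x (j + 1)) (x j)) ^ (q / r) with hd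
  set e : ℕ → ℝ≥0∞ := fun k => ω (Iic (x (k + 2))) * μ (Ioc (x (k + 1)) (y k)) ^ (q / r) with he
  set ν : Measure ℝ := (Measure.sum fun k => d k • Measure.dirac (x k)) +
    Measure.sum fun k => e k • Measure.dirac (y k) with hν
  have hνint : ∀ g : ℝ → ℝ≥0∞, ∫⁻ t, g t ∂ν = ∑' k, d k * g (x k) + ∑' k, e k * g (y k) := by
    intro g
    rw [hν, lintegral_add_measure, lintegral_sum_smul_dirac, lintegral_sum_smul_dirac]
  have hν0 : ν (Iic 0) = 0 := by
    have h := hνint ((Iic 0).indicator 1)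
    rw [lintegral_indicator_one measurableSet_Iic] at h
    rw [h]
    have hy0 : ∀ k, 0 < y k := fun k => (hx.pos _).trans (hy k)
    simp [hx.pos, hy0]
  have hνle : ∀ k, e k + ∑' j, d (k + 1 + j) ≤ ν (Iic (y k)) := by
    intro k
    have h := hνint ((Iic (y k)).indicator 1)
    rw [lintegral_indicator_one measurableSet_Iic] at h
    rw [h, add_comm]
    refine add_le_add ?_ ?_
    · refine le_trans (ENNReal.tsum_le_tsum fun j => ?_) (ENNReal.tsum_comp_le_tsum_of_injective
        (add_right_injective (k + 1)) fun j => d j * (Iic (y k)).indicator 1 (x j))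
      have hj : x (k + 1 + j) ∈ Iic (y k) :=
        (hx.strictAnti.antitone (Nat.le_add_right _ _)).trans (hy k).le
      simp [indicator_of_mem hj]
    · refine le_trans ?_ (ENNReal.le_tsum k)
      simp
  have hH : ∀ f : ℝ → ℝ≥0∞, Measurable f →
      ∫⁻ t, (∫⁻ s in Ioi t, f s ∂m) ^ q ∂ν ≤ 2 * K * (∫⁻ t, f t ^ p ∂m) ^ (q / p) := by
    intro f hf
    rw [hνint, mul_assoc, two_mul]
    exact add_le_add ((hx.tsum_mul_tail_le hq hr x f).trans (hineq f hf))
      ((hx.tsum_mul_tail_le hq hr y f).trans (hineq f hf))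
  have hmain := hC m ν hm hm0 hν0 (2 * K) (ENNReal.mul_ne_top (by simp) hK) hH
  rw [hνint, ENNReal.mul_rpow_of_nonneg _ _ (by positivity), ← mul_assoc] at hmain
  rw [ENNReal.coe_mul, ENNReal.coe_toNNReal h2]
  refine le_trans (ENNReal.tsum_le_tsum fun k => ?_) (le_add_self.trans hmain)
  rw [← mul_assoc]
  exact mul_le_mul_left (mul_le_mul_right (ENNReal.rpow_le_rpow (hνle k) (by positivity)) _) _

theorem exists_lintegral_headKernel_le {p q r : ℝ} (hp : 1 < p) (hq : 0 < q) (hr : 0 < r)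
    (hqp : q < p) :
    ∃ C : ℝ≥0, ∀ (m μ ω : Measure ℝ) [NullSingletonClass m] [SFinite m] [NullSingletonClass ω],
      (∀ t, 0 < t → m (Ioi t) ≠ ∞) → (∀ t, m (Ioi t) ≠ 0) → ω (Iic 0) = 0 →
      (∀ t, 0 < t → ω (Iic t) ≠ 0) → (∀ t, ω (Iic t) ≠ ∞) → ∀ K : ℝ≥0∞, K ≠ ∞ →
      (∀ f : ℝ → ℝ≥0∞, Measurable f →
        ∫⁻ x, (∫⁻ t in Ioi x, (∫⁻ s in Ioi t, f s ∂m) ^ r ∂μ) ^ (q / r) ∂ω ≤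
          K * (∫⁻ t, f t ^ p ∂m) ^ (q / p)) →
      ∫⁻ t, headKernel μ ω (q / r) t ^ (q / (p - q)) *
        supKernel m μ (q / r) ((p - 1) * q / (p - q)) t ∂ω ≤ C * K ^ (p / (p - q)) := by
  have hpq : 0 < p - q := by linarith
  have hθ : 0 < q / r := by positivity
  have ha : 0 ≤ q / (p - q) := by positivity
  obtain ⟨C₁, hC₁⟩ := exists_headKernel_le hθ
  obtain ⟨C₂, hC₂⟩ := exists_tsum_mul_measure_Ioi_le hp hq hr hqp
  set θ := q / r with hθ_def
  set a := q / (p - q) with ha_def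
  set ε := (p - 1) * q / (p - q) with hε_def
  set D : ℝ≥0∞ := 2 * (2 ^ θ * (4 * (C₁ + 1))) ^ a with hD
  have hDt : D * C₂ ≠ ∞ := by
    refine ENNReal.mul_ne_top (ENNReal.mul_ne_top (by simp) (ENNReal.rpow_ne_top_of_nonneg ha ?_))
      (by simp)
    exact ENNReal.mul_ne_top (ENNReal.rpow_ne_top_of_nonneg hθ.le (by simp))
      (ENNReal.mul_ne_top (by simp) (by simp))
  refine ⟨(D * C₂).toNNReal, fun m μ ω _ _ _ hm hm0 h0 hpos hfin K hK hineq => ?_⟩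
  rw [ENNReal.coe_toNNReal hDt, lintegral_eq_iSup_setLIntegral_Ioc ω h0]
  refine iSup_le fun n => ?_
  obtain ⟨x, hx⟩ := exists_geometric_partition ω h0 hpos (T := (n : ℝ) + 1) (by positivity)
    (hfin _)
  set S : ℕ → ℝ≥0∞ := fun k => ∑' j, ω (Iic (x (k + 1 + j + 2))) *
    μ (Ioc (x (k + 1 + j + 1)) (x (k + 1 + j))) ^ θ with hS
  set e : ℕ → ℝ → ℝ≥0∞ := fun k y => ω (Iic (x (k + 2))) * μ (Ioc (x (k + 1)) y) ^ θ with he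
  have h4 : ∀ k, ω (Iic (x k)) = 4 * ω (Iic (x (k + 2))) := by
    intro k
    rw [← hx.two_mul_measure_Iic_succ k, ← hx.two_mul_measure_Iic_succ (k + 1), ← mul_assoc]
    norm_num
  have hhead : ∀ k, headKernel μ ω θ (x (k + 1)) ≤ 4 * C₁ * S k := by
    intro k
    refine (hC₁ ω μ _ _ h0 (hx.shift (k + 1))).trans_eq ?_
    have hS4 : 4 * S k = ∑' j, ω (Iic (x (k + 1 + j))) *
        μ (Ioc (x (k + 1 + (j + 1))) (x (k + 1 + j))) ^ θ := by
      rw [hS, ← ENNReal.tsum_mul_left]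
      refine tsum_congr fun j => ?_
      rw [h4 (k + 1 + j), mul_assoc]
      rfl
    rw [← hS4]
    ring
  have hpt : ∀ k, ∀ t ∈ Ioc (x (k + 1)) (x k), ∀ y, t < y →
      headKernel μ ω θ t ≤ 2 ^ θ * (4 * (C₁ + 1)) * (e k y + S k) := by
    intro k t ht y hty
    refine (headKernel_le_add μ ω hθ ht.1.le).trans ?_
    rw [mul_assoc]
    refine mul_le_mul_right ?_ _
    calc headKernel μ ω θ (x (k + 1)) + μ (Ioc (x (k + 1)) t) ^ θ * ω (Iic t)
        ≤ 4 * C₁ * S k + μ (Ioc (x (k + 1)) y) ^ θ * (4 * ω (Iic (x (k + 2)))) := by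
          refine add_le_add (hhead k) (mul_le_mul' (ENNReal.rpow_le_rpow (measure_mono
            (Ioc_subset_Ioc_right hty.le)) hθ.le) ?_)
          rw [← h4]
          exact monotone_measure_Iic ω ht.2
      _ = 4 * C₁ * S k + 4 * e k y := by rw [he]; ring
      _ ≤ 4 * (C₁ + 1) * S k + 4 * (C₁ + 1) * e k y := by
          refine add_le_add (mul_le_mul_left (mul_le_mul_right le_self_add _) _) ?_
          refine mul_le_mul_left ?_ _
          exact le_mul_of_one_le_right' le_add_self
      _ = _ := by ring
  set F : ℕ → Ioi (0 : ℝ) → ℝ≥0∞ := fun k z =>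
    e k (x (k + 1) + z) * (e k (x (k + 1) + z) + S k) ^ a * m (Ioi (x (k + 1) + z)) ^ ε with hF
  have hFsum : ∑' k, ⨆ z, F k z ≤ C₂ * K ^ (p / (p - q)) := by
    let _ : Nonempty (Ioi (0 : ℝ)) := ⟨⟨1, mem_Ioi.2 one_pos⟩⟩
    exact tsum_iSup_le fun z => hC₂ m μ ω hm hm0 K hK hineq _ x hx
      (fun k => x (k + 1) + z k) fun k => lt_add_of_pos_right _ (z k).2
  rw [hx.setLIntegral_eq_tsum, mul_assoc]
  refine le_trans ?_ (mul_le_mul_right hFsum D)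
  rw [← ENNReal.tsum_mul_left]
  refine ENNReal.tsum_le_tsum fun k => ?_
  have hc0 : ω (Iic (x (k + 2))) ≠ 0 := hpos _ (hx.pos _)
  have hct : ω (Iic (x (k + 2))) ≠ ∞ := hfin _
  have hb : ∀ t ∈ Ioc (x (k + 1)) (x k), headKernel μ ω θ t ^ a * supKernel m μ θ ε t ≤
      (2 ^ θ * (4 * (C₁ + 1))) ^ a * ((⨆ z, F k z) / ω (Iic (x (k + 2)))) := by
    intro t ht
    rw [supKernel, ENNReal.mul_iSup]
    refine iSup_le fun y => ?_
    rw [ENNReal.mul_iSup]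
    refine iSup_le fun hy => ?_
    have hxy : x (k + 1) < y := ht.1.trans hy
    calc headKernel μ ω θ t ^ a * (μ (Ioc t y) ^ θ * m (Ioi y) ^ ε)
        ≤ (2 ^ θ * (4 * (C₁ + 1)) * (e k y + S k)) ^ a *
            (μ (Ioc (x (k + 1)) y) ^ θ * m (Ioi y) ^ ε) := by
          refine mul_le_mul' (ENNReal.rpow_le_rpow (hpt k t ht y hy) ha) ?_
          exact mul_le_mul_left (ENNReal.rpow_le_rpow (measure_mono
            (Ioc_subset_Ioc_left ht.1.le)) hθ.le) _
      _ = (2 ^ θ * (4 * (C₁ + 1))) ^ a *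
            ((e k y + S k) ^ a * μ (Ioc (x (k + 1)) y) ^ θ * m (Ioi y) ^ ε) := by
          rw [ENNReal.mul_rpow_of_nonneg _ _ ha]; ring
      _ ≤ _ := by
          refine mul_le_mul_right ?_ _
          rw [ENNReal.le_div_iff_mul_le (Or.inl hc0) (Or.inl hct)]
          refine le_trans (le_of_eq ?_) (le_iSup (F k) ⟨y - x (k + 1), sub_pos.2 hxy⟩)
          simp only [hF, add_sub_cancel, he]
          ring
  refine (hx.setLIntegral_Ioc_le hb).trans_eq ?_
  rw [← hx.two_mul_measure_Iic_succ (k + 1), hD]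
  calc _ = 2 * (2 ^ θ * (4 * (C₁ + 1))) ^ a *
        ((⨆ z, F k z) / ω (Iic (x (k + 2))) * ω (Iic (x (k + 2)))) := by ring
    _ = _ := by rw [ENNReal.div_mul_cancel hc0 hct]

theorem measure_Iic_ne_top_of_iterated {p q r : ℝ} (hp : 0 < p) (hq : 0 < q) (hr : 0 < r)
    {m μ ω : Measure ℝ} (hm : ∀ t, 0 < t → m (Ioi t) ≠ ∞) (hm0 : ∀ t, m (Ioi t) ≠ 0)
    (hμ : ∀ s t, 0 ≤ s → s < t → μ (Ioc s t) ≠ 0) {K : ℝ≥0∞} (hK : K ≠ ∞)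
    (hineq : ∀ f : ℝ → ℝ≥0∞, Measurable f →
      ∫⁻ x, (∫⁻ t in Ioi x, (∫⁻ s in Ioi t, f s ∂m) ^ r ∂μ) ^ (q / r) ∂ω ≤
        K * (∫⁻ t, f t ^ p ∂m) ^ (q / p)) (T : ℝ) :
    ω (Iic T) ≠ ∞ := by
  wlog hT : 0 < T generalizing T
  · exact ne_top_of_le_ne_top (this 1 one_pos)
      (monotone_measure_Iic ω ((not_lt.1 hT).trans zero_le_one))
  intro htop
  have hθ : 0 < q / r := by positivity
  set b := T + 1 with hb
  have hb0 : 0 < b := by positivity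
  have h := hineq ((Ioi b).indicator 1) (measurable_one.indicator measurableSet_Ioi)
  have hR : ∫⁻ t, (Ioi b).indicator (1 : ℝ → ℝ≥0∞) t ^ p ∂m = m (Ioi b) := by
    rw [← lintegral_indicator_one measurableSet_Ioi]
    refine lintegral_congr fun t => ?_
    by_cases ht : t ∈ Ioi b
    · simp [indicator_of_mem ht]
    · simp [indicator_of_notMem ht, hp]
  rw [hR] at h
  have hinner : ∀ t ≤ b, (∫⁻ s in Ioi t, (Ioi b).indicator (1 : ℝ → ℝ≥0∞) s ∂m) = m (Ioi b) := by
    intro t ht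
    rw [lintegral_indicator_one measurableSet_Ioi, Measure.restrict_apply measurableSet_Ioi,
      inter_eq_left.2 (Ioi_subset_Ioi ht)]
  have hL : ∞ ≤ ∫⁻ x, (∫⁻ t in Ioi x,
      (∫⁻ s in Ioi t, (Ioi b).indicator (1 : ℝ → ℝ≥0∞) s ∂m) ^ r ∂μ) ^ (q / r) ∂ω := by
    calc ∞ = ∫⁻ _ in Iic T, (m (Ioi b) ^ r * μ (Ioc T b)) ^ (q / r) ∂ω := by
          rw [setLIntegral_const, htop, ENNReal.mul_top]
          rw [Ne, ENNReal.rpow_eq_zero_iff_of_pos hθ, mul_eq_zero,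
            ENNReal.rpow_eq_zero_iff_of_pos hr, not_or]
          exact ⟨hm0 b, hμ T b hT.le (by linarith)⟩
      _ ≤ ∫⁻ x in Iic T, (∫⁻ t in Ioi x,
            (∫⁻ s in Ioi t, (Ioi b).indicator (1 : ℝ → ℝ≥0∞) s ∂m) ^ r ∂μ) ^ (q / r) ∂ω := by
          refine setLIntegral_mono' measurableSet_Iic fun x hx => ENNReal.rpow_le_rpow ?_ hθ.le
          rw [← setLIntegral_const]
          refine (setLIntegral_mono' measurableSet_Ioc fun t ht => ?_).trans
            (lintegral_mono_set (Ioc_subset_Ioi_self.trans (Ioi_subset_Ioi hx)))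
          rw [hinner t ht.2]
      _ ≤ _ := setLIntegral_le_lintegral _ _
  refine absurd (hL.trans h) (not_le.2 (ENNReal.mul_lt_top hK.lt_top ?_))
  exact (ENNReal.rpow_ne_top_of_nonneg (by positivity) (hm b hb0)).lt_top

theorem tailKernel_ne_zero {m μ : Measure ℝ} {γ e t : ℝ} (hγ : 0 ≤ γ) (he : 0 ≤ e) (ht : 0 ≤ t)
    (hm0 : ∀ t, m (Ioi t) ≠ 0) (hμ : ∀ s t, 0 ≤ s → s < t → μ (Ioc s t) ≠ 0) :
    tailKernel m μ γ e t ≠ 0 := by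
  have hne : ∀ {y : ℝ≥0∞} {c : ℝ}, 0 ≤ c → y ≠ 0 → y ^ c ≠ 0 := fun {y c} hc hy => by
    simp [ENNReal.rpow_eq_zero_iff, hy, not_lt.2 hc]
  have h : μ (Ioc t (t + 1)) ^ γ * m (Ioi (t + 2)) ^ e * μ (Ioc (t + 1) (t + 2)) ≤
      tailKernel m μ γ e t := by
    rw [← setLIntegral_const]
    refine (setLIntegral_mono' measurableSet_Ioc fun x hx => mul_le_mul' ?_ ?_).trans
      (lintegral_mono_set (Ioc_subset_Ioi_self.trans (Ioi_subset_Ioi (by linarith))))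
    · exact ENNReal.rpow_le_rpow (measure_mono (Ioc_subset_Ioc_right hx.1.le)) hγ
    · exact ENNReal.rpow_le_rpow (antitone_measure_Ioi m hx.2) he
  refine fun h0 => absurd (h.trans h0.le) (not_le.2 (pos_iff_ne_zero.2 ?_))
  exact mul_ne_zero (mul_ne_zero (hne hγ (hμ _ _ ht (by linarith))) (hne he (hm0 _)))
    (hμ _ _ (by linarith) (by linarith))

theorem measure_Iic_ne_top_of_lintegral_tailKernel {m μ ω : Measure ℝ} {γ e a β : ℝ} (hγ : 0 ≤ γ)
    (he : 0 ≤ e) (ha : 0 < a) (hβ : 0 ≤ β) (hm0 : ∀ t, m (Ioi t) ≠ 0)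
    (hμ : ∀ s t, 0 ≤ s → s < t → μ (Ioc s t) ≠ 0) (hω : ∀ s t, 0 ≤ s → s < t → ω (Ioc s t) ≠ 0)
    (h : ∫⁻ t, ω (Iic t) ^ a * tailKernel m μ γ e t ^ β ∂ω ≠ ∞) (T : ℝ) : ω (Iic T) ≠ ∞ := by
  wlog hT : 0 < T generalizing T
  · exact ne_top_of_le_ne_top (this 1 one_pos)
      (monotone_measure_Iic ω ((not_lt.1 hT).trans zero_le_one))
  intro htop
  refine h (top_le_iff.1 ?_)
  calc ∞ = ∫⁻ _ in Ioc T (T + 1), ∞ ∂ω := by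
        rw [setLIntegral_const, ENNReal.top_mul (hω _ _ hT.le (by linarith))]
    _ ≤ ∫⁻ t in Ioc T (T + 1), ω (Iic t) ^ a * tailKernel m μ γ e t ^ β ∂ω := by
        refine setLIntegral_mono' measurableSet_Ioc fun t ht => ?_
        have h1 : ω (Iic t) = ∞ := top_le_iff.1 (htop.symm.le.trans (monotone_measure_Iic ω ht.1.le))
        rw [h1, ENNReal.top_rpow_of_pos ha, ENNReal.top_mul]
        have := tailKernel_ne_zero (m := m) (μ := μ) hγ he (hT.le.trans ht.1.le) hm0 hμ
        simp [ENNReal.rpow_eq_zero_iff, this, not_lt.2 hβ]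
    _ ≤ _ := setLIntegral_le_lintegral _ _

/-- The iterated Hardy inequality for general measures on the half-line. -/
theorem iterated_hardy_iff {p q r : ℝ} (hq : 0 < q) (hr : 0 < r) (hp : 1 < p) (hqp : q < p)
    (hrp : r < p) (m μ ω : Measure ℝ) [NullSingletonClass m] [SFinite m] [NullSingletonClass ω]
    (hm : ∀ t, 0 < t → m (Ioi t) ≠ ∞) (hm0 : ∀ t, m (Ioi t) ≠ 0)
    (hμ : ∀ s t, 0 ≤ s → s < t → μ (Ioc s t) ≠ 0) (h0 : ω (Iic 0) = 0)
    (hω : ∀ s t, 0 ≤ s → s < t → ω (Ioc s t) ≠ 0) :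
    (∃ C : ℝ≥0, 0 < C ∧ ∀ f : ℝ → ℝ≥0∞, Measurable f →
        (∫⁻ x, (∫⁻ t in Ioi x, (∫⁻ s in Ioi t, f s ∂m) ^ r ∂μ) ^ (q / r) ∂ω) ^ (1 / q) ≤
          C * (∫⁻ t, f t ^ p ∂m) ^ (1 / p)) ↔
      (∫⁻ t, headKernel μ ω (q / r) t ^ (q / (p - q)) *
        supKernel m μ (q / r) ((p - 1) * q / (p - q)) t ∂ω) < ∞ ∧
      (∫⁻ t, ω (Iic t) ^ (q / (p - q)) *
        tailKernel m μ (r / (p - r)) ((p - 1) * r / (p - r)) t ^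
          (q * (p - r) / (r * (p - q))) ∂ω) < ∞ := by
  have hp0 : 0 < p := by linarith
  have hp1 : 0 < p - 1 := by linarith
  have hpq : 0 < p - q := by linarith
  have hpr : 0 < p - r := by linarith
  have hpos : ∀ t, 0 < t → ω (Iic t) ≠ 0 := fun t ht h =>
    hω 0 t le_rfl ht (measure_mono_null Ioc_subset_Iic_self h)
  constructor
  · rintro ⟨C, -, hC⟩
    have hK : (C : ℝ≥0∞) ^ q ≠ ∞ := ENNReal.rpow_ne_top_of_nonneg hq.le (by simp)
    have hineq : ∀ f : ℝ → ℝ≥0∞, Measurable f →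
        ∫⁻ x, (∫⁻ t in Ioi x, (∫⁻ s in Ioi t, f s ∂m) ^ r ∂μ) ^ (q / r) ∂ω ≤
          (C : ℝ≥0∞) ^ q * (∫⁻ t, f t ^ p ∂m) ^ (q / p) := by
      intro f hf
      have h := hC f hf
      rw [one_div, ENNReal.rpow_inv_le_iff hq, ENNReal.mul_rpow_of_nonneg _ _ hq.le,
        ← ENNReal.rpow_mul, one_div_mul_eq_div] at h
      exact h
    have hfin := measure_Iic_ne_top_of_iterated hp0 hq hr hm hm0 hμ hK hineq
    obtain ⟨C₁, h1⟩ := exists_lintegral_headKernel_le hp hq hr hqp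
    obtain ⟨C₂, h2⟩ := exists_lintegral_tailKernel_le hp hq hr hqp hrp
    have hKp : ∀ D : ℝ≥0, (D : ℝ≥0∞) * ((C : ℝ≥0∞) ^ q) ^ (p / (p - q)) < ∞ := fun D =>
      ENNReal.mul_lt_top (by simp) (ENNReal.rpow_ne_top_of_nonneg (by positivity) hK).lt_top
    exact ⟨(h1 m μ ω hm hm0 h0 hpos hfin _ hK hineq).trans_lt (hKp _),
      (h2 m μ ω hm hm0 h0 hpos hfin _ hK hineq).trans_lt (hKp _)⟩
  · rintro ⟨h1, h2⟩
    have hfin := measure_Iic_ne_top_of_lintegral_tailKernel (by positivity) (by positivity)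
      (by positivity) (by positivity) hm0 hμ hω h2.ne
    obtain ⟨C₀, hC₀⟩ := exists_iterated_hardy_le hp hq hr hqp hrp
    have hA := ENNReal.add_ne_top.2 ⟨h1.ne, h2.ne⟩
    have hCt := ENNReal.mul_ne_top (a := (C₀ : ℝ≥0∞)) (by simp)
      (ENNReal.rpow_ne_top_of_nonneg (y := (p - q) / p) (by positivity) hA)
    have hC := fun f hf hft => hC₀ m μ ω hm h0 hpos hfin f hf hft
    revert hCt hC
    generalize (C₀ : ℝ≥0∞) * _ = A
    intro hAt hC
    have hB : A ^ (1 / q) ≠ ∞ := ENNReal.rpow_ne_top_of_nonneg (by positivity) hAt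
    refine ⟨(A ^ (1 / q)).toNNReal + 1, by positivity, fun f hf => ?_⟩
    rw [ENNReal.coe_add, ENNReal.coe_toNNReal hB, ENNReal.coe_one]
    rcases eq_or_ne (∫⁻ t, f t ^ p ∂m) ∞ with hF | hF
    · rw [hF, ENNReal.top_rpow_of_pos (by positivity), ENNReal.mul_top (by simp)]
      exact le_top
    · refine le_trans ?_ (mul_le_mul_left le_self_add _)
      refine (ENNReal.rpow_le_rpow (hC f hf hF) (by positivity)).trans_eq ?_
      rw [ENNReal.mul_rpow_of_nonneg _ _ (by positivity), ← ENNReal.rpow_mul]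
      congr 2
      field_simp

section Density

variable {φ : ℝ → ℝ≥0∞}

theorem lintegral_mu0_withDensity (hφ : IsWeight φ) (g : ℝ → ℝ≥0∞) :
    ∫⁻ t, g t ∂(mu0.withDensity φ) = ∫⁻ t in Ioi 0, φ t * g t :=
  lintegral_withDensity_eq_lintegral_mul_non_measurable _ hφ.1 (hφ.2.mono fun _ h => h.2) g

theorem setLIntegral_mu0_withDensity (hφ : IsWeight φ) (g : ℝ → ℝ≥0∞) {S : Set ℝ}
    (hS : MeasurableSet S) :
    ∫⁻ t in S, g t ∂(mu0.withDensity φ) = ∫⁻ t in S ∩ Ioi 0, φ t * g t := by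
  rw [setLIntegral_withDensity_eq_setLIntegral_mul_non_measurable _ hφ.1 _ hS
    (ae_restrict_of_ae (hφ.2.mono fun _ h => h.2)), mu0, Measure.restrict_restrict hS]
  rfl

theorem mu0_withDensity_apply (φ : ℝ → ℝ≥0∞) {S : Set ℝ} (hS : MeasurableSet S) :
    (mu0.withDensity φ) S = ∫⁻ t in S ∩ Ioi 0, φ t := by
  rw [withDensity_apply _ hS, mu0, Measure.restrict_restrict hS]

theorem Ioi_inter_Ioi_zero {t : ℝ} (ht : 0 ≤ t) : Ioi t ∩ Ioi 0 = Ioi t :=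
  inter_eq_left.2 (Ioi_subset_Ioi ht)

theorem Ioc_inter_Ioi_zero {s t : ℝ} (hs : 0 ≤ s) : Ioc s t ∩ Ioi 0 = Ioc s t :=
  inter_eq_left.2 (Ioc_subset_Ioi_self.trans (Ioi_subset_Ioi hs))

theorem mu0_withDensity_Ioc (φ : ℝ → ℝ≥0∞) {s t : ℝ} (hs : 0 ≤ s) :
    (mu0.withDensity φ) (Ioc s t) = ∫⁻ τ in Ioc s t, φ τ := by
  rw [mu0_withDensity_apply φ measurableSet_Ioc, Ioc_inter_Ioi_zero hs]

theorem mu0_withDensity_Ioi (φ : ℝ → ℝ≥0∞) {t : ℝ} (ht : 0 ≤ t) :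
    (mu0.withDensity φ) (Ioi t) = ∫⁻ τ in Ioi t, φ τ := by
  rw [mu0_withDensity_apply φ measurableSet_Ioi, Ioi_inter_Ioi_zero ht]

theorem mu0_withDensity_Iic (φ : ℝ → ℝ≥0∞) (t : ℝ) :
    (mu0.withDensity φ) (Iic t) = ∫⁻ τ in Ioc 0 t, φ τ := by
  rw [mu0_withDensity_apply φ measurableSet_Iic, Iic_inter_Ioi]

theorem mu0_withDensity_Ioc_ne_zero (hφ : IsWeight φ) {s t : ℝ} (hs : 0 ≤ s) (hst : s < t) :
    (mu0.withDensity φ) (Ioc s t) ≠ 0 := by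
  intro h
  have h1 := withDensity_absolutelyContinuous' hφ.1.aemeasurable
    (hφ.2.mono fun _ h => h.1.ne') h
  rw [mu0, Measure.restrict_apply measurableSet_Ioc, Ioc_inter_Ioi_zero hs] at h1
  rw [Real.volume_Ioc, ENNReal.ofReal_eq_zero] at h1
  linarith

theorem mu0_withDensity_Ioi_ne_zero (hφ : IsWeight φ) (t : ℝ) :
    (mu0.withDensity φ) (Ioi t) ≠ 0 := fun h =>
  mu0_withDensity_Ioc_ne_zero hφ (le_max_right t 0) (lt_add_one _)
    (measure_mono_null (Ioc_subset_Ioi_self.trans (Ioi_subset_Ioi (le_max_left t 0))) h)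

instance (φ : ℝ → ℝ≥0∞) : NullSingletonClass (mu0.withDensity φ) where
  measure_singleton x := by
    refine withDensity_absolutelyContinuous _ _ ?_
    rw [mu0]
    exact measure_singleton x

instance (φ : ℝ → ℝ≥0∞) : SFinite (mu0.withDensity φ) := by
  unfold mu0
  infer_instance

theorem IsWeight.rpow (hφ : IsWeight φ) (y : ℝ) : IsWeight fun t => φ t ^ y :=
  ⟨hφ.1.pow_const y, hφ.2.mono fun _ h =>
    ⟨ENNReal.rpow_pos h.1 h.2.ne, (ENNReal.rpow_ne_top_of_ne_zero h.1.ne' h.2.ne).lt_top⟩⟩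

end Density

section Translation

variable {u w v σ : ℝ → ℝ≥0∞}

theorem iterated_integral_eq (hσ : IsWeight σ) (hu : IsWeight u) (hw : IsWeight w) {r θ : ℝ}
    {f h : ℝ → ℝ≥0∞} (hfh : ∀ᵐ t ∂mu0, h t = σ t * f t) :
    ∫⁻ x, (∫⁻ t in Ioi x, (∫⁻ s in Ioi t, f s ∂(mu0.withDensity σ)) ^ r
        ∂(mu0.withDensity u)) ^ θ ∂(mu0.withDensity w) =
      ∫⁻ x in Ioi 0, (∫⁻ t in Ioi x, (∫⁻ s in Ioi t, h s) ^ r * u t) ^ θ * w x := by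
  rw [lintegral_mu0_withDensity hw]
  refine setLIntegral_congr_fun measurableSet_Ioi fun x hx => ?_
  rw [mul_comm, setLIntegral_mu0_withDensity hu _ measurableSet_Ioi, Ioi_inter_Ioi_zero hx.le]
  congr 2
  refine setLIntegral_congr_fun measurableSet_Ioi fun t ht => ?_
  have ht0 : (0 : ℝ) ≤ t := (hx.trans ht).le
  rw [mul_comm, setLIntegral_mu0_withDensity hσ _ measurableSet_Ioi, Ioi_inter_Ioi_zero ht0]
  congr 2
  refine lintegral_congr_ae ?_
  filter_upwards [ae_restrict_of_ae_restrict_of_subset (Ioi_subset_Ioi ht0) hfh] with s hs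
  exact hs.symm

theorem headKernel_mu0 (hw : IsWeight w) {θ t : ℝ} :
    headKernel (mu0.withDensity u) (mu0.withDensity w) θ t =
      ∫⁻ s in Ioc 0 t, w s * (∫⁻ τ in Ioc s t, u τ) ^ θ := by
  rw [headKernel, setLIntegral_mu0_withDensity hw _ measurableSet_Iic, Iic_inter_Ioi]
  refine setLIntegral_congr_fun measurableSet_Ioc fun s hs => ?_
  rw [mu0_withDensity_Ioc u hs.1.le]

theorem supKernel_mu0 {θ ε t : ℝ} (ht : 0 ≤ t) :
    supKernel (mu0.withDensity σ) (mu0.withDensity u) θ ε t =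
      ⨆ x ∈ Ioi t, (∫⁻ τ in Ioc t x, u τ) ^ θ * (∫⁻ τ in Ioi x, σ τ) ^ ε := by
  refine iSup_congr fun x => iSup_congr fun hx => ?_
  rw [mu0_withDensity_Ioc u ht, mu0_withDensity_Ioi σ (ht.trans (le_of_lt hx))]

theorem tailKernel_mu0 (hu : IsWeight u) {γ e t : ℝ} (ht : 0 ≤ t) :
    tailKernel (mu0.withDensity σ) (mu0.withDensity u) γ e t =
      ∫⁻ x in Ioi t, (∫⁻ τ in Ioc t x, u τ) ^ γ * u x * (∫⁻ τ in Ioi x, σ τ) ^ e := by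
  rw [tailKernel, setLIntegral_mu0_withDensity hu _ measurableSet_Ioi, Ioi_inter_Ioi_zero ht]
  refine setLIntegral_congr_fun measurableSet_Ioi fun x hx => ?_
  rw [mu0_withDensity_Ioc u ht, mu0_withDensity_Ioi σ (ht.trans (le_of_lt hx))]
  ring

theorem rpow_mul_eq_mul_rpow_conjugate {p : ℝ} (hp : 1 < p) {y z : ℝ≥0∞} (hy : 0 < y)
    (hy' : y < ∞) :
    (y ^ (1 - p / (p - 1)) * z) ^ p * y = y ^ (1 - p / (p - 1)) * z ^ p := by
  have hp1 : p - 1 ≠ 0 := by linarith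
  rw [ENNReal.mul_rpow_of_nonneg _ _ (by linarith), ← ENNReal.rpow_mul, mul_right_comm]
  congr 1
  nth_rw 2 [← ENNReal.rpow_one y]
  rw [← ENNReal.rpow_add _ _ hy.ne' hy'.ne]
  congr 1
  field_simp
  ring

end Translation

theorem statement19 (p q r : ℝ) (hq : 0 < q) (hr : 0 < r) (hp : 1 < p) (hqp : q < p) (hrp : r < p)
    (u w v : ℝ → ℝ≥0∞) (hu : IsWeight u) (hw : IsWeight w) (hv : IsWeight v)
    (hvfin : ∀ x ∈ Ioi (0 : ℝ), (∫⁻ t in Ioi x, v t ^ (1 - p / (p - 1))) < ∞) :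
    (∃ C : ℝ≥0, 0 < C ∧ ∀ h : ℝ → ℝ≥0∞, Measurable h →
        (∫⁻ x in Ioi (0 : ℝ),
            (∫⁻ t in Ioi x, (∫⁻ s in Ioi t, h s) ^ r * u t) ^ (q / r) * w x) ^
          (1 / q) ≤
          (C : ℝ≥0∞) * (∫⁻ t in Ioi (0 : ℝ), h t ^ p * v t) ^ (1 / p)) ↔
      (((∫⁻ t in Ioi (0 : ℝ),
        (∫⁻ s in Ioc (0 : ℝ) t, w s * (∫⁻ τ in Ioc s t, u τ) ^ (q / r)) ^ (q / (p - q)) *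
          (w t *
            ⨆ x ∈ Ioi t, (∫⁻ τ in Ioc t x, u τ) ^ (q / r) *
              (∫⁻ τ in Ioi x, v τ ^ (1 - p / (p - 1))) ^ ((p - 1) * q / (p - q)))) ^
        ((p - q) / (p * q))) < ∞ ∧
      ((∫⁻ t in Ioi (0 : ℝ),
        (∫⁻ s in Ioc (0 : ℝ) t, w s) ^ (q / (p - q)) * w t *
          (∫⁻ x in Ioi t,
              (∫⁻ τ in Ioc t x, u τ) ^ (r / (p - r)) * u x *
                (∫⁻ τ in Ioi x, v τ ^ (1 - p / (p - 1))) ^ ((p - 1) * r / (p - r))) ^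
            (q * (p - r) / (r * (p - q)))) ^ ((p - q) / (p * q))) < ∞) := by
  set σ : ℝ → ℝ≥0∞ := fun t => v t ^ (1 - p / (p - 1)) with hσ_def
  have hσ : IsWeight σ := hv.rpow _
  have hp0 : 0 < p := by linarith
  have hpq : 0 < p - q := by linarith
  have hnorm : ∀ f h : ℝ → ℝ≥0∞, (∀ᵐ t ∂mu0, h t = σ t * f t) →
      ∫⁻ t, f t ^ p ∂(mu0.withDensity σ) = ∫⁻ t in Ioi 0, h t ^ p * v t := by
    intro f h hfh
    rw [lintegral_mu0_withDensity hσ]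
    refine lintegral_congr_ae ?_
    filter_upwards [hfh, hv.2] with t ht hvt
    rw [ht, rpow_mul_eq_mul_rpow_conjugate hp hvt.1 hvt.2]
  have hiff := iterated_hardy_iff hq hr hp hqp hrp (mu0.withDensity σ) (mu0.withDensity u)
    (mu0.withDensity w) (fun t ht => by
      rw [mu0_withDensity_Ioi σ ht.le]; exact (hvfin t ht).ne)
    (mu0_withDensity_Ioi_ne_zero hσ) (fun s t hs hst => mu0_withDensity_Ioc_ne_zero hu hs hst)
    (by rw [mu0_withDensity_Iic]; simp) (fun s t hs hst => mu0_withDensity_Ioc_ne_zero hw hs hst)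
  have h3 : ∫⁻ t, headKernel (mu0.withDensity u) (mu0.withDensity w) (q / r) t ^ (q / (p - q)) *
        supKernel (mu0.withDensity σ) (mu0.withDensity u) (q / r) ((p - 1) * q / (p - q)) t
          ∂(mu0.withDensity w) =
      ∫⁻ t in Ioi (0 : ℝ),
        (∫⁻ s in Ioc (0 : ℝ) t, w s * (∫⁻ τ in Ioc s t, u τ) ^ (q / r)) ^ (q / (p - q)) *
          (w t *
            ⨆ x ∈ Ioi t, (∫⁻ τ in Ioc t x, u τ) ^ (q / r) *
              (∫⁻ τ in Ioi x, σ τ) ^ ((p - 1) * q / (p - q))) := by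
    rw [lintegral_mu0_withDensity hw]
    refine setLIntegral_congr_fun measurableSet_Ioi fun t ht => ?_
    rw [headKernel_mu0 hw, supKernel_mu0 (le_of_lt ht), mul_left_comm]
  have h5 : ∫⁻ t, (mu0.withDensity w) (Iic t) ^ (q / (p - q)) *
        tailKernel (mu0.withDensity σ) (mu0.withDensity u) (r / (p - r))
          ((p - 1) * r / (p - r)) t ^ (q * (p - r) / (r * (p - q))) ∂(mu0.withDensity w) =
      ∫⁻ t in Ioi (0 : ℝ),
        (∫⁻ s in Ioc (0 : ℝ) t, w s) ^ (q / (p - q)) * w t *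
          (∫⁻ x in Ioi t,
              (∫⁻ τ in Ioc t x, u τ) ^ (r / (p - r)) * u x *
                (∫⁻ τ in Ioi x, σ τ) ^ ((p - 1) * r / (p - r))) ^
            (q * (p - r) / (r * (p - q))) := by
    rw [lintegral_mu0_withDensity hw]
    refine setLIntegral_congr_fun measurableSet_Ioi fun t ht => ?_
    rw [mu0_withDensity_Iic, tailKernel_mu0 hu (le_of_lt ht), ← mul_assoc, mul_comm (w t)]
  have hs : 0 < (p - q) / (p * q) := by positivity
  rw [ENNReal.rpow_lt_top_iff_of_pos hs, ENNReal.rpow_lt_top_iff_of_pos hs, ← h3, ← h5, ← hiff]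
  refine exists_congr fun C => and_congr_right fun _ => ⟨fun H f hf => ?_, fun H h hh => ?_⟩
  · have hfh : ∀ᵐ t ∂mu0, σ t * f t = σ t * f t := .of_forall fun _ => rfl
    rw [iterated_integral_eq hσ hu hw hfh, hnorm _ _ hfh]
    exact H _ (hσ.1.mul hf)
  · have hfh : ∀ᵐ t ∂mu0, h t = σ t * (h t / σ t) := hσ.2.mono fun t ht =>
      (ENNReal.mul_div_cancel ht.1.ne' ht.2.ne).symm
    rw [← iterated_integral_eq hσ hu hw hfh, ← hnorm _ _ hfh]
    exact H _ (hh.div hσ.1)
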